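/- Interior Harnack inequality with critical drift: Let Y = (y,s) ∈ ℝ^{n+1}, r > 0, and let u ∈ C^{2,1}(Q_{2r}(Y)) ∩ C(closure of Q_{2r}(Y)) satisfy u ≥ 0 and −u_t + Lu = 0 at every point of Q_{2r}(Y). Then sup_{Q⁰} u ≤ N · inf_{Q_r(Y)} u, where Q⁰ := B_r(y) × (s−3r², s−2r²) and N is a positive constant depending only on n, ν and S. -/

import Mathlib

open MeasureTheory ENNReal Metric Set RealInnerProductSpace

noncomputable section

/-- `n`-dimensional Euclidean space. -/
abbrev En (n : ℕ) : Type := EuclideanSpace ℝ (Fin n)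

variable {n : ℕ}

/-- Time derivative `u_t`. -/
def Dt (u : En n × ℝ → ℝ) (X : En n × ℝ) : ℝ :=
  deriv (fun t => u (X.1, t)) X.2

/-- First spatial derivative `D_i u`. -/
def Dx (u : En n × ℝ → ℝ) (i : Fin n) (X : En n × ℝ) : ℝ :=
  fderiv ℝ (fun x => u (x, X.2)) X.1 (EuclideanSpace.single i 1)

/-- Second spatial derivative `D_{ij} u`. -/
def Dxx (u : En n × ℝ → ℝ) (i j : Fin n) (X : En n × ℝ) : ℝ :=
  Dx (Dx u j) i X

/-- `u` is of class `C^{2,1}` on `Q`: `u`, `D_i u`, `D_{ij} u`, `u_t` exist and are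
continuous on `Q`. -/
structure IsC21 (u : En n × ℝ → ℝ) (Q : Set (En n × ℝ)) : Prop where
  cont : ContinuousOn u Q
  diff_t : ∀ X ∈ Q, DifferentiableAt ℝ (fun t => u (X.1, t)) X.2
  diff_x : ∀ X ∈ Q, DifferentiableAt ℝ (fun x => u (x, X.2)) X.1
  diff_xx : ∀ j : Fin n, ∀ X ∈ Q, DifferentiableAt ℝ (fun x => Dx u j (x, X.2)) X.1
  cont_t : ContinuousOn (Dt u) Q
  cont_x : ∀ i, ContinuousOn (Dx u i) Q
  cont_xx : ∀ i j, ContinuousOn (Dxx u i j) Q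

/-- Uniform parabolicity with constant `ν` on `Q`:
`ν⁻¹|ξ|² ≤ Σ a_ij ξ_i ξ_j` and `Σ a_ij² ≤ ν²`. -/
def UnifParabolic (ν : ℝ) (a : En n × ℝ → Matrix (Fin n) (Fin n) ℝ)
    (Q : Set (En n × ℝ)) : Prop :=
  ∀ X ∈ Q, (∀ ξ : Fin n → ℝ, ν⁻¹ * (∑ i, ξ i ^ 2) ≤ ∑ i, ∑ j, a X i j * ξ i * ξ j) ∧
    (∑ i, ∑ j, (a X i j) ^ 2) ≤ ν ^ 2

/-- `Lu = Σ_{ij} a_ij D_ij u + Σ_i b_i D_i u`. -/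
def Lop (a : En n × ℝ → Matrix (Fin n) (Fin n) ℝ) (b : En n × ℝ → En n)
    (u : En n × ℝ → ℝ) (X : En n × ℝ) : ℝ :=
  (∑ i, ∑ j, a X i j * Dxx u i j X) + ∑ i, b X i * Dx u i X

/-- `∫ (ess sup_t |f(x,t)|)ⁿ dx`, the `n`-th power of the `L^n_x L^∞_t` norm of `f`
over the set `Q ⊆ ℝⁿ × ℝ`. -/
def LxnLtinfPow {E : Type*} [NNNorm E] (f : En n × ℝ → E) (Q : Set (En n × ℝ)) : ℝ≥0∞ :=
  ∫⁻ x, (essSup (fun t => (‖f (x, t)‖₊ : ℝ≥0∞)) (volume.restrict {t | (x, t) ∈ Q})) ^ n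

/-- The `L^n_x L^∞_t` norm of `f` over `Q`. -/
def LxnLtinf {E : Type*} [NNNorm E] (f : En n × ℝ → E) (Q : Set (En n × ℝ)) : ℝ≥0∞ :=
  (LxnLtinfPow f Q) ^ (1 / (n : ℝ))

/-- The box `B_ρ(y) × (t₁, t₂)`. -/
def box (y : En n) (ρ t₁ t₂ : ℝ) : Set (En n × ℝ) := ball y ρ ×ˢ Ioo t₁ t₂

/-- The standard parabolic cylinder `Q_r(Y) = B_r(y) × (s - r², s)`. -/
def pcyl (Y : En n × ℝ) (r : ℝ) : Set (En n × ℝ) := box Y.1 r (Y.2 - r ^ 2) Y.2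

/-- The slanted cylinder `V_r(Y) = {(x,t) : |x - (t/s)y| < r, 0 < t < s}`. -/
def slantCyl (Y : En n × ℝ) (r : ℝ) : Set (En n × ℝ) :=
  {X | ‖X.1 - (X.2 / Y.2) • Y.1‖ < r ∧ 0 < X.2 ∧ X.2 < Y.2}

/-- Supremum of the positive part `u₊` over a set `A`. -/
def supPos (u : En n × ℝ → ℝ) (A : Set (En n × ℝ)) : ℝ :=
  sSup ((fun X => max (u X) 0) '' A)

/-- `Ω` is a Lipschitz domain with character `(rΩ, mΩ)`: at every boundary point `y`
there is a coordinate frame, encoded by the unit "vertical" direction `e`, in which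
`Ω ∩ B_{rΩ}(y)` is the region above the graph of an `mΩ`-Lipschitz function `φ`
of the tangential variables. -/
def IsLipschitzDomain (Ω : Set (En n)) (rΩ mΩ : ℝ) : Prop :=
  0 < rΩ ∧ 0 ≤ mΩ ∧
  ∀ y ∈ frontier Ω, ∃ (e : En n) (φ : En n → ℝ),
    ‖e‖ = 1 ∧ LipschitzWith (Real.toNNReal mΩ) φ ∧ φ 0 = 0 ∧
    (∀ x, x ∈ Ω ∩ ball y rΩ ↔
      dist x y < rΩ ∧ φ ((x - y) - ⟪x - y, e⟫ • e) < ⟪x - y, e⟫) ∧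
    (∀ ρ : ℝ, 0 < ρ → ρ ≤ rΩ → y + ρ • e ∈ Ω)

section
open Asymptotics Filter Topology

/-- admissible coefficient matrices -/
def Ell (n : ℕ) (ν : ℝ) : Set (Matrix (Fin n) (Fin n) ℝ) :=
  {a | (∀ ξ : Fin n → ℝ, ν⁻¹ * (∑ i, ξ i ^ 2) ≤ ∑ i, ∑ j, a i j * ξ i * ξ j) ∧
    (∑ i, ∑ j, (a i j) ^ 2) ≤ ν ^ 2}

def qf (M : Matrix (Fin n) (Fin n) ℝ) (h : En n) : ℝ := ∑ i, ∑ j, M i j * h i * h j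

def dotM (a M : Matrix (Fin n) (Fin n) ℝ) : ℝ := ∑ i, ∑ j, a i j * M i j

/-- `v` satisfies the equation at `(x,t)` with some admissible matrix and a drift of size `β`. -/
def PtSol (ν : ℝ) (β : ℝ≥0∞) (v : En n × ℝ → ℝ) (x : En n) (t : ℝ) : Prop :=
  ∃ (c : ℝ) (G : En n) (M a : Matrix (Fin n) (Fin n) ℝ), a ∈ Ell n ν ∧ M.IsSymm ∧
    HasDerivAt (fun s => v (x, s)) c t ∧
    (fun h : En n => v (x + h, t) - v (x, t) - ⟪G, h⟫ - qf M h / 2) =o[𝓝 0] (fun h => ‖h‖ ^ 2) ∧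
    ENNReal.ofReal |c - dotM a M| ≤ β * ENNReal.ofReal ‖G‖

structure Sol (ν : ℝ) (β : En n → ℝ≥0∞) (Q : Set (En n × ℝ)) (v : En n × ℝ → ℝ) : Prop where
  cont : ContinuousOn v Q
  pt : ∀ X ∈ Q, PtSol ν (β X.1) v X.1 X.2

structure Drift (S : ℝ≥0∞) (β : En n → ℝ≥0∞) : Prop where
  lsc : LowerSemicontinuous β
  int : ∫⁻ x, β x ^ n ≤ S

lemma Sol.mono {ν : ℝ} {β : En n → ℝ≥0∞} {Q Q' : Set (En n × ℝ)} {v : En n × ℝ → ℝ}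
    (h : Sol ν β Q v) (hQ : Q' ⊆ Q) : Sol ν β Q' v :=
  ⟨h.cont.mono hQ, fun X hX => h.pt X (hQ hX)⟩

lemma Drift.mono {S S' : ℝ≥0∞} {β : En n → ℝ≥0∞} (h : Drift S β) (hS : S ≤ S') : Drift S' β :=
  ⟨h.lsc, h.int.trans hS⟩

lemma qf_smul (M : Matrix (Fin n) (Fin n) ℝ) (c : ℝ) (h : En n) : qf (c • M) h = c * qf M h := by
  simp [qf, Finset.mul_sum, mul_assoc]

lemma qf_smul_right (M : Matrix (Fin n) (Fin n) ℝ) (c : ℝ) (h : En n) :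
    qf M (c • h) = c ^ 2 * qf M h := by
  simp only [qf, Finset.mul_sum, PiLp.smul_apply, smul_eq_mul]
  refine Finset.sum_congr rfl fun i _ => Finset.sum_congr rfl fun j _ => by ring

lemma dotM_smul (a M : Matrix (Fin n) (Fin n) ℝ) (c : ℝ) : dotM a (c • M) = c * dotM a M := by
  simp only [dotM, Finset.mul_sum, Matrix.smul_apply, smul_eq_mul]
  refine Finset.sum_congr rfl fun i _ => Finset.sum_congr rfl fun j _ => by ring

lemma PtSol.affine {ν : ℝ} {β : ℝ≥0∞} {v : En n × ℝ → ℝ} {x : En n} {t : ℝ}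
    (h : PtSol ν β v x t) (A B : ℝ) : PtSol ν β (fun X => A * v X + B) x t := by
  obtain ⟨c, G, M, a, ha, hM, hc, ho, hb⟩ := h
  refine ⟨A * c, A • G, A • M, a, ha, hM.smul A, (hc.const_mul A).add_const B, ?_, ?_⟩
  · refine (ho.const_mul_left A).congr_left fun h => ?_
    simp only [qf_smul, real_inner_smul_left]; ring
  · rw [dotM_smul, ← mul_sub, abs_mul, norm_smul, Real.norm_eq_abs, ENNReal.ofReal_mul (abs_nonneg _),
      ENNReal.ofReal_mul (abs_nonneg _)]
    calc _ ≤ ENNReal.ofReal |A| * (β * ENNReal.ofReal ‖G‖) := by gcongr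
      _ = _ := by ring

lemma Sol.affine {ν : ℝ} {β : En n → ℝ≥0∞} {Q : Set (En n × ℝ)} {v : En n × ℝ → ℝ}
    (h : Sol ν β Q v) (A B : ℝ) : Sol ν β Q (fun X => A * v X + B) :=
  ⟨(h.cont.const_smul A).add continuousOn_const, fun X hX => (h.pt X hX).affine A B⟩

/-- parabolic rescaling map -/
def psc (y : En n) (s ρ : ℝ) (X : En n × ℝ) : En n × ℝ := (y + ρ • X.1, s + ρ ^ 2 * X.2)

lemma psc_cont (y : En n) (s ρ : ℝ) : Continuous (psc y s ρ) := by
  unfold psc; fun_prop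

lemma PtSol.scale {ν : ℝ} {β : ℝ≥0∞} {v : En n × ℝ → ℝ} {x : En n} {t : ℝ} {y : En n} {s ρ : ℝ}
    (hρ : 0 < ρ) (h : PtSol ν β v (y + ρ • x) (s + ρ ^ 2 * t)) :
    PtSol ν (ENNReal.ofReal ρ * β) (fun X => v (psc y s ρ X)) x t := by
  obtain ⟨c, G, M, a, ha, hM, hc, ho, hb⟩ := h
  refine ⟨ρ ^ 2 * c, ρ • G, ρ ^ 2 • M, a, ha, hM.smul _, ?_, ?_, ?_⟩
  · have h1 : HasDerivAt (fun t' : ℝ => s + ρ ^ 2 * t') (ρ ^ 2) t := by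
      simpa using ((hasDerivAt_id t).const_mul (ρ ^ 2)).const_add s
    have := HasDerivAt.comp t hc h1
    rw [mul_comm]
    exact this
  · have ht : Tendsto (fun h : En n => ρ • h) (𝓝 0) (𝓝 0) := by
      have : Continuous (fun h : En n => ρ • h) := by fun_prop
      simpa using this.tendsto 0
    have := ho.comp_tendsto ht
    have h2 : ((fun h : En n => ‖h‖ ^ 2) ∘ fun h : En n => ρ • h) =O[𝓝 0]
        (fun h : En n => ‖h‖ ^ 2) := by
      refine (isBigO_const_mul_self (ρ ^ 2) (fun h : En n => ‖h‖ ^ 2) _).congr_left fun h => ?_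
      simp [norm_smul, mul_pow]
    refine (this.trans_isBigO h2).congr_left fun h => ?_
    simp only [Function.comp, psc, qf_smul, qf_smul_right, real_inner_smul_left,
      real_inner_smul_right, smul_add, add_assoc]
  · rw [dotM_smul, ← mul_sub, abs_mul, norm_smul, Real.norm_eq_abs, abs_of_pos hρ,
      abs_of_pos (by positivity), ENNReal.ofReal_mul (by positivity),
      ENNReal.ofReal_mul hρ.le]
    calc _ ≤ ENNReal.ofReal (ρ ^ 2) * (β * ENNReal.ofReal ‖G‖) := by gcongr
      _ = _ := by rw [ENNReal.ofReal_pow hρ.le]; ring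

lemma Sol.scale {ν : ℝ} {β : En n → ℝ≥0∞} {Q : Set (En n × ℝ)} {v : En n × ℝ → ℝ}
    (h : Sol ν β Q v) {y : En n} {s ρ : ℝ} (hρ : 0 < ρ) {Q' : Set (En n × ℝ)}
    (hQ : MapsTo (psc y s ρ) Q' Q) :
    Sol ν (fun x => ENNReal.ofReal ρ * β (y + ρ • x)) Q' (fun X => v (psc y s ρ X)) :=
  ⟨h.cont.comp (psc_cont y s ρ).continuousOn hQ, fun X hX => (h.pt _ (hQ hX)).scale hρ⟩

lemma lintegral_scale (f : En n → ℝ≥0∞) (hf : Measurable f) (y : En n) {ρ : ℝ} (hρ : 0 < ρ) :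
    ENNReal.ofReal ρ ^ n * ∫⁻ x, f (y + ρ • x) = ∫⁻ x, f x := by
  have h1 : ∫⁻ x, f (y + x) = ∫⁻ x, f x := lintegral_add_left_eq_self f y
  have h2 : Measurable (fun x : En n => f (y + x)) := by fun_prop
  have h3 := Measure.map_addHaar_smul (volume : Measure (En n)) hρ.ne'
  have h4 : ∫⁻ x, f (y + ρ • x) = ∫⁻ x, f (y + x) ∂(Measure.map (fun x : En n => ρ • x) volume) := by
    rw [lintegral_map h2 (by fun_prop)]
  rw [h4, h3, lintegral_smul_measure, h1, smul_eq_mul, ← mul_assoc]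
  have : ENNReal.ofReal ρ ^ n * ENNReal.ofReal |(ρ ^ Module.finrank ℝ (En n))⁻¹| = 1 := by
    rw [← ENNReal.ofReal_pow hρ.le, ← ENNReal.ofReal_mul (by positivity)]
    simp [abs_of_pos hρ, hρ.ne']
  rw [this, one_mul]

lemma Drift.meas {S : ℝ≥0∞} {β : En n → ℝ≥0∞} (h : Drift S β) : Measurable β := h.lsc.measurable

/-- local version of smallness of the drift -/
lemma Drift.scale_int {S : ℝ≥0∞} {β : En n → ℝ≥0∞} (h : Drift S β) (y : En n) {ρ : ℝ} (hρ : 0 < ρ) :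
    ∫⁻ x, (ENNReal.ofReal ρ * β (y + ρ • x)) ^ n = ∫⁻ x, β x ^ n := by
  simp_rw [mul_pow]
  have hm := h.meas
  rw [lintegral_const_mul _ (by fun_prop)]
  exact lintegral_scale (fun x => β x ^ n) (by fun_prop) y hρ

lemma Drift.scale {S : ℝ≥0∞} {β : En n → ℝ≥0∞} (h : Drift S β) (y : En n) {ρ : ℝ} (hρ : 0 < ρ) :
    Drift S (fun x => ENNReal.ofReal ρ * β (y + ρ • x)) := by
  refine ⟨?_, (h.scale_int y hρ).trans_le h.int⟩
  have h1 : LowerSemicontinuous (fun x => β (y + ρ • x)) := h.lsc.comp (by fun_prop)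
  have h2 : Continuous (fun z : ℝ≥0∞ => ENNReal.ofReal ρ * z) :=
    ENNReal.continuous_const_mul (by simp)
  exact h2.comp_lowerSemicontinuous h1 (fun a b hab => by dsimp; gcongr)

/-! matrix facts -/

lemma Ell.diag {ν : ℝ} (hν : 1 ≤ ν) {a : Matrix (Fin n) (Fin n) ℝ} (ha : a ∈ Ell n ν) :
    dotM a 1 ≤ n * ν := by
  have h1 : ∀ i, a i i ≤ ν := fun i => by
    have : a i i ^ 2 ≤ ν ^ 2 := by
      refine le_trans ?_ ha.2
      refine le_trans ?_ (Finset.single_le_sum (f := fun i => ∑ j, a i j ^ 2)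
        (fun i _ => Finset.sum_nonneg fun j _ => sq_nonneg _) (Finset.mem_univ i))
      exact Finset.single_le_sum (f := fun j => a i j ^ 2) (fun j _ => sq_nonneg _)
        (Finset.mem_univ i)
    exact abs_le_of_sq_le_sq' this (by linarith) |>.2
  have : dotM a 1 = ∑ i, a i i := by
    simp [dotM, Matrix.one_apply]
  rw [this]
  calc _ ≤ ∑ i : Fin n, ν := Finset.sum_le_sum fun i _ => h1 i
    _ = _ := by simp

lemma psd_fact {M : Matrix (Fin n) (Fin n) ℝ} (hM : M.IsSymm) (hp : ∀ h : En n, 0 ≤ qf M h) :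
    ∃ (m : ℕ) (B : Fin m → Fin n → ℝ), ∀ i j, M i j = ∑ k, B k i * B k j := by
  have h : M.PosSemidef := by
    refine Matrix.PosSemidef.of_dotProduct_mulVec_nonneg ?_ ?_
    · exact hM
    · intro x
      have h2 := hp (WithLp.toLp 2 x)
      unfold qf at h2
      have h3 : star x ⬝ᵥ M.mulVec x = ∑ i, ∑ j, M i j * x i * x j := by
        simp only [dotProduct, Matrix.mulVec, Finset.mul_sum, star_trivial]
        exact Finset.sum_congr rfl fun i _ => Finset.sum_congr rfl fun j _ => by ring
      rw [h3]; exact h2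
  obtain ⟨m, B, hB⟩ := Matrix.posSemidef_iff_eq_sum_vecMulVec.1 h
  refine ⟨m, B, fun i j => ?_⟩
  rw [hB]; simp [Matrix.sum_apply, Matrix.vecMulVec_apply]

lemma sum3 {m : ℕ} (B : Fin m → Fin n → ℝ) (f : Fin n → Fin n → ℝ) :
    ∑ i, ∑ j, (∑ k, B k i * B k j) * f i j = ∑ k, ∑ i, ∑ j, f i j * B k i * B k j := by
  simp only [Finset.sum_mul]
  calc _ = ∑ i, ∑ k, ∑ j, B k i * B k j * f i j :=
        Finset.sum_congr rfl fun i _ => Finset.sum_comm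
    _ = ∑ k, ∑ i, ∑ j, B k i * B k j * f i j := Finset.sum_comm
    _ = _ := Finset.sum_congr rfl fun k _ => Finset.sum_congr rfl fun i _ =>
        Finset.sum_congr rfl fun j _ => by ring

lemma trace_fact {M : Matrix (Fin n) (Fin n) ℝ} {m : ℕ} {B : Fin m → Fin n → ℝ}
    (hB : ∀ i j, M i j = ∑ k, B k i * B k j) : M.trace = ∑ k, ∑ i, B k i ^ 2 := by
  simp only [Matrix.trace, Matrix.diag, hB]
  rw [Finset.sum_comm]
  simp [sq]

lemma qf_le_trace {M : Matrix (Fin n) (Fin n) ℝ} (hM : M.IsSymm) (hp : ∀ h : En n, 0 ≤ qf M h)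
    (h : En n) : qf M h ≤ M.trace * ‖h‖ ^ 2 := by
  obtain ⟨m, B, hB⟩ := psd_fact hM hp
  have h1 : qf M h = ∑ k, (∑ i, B k i * h i) ^ 2 := by
    simp only [qf, hB, mul_assoc]
    rw [sum3 B (fun i j => h i * h j)]
    refine Finset.sum_congr rfl fun k _ => ?_
    rw [sq, Finset.sum_mul_sum]
    exact Finset.sum_congr rfl fun i _ => Finset.sum_congr rfl fun j _ => by ring
  rw [h1, trace_fact hB, EuclideanSpace.real_norm_sq_eq, Finset.sum_mul]
  exact Finset.sum_le_sum fun k _ => Finset.sum_mul_sq_le_sq_mul_sq _ _ _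

lemma trace_nonneg {M : Matrix (Fin n) (Fin n) ℝ} (hM : M.IsSymm) (hp : ∀ h : En n, 0 ≤ qf M h) :
    0 ≤ M.trace := by
  obtain ⟨m, B, hB⟩ := psd_fact hM hp
  rw [trace_fact hB]; positivity

lemma Ell.trace_le {ν : ℝ} {a : Matrix (Fin n) (Fin n) ℝ} (ha : a ∈ Ell n ν)
    {M : Matrix (Fin n) (Fin n) ℝ} (hM : M.IsSymm) (hp : ∀ h : En n, 0 ≤ qf M h) :
    ν⁻¹ * M.trace ≤ dotM a M := by
  obtain ⟨m, B, hB⟩ := psd_fact hM hp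
  have : dotM a M = ∑ k, ∑ i, ∑ j, a i j * B k i * B k j := by
    rw [← sum3 B (fun i j => a i j)]; simp only [dotM, hB]
    exact Finset.sum_congr rfl fun i _ => Finset.sum_congr rfl fun j _ => by ring
  rw [this, trace_fact hB, Finset.mul_sum]
  exact Finset.sum_le_sum fun k _ => ha.1 (B k)

end

section
open Asymptotics Filter Topology

def LS (ν : ℝ) (β : ℝ≥0∞) (w : En n × ℝ → ℝ) (x : En n) (t : ℝ) : Prop :=
  ∃ p : En n, (∀ (k : ℝ) (z : En n), IsLocalMin (fun y => w (y, t) + k / 2 * ‖y - z‖ ^ 2) x →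
      p = k • (z - x)) ∧
    ∀ (k : ℝ) (z : En n) (κ : ℝ), 0 ≤ k → IsLocalMin (fun y => w (y, t) + k / 2 * ‖y - z‖ ^ 2) x →
      (∀ᶠ s in 𝓝[<] t, w (x, t) + κ * (t - s) ≤ w (x, s)) →
      ∃ A : ℝ, 0 ≤ A ∧
        (∀ ε > 0, ∀ᶠ y in 𝓝 x, w (y, t) + k / 2 * ‖y - z‖ ^ 2 ≤
          w (x, t) + k / 2 * ‖x - z‖ ^ 2 + (A + ε) / 2 * ‖y - x‖ ^ 2) ∧
        ENNReal.ofReal (A / ν + κ + ‖p‖ ^ 2 / ν - n * ν * k) ≤ β * ENNReal.ofReal ‖p‖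

/-- Peano expansion for the logarithm -/
lemma log_peano {f : En n → ℝ} {G : En n} {M : Matrix (Fin n) (Fin n) ℝ}
    (hf : (fun h : En n => f h - ⟪G, h⟫ - qf M h / 2) =o[𝓝 0] (fun h => ‖h‖ ^ 2)) :
    (fun h : En n => Real.log (1 + f h) - ⟪G, h⟫ - (qf M h - ⟪G, h⟫ ^ 2) / 2) =o[𝓝 0]
      (fun h => ‖h‖ ^ 2) := by
  have hid : (fun h : En n => ‖h‖) =o[𝓝 0] (fun _ => (1 : ℝ)) := by
    rw [isLittleO_one_iff]; simpa using (continuous_norm (E := En n)).tendsto 0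
  have hn0 : (fun h : En n => ‖h‖ ^ 2) =O[𝓝 0] (fun h => ‖h‖) := by
    have := hid.isBigO.mul (isBigO_refl (fun h : En n => ‖h‖) (𝓝 0))
    simpa [sq] using this
  have hG : (fun h : En n => ⟪G, h⟫) =O[𝓝 0] (fun h => ‖h‖) := by
    refine IsBigO.of_bound ‖G‖ (Eventually.of_forall fun h => ?_)
    simpa using norm_inner_le_norm (𝕜 := ℝ) G h
  have hM : (fun h : En n => qf M h / 2) =O[𝓝 0] (fun h => ‖h‖ ^ 2) := by
    refine IsBigO.of_bound ((∑ i, ∑ j, |M i j|)) (Eventually.of_forall fun h => ?_)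
    have hh : ∀ i, |h i| ≤ ‖h‖ := fun i => by simpa using EuclideanSpace.norm_eq h ▸ PiLp.norm_apply_le h i
    rw [Real.norm_eq_abs, Real.norm_eq_abs, abs_div, abs_of_nonneg (sq_nonneg ‖h‖)]
    have : |qf M h| ≤ (∑ i, ∑ j, |M i j|) * ‖h‖ ^ 2 := by
      unfold qf
      simp only [Finset.sum_mul]
      refine (Finset.abs_sum_le_sum_abs _ _).trans (Finset.sum_le_sum fun i _ => ?_)
      refine (Finset.abs_sum_le_sum_abs _ _).trans (Finset.sum_le_sum fun j _ => ?_)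
      rw [abs_mul, abs_mul, mul_assoc, sq]
      gcongr <;> exact hh _
    have h2 : |(2:ℝ)| = 2 := by norm_num
    rw [h2]; linarith [abs_nonneg (qf M h)]
  have hf1 : (fun h => f h - ⟪G, h⟫) =O[𝓝 0] (fun h => ‖h‖ ^ 2) := by
    have := hf.isBigO.add hM
    simpa using this
  have hf2 : f =O[𝓝 0] (fun h => ‖h‖) := by
    have := (hf1.trans hn0).add hG
    simpa using this
  have hf0 : Tendsto f (𝓝 0) (𝓝 0) := by
    have := hf2.trans_isLittleO hid
    rwa [isLittleO_one_iff] at this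
  have e1 : (fun h => f h ^ 2 - ⟪G, h⟫ ^ 2) =o[𝓝 0] (fun h : En n => ‖h‖ ^ 2) := by
    have a1 : (fun h => f h + ⟪G, h⟫) =o[𝓝 0] (fun _ => (1:ℝ)) :=
      (hf2.add hG).trans_isLittleO hid
    have := hf1.mul_isLittleO a1
    simp only [mul_one] at this
    exact this.congr_left fun h => by ring
  have e2 : (fun h => Real.log (1 + f h) - f h + f h ^ 2 / 2) =o[𝓝 0] (fun h : En n => ‖h‖ ^ 2) := by
    have a1 : (fun h => Real.log (1 + f h) - f h + f h ^ 2 / 2) =O[𝓝 0] (fun h => f h ^ 2 * f h) := by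
      refine IsBigO.of_bound 2 ?_
      have : ∀ᶠ h in 𝓝 0, |f h| < 1 / 2 := by
        have := hf0.abs; simp only [abs_zero] at this
        exact this.eventually_lt_const (by norm_num)
      filter_upwards [this] with h hh
      have := Real.abs_log_sub_add_sum_range_le (x := -f h) (by rw [abs_neg]; linarith) 2
      simp only [Finset.sum_range_succ, Finset.sum_range_zero] at this
      rw [abs_neg] at this
      have h3 : |f h| ^ (2+1) / (1 - |f h|) ≤ 2 * |f h| ^ 3 := by
        rw [div_le_iff₀ (by linarith)]
        have h5 := mul_nonneg (pow_nonneg (abs_nonneg (f h)) 3) (by linarith : 0 ≤ 1 - 2 * |f h|)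
        show |f h| ^ 3 ≤ _
        generalize |f h| = q at *
        nlinarith
      rw [Real.norm_eq_abs, Real.norm_eq_abs, abs_mul, abs_pow]
      calc _ = _ := by congr 1; norm_num; ring_nf
        _ ≤ _ := this
        _ ≤ _ := h3
        _ = _ := by ring
    refine a1.trans_isLittleO ?_
    have a2 : (fun h => f h ^ 2) =O[𝓝 0] (fun h : En n => ‖h‖ ^ 2) := hf2.pow 2
    have a3 : f =o[𝓝 0] (fun _ => (1:ℝ)) := hf2.trans_isLittleO hid
    simpa using a2.mul_isLittleO a3
  have := (e2.sub (e1.const_mul_left (1/2))).add hf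
  exact this.congr_left fun h => by ring

lemma second_order {φ : En n → ℝ} {g : En n} {N : Matrix (Fin n) (Fin n) ℝ}
    (ho : (fun h : En n => φ h - ⟪g, h⟫ - qf N h / 2) =o[𝓝 0] (fun h => ‖h‖ ^ 2))
    (hp : ∀ᶠ h in 𝓝 0, 0 ≤ φ h) : g = 0 ∧ ∀ h, 0 ≤ qf N h := by
  -- evaluate along rays
  have key : ∀ h : En n, ∀ ε > 0, ∀ᶠ s : ℝ in 𝓝[>] 0,
      0 ≤ s * ⟪g, h⟫ + s ^ 2 * (qf N h / 2 + ε * ‖h‖ ^ 2) := by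
    intro h ε hε
    have ht : Tendsto (fun s : ℝ => s • h) (𝓝[>] 0) (𝓝 0) := by
      have : Continuous (fun s : ℝ => s • h) := by fun_prop
      have := this.tendsto 0
      simp only [zero_smul] at this
      exact this.mono_left nhdsWithin_le_nhds
    have h1 := ht.eventually (ho.bound hε)
    have h2 := ht.eventually hp
    filter_upwards [h1, h2, self_mem_nhdsWithin] with s h1 h2 hs
    rw [real_inner_smul_right, qf_smul_right] at h1
    rw [Real.norm_eq_abs, Real.norm_eq_abs, abs_of_nonneg (sq_nonneg ‖s • h‖), norm_smul, mul_pow,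
      Real.norm_eq_abs, sq_abs] at h1
    have := (abs_le.1 h1).2
    nlinarith
  have hg : g = 0 := by
    by_contra hg
    have hpos : 0 < ‖g‖ ^ 2 := by positivity
    have h1 := key (-g) 1 one_pos
    simp only [inner_neg_right, real_inner_self_eq_norm_sq, norm_neg] at h1
    set C := qf N (-g) / 2 + 1 * ‖g‖ ^ 2
    have h2 : ∀ᶠ s : ℝ in 𝓝[>] 0, s * C < ‖g‖ ^ 2 := by
      have : Tendsto (fun s : ℝ => s * C) (𝓝[>] 0) (𝓝 0) := by
        have : Continuous (fun s : ℝ => s * C) := by fun_prop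
        have := this.tendsto 0
        simp only [zero_mul] at this
        exact this.mono_left nhdsWithin_le_nhds
      exact this.eventually_lt_const hpos
    obtain ⟨s, h1, h2, hs⟩ := (h1.and (h2.and self_mem_nhdsWithin)).exists
    have hs : 0 < s := hs
    nlinarith
  refine ⟨hg, fun h => ?_⟩
  have h3 : ∀ ε > 0, 0 ≤ qf N h / 2 + ε * ‖h‖ ^ 2 := by
    intro ε hε
    obtain ⟨s, h1, hs⟩ := ((key h ε hε).and self_mem_nhdsWithin).exists
    have hs : 0 < s := hs
    rw [hg, inner_zero_left, mul_zero, zero_add] at h1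
    exact nonneg_of_mul_nonneg_right h1 (by positivity)
  have : 0 ≤ qf N h / 2 := by
    refine le_of_forall_pos_le_add fun ε hε => ?_
    have h4 := h3 (ε / (‖h‖ ^ 2 + 1)) (by positivity)
    have h5 : ε / (‖h‖ ^ 2 + 1) * ‖h‖ ^ 2 ≤ ε := by
      rw [div_mul_eq_mul_div, div_le_iff₀ (by positivity)]; nlinarith
    linarith
  linarith

lemma qf_add (M N : Matrix (Fin n) (Fin n) ℝ) (h : En n) : qf (M + N) h = qf M h + qf N h := by
  simp [qf, add_mul, Finset.sum_add_distrib]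

lemma dotM_add (a M N : Matrix (Fin n) (Fin n) ℝ) : dotM a (M + N) = dotM a M + dotM a N := by
  simp [dotM, mul_add, Finset.sum_add_distrib]

lemma qf_one (h : En n) : qf 1 h = ‖h‖ ^ 2 := by
  rw [EuclideanSpace.real_norm_sq_eq]; simp [qf, Matrix.one_apply, sq]

def rk1 (p : En n) : Matrix (Fin n) (Fin n) ℝ := Matrix.of fun i j => p i * p j

lemma qf_rk1 (p h : En n) : qf (rk1 p) h = ⟪p, h⟫ ^ 2 := by
  rw [PiLp.inner_apply, sq, Finset.sum_mul_sum]
  simp only [qf, rk1, Matrix.of_apply]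
  exact Finset.sum_congr rfl fun i _ => Finset.sum_congr rfl fun j _ => by simp; ring

lemma dotM_rk1 {ν : ℝ} {a : Matrix (Fin n) (Fin n) ℝ} (ha : a ∈ Ell n ν) (p : En n) :
    ν⁻¹ * ‖p‖ ^ 2 ≤ dotM a (rk1 p) := by
  have := ha.1 (fun i => p i)
  rw [EuclideanSpace.real_norm_sq_eq]
  refine this.trans_eq ?_
  simp only [dotM, rk1, Matrix.of_apply, mul_assoc]

lemma PtSol.log {ν : ℝ} (hν : 1 ≤ ν) {β : ℝ≥0∞} {v : En n × ℝ → ℝ} {x : En n} {t : ℝ}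
    (h : PtSol ν β v x t) (hv : 0 < v (x, t)) :
    LS ν β (fun X => Real.log (v X)) x t := by
  obtain ⟨c, G, M, a, ha, hM, hc, ho, hb⟩ := h
  set V := v (x, t) with hV
  set p := V⁻¹ • G with hp
  have hν0 : 0 < ν := by linarith
  have hVi : 0 < V⁻¹ := inv_pos.2 hv
  -- expansion of log v
  have hexp : (fun h : En n => Real.log (v (x + h, t)) - Real.log V - ⟪p, h⟫ -
      (qf (V⁻¹ • M) h - ⟪p, h⟫ ^ 2) / 2) =o[𝓝 0] (fun h => ‖h‖ ^ 2) := by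
    have h1 : (fun h : En n => (V⁻¹ * v (x + h, t) - 1) - ⟪p, h⟫ - qf (V⁻¹ • M) h / 2) =o[𝓝 0]
        (fun h => ‖h‖ ^ 2) := by
      refine (ho.const_mul_left V⁻¹).congr_left fun h => ?_
      rw [hp, real_inner_smul_left, qf_smul]
      field_simp
    have h2 := log_peano h1
    have hpos : ∀ᶠ h in 𝓝 (0 : En n), 0 < v (x + h, t) := by
      have hcont : Tendsto (fun h : En n => v (x + h, t)) (𝓝 0) (𝓝 V) := by
        have e1 : Tendsto (fun h : En n => v (x + h, t) - v (x, t) - ⟪G, h⟫ - qf M h / 2)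
            (𝓝 0) (𝓝 0) := by
          refine ho.trans_tendsto ?_
          have : Continuous (fun h : En n => ‖h‖ ^ 2) := by fun_prop
          simpa using this.tendsto 0
        have e2 : Tendsto (fun h : En n => V + ⟪G, h⟫ + qf M h / 2) (𝓝 0) (𝓝 V) := by
          have : Continuous (fun h : En n => V + ⟪G, h⟫ + qf M h / 2) := by
            unfold qf; fun_prop
          have := this.tendsto 0
          simpa [qf] using this
        have := e1.add e2
        rw [zero_add] at this
        refine this.congr fun h => by ring
      exact hcont.eventually_const_lt hv
    refine h2.congr' ?_ (EventuallyEq.refl _ _)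
    filter_upwards [hpos] with h hh
    have : 1 + (V⁻¹ * v (x + h, t) - 1) = v (x + h, t) / V := by field_simp; ring
    rw [this, Real.log_div hh.ne' hv.ne']
  have hexp2 : ∀ (k : ℝ) (z : En n), (fun h : En n =>
      (Real.log (v (x + h, t)) + k / 2 * ‖x + h - z‖ ^ 2 - (Real.log V + k / 2 * ‖x - z‖ ^ 2)) -
      ⟪p + k • (x - z), h⟫ - qf (V⁻¹ • M + (-1 : ℝ) • rk1 p + k • 1) h / 2) =o[𝓝 0]
        (fun h => ‖h‖ ^ 2) := by
    intro k z
    refine hexp.congr_left fun h => ?_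
    rw [qf_add, qf_add, qf_smul, qf_smul, qf_smul, qf_one, qf_rk1, inner_add_left,
      real_inner_smul_left (x - z) h k]
    have : x + h - z = (x - z) + h := by abel
    rw [this, norm_add_sq_real]
    ring
  have hsym : ∀ k : ℝ, (V⁻¹ • M + (-1 : ℝ) • rk1 p + k • 1).IsSymm := by
    intro k
    refine ((hM.smul _).add (Matrix.IsSymm.smul ?_ _)).add (Matrix.isSymm_one.smul _)
    ext i j; simp [rk1, mul_comm]
  have hmin : ∀ (k : ℝ) (z : En n), IsLocalMin (fun y => Real.log (v (y, t)) + k / 2 * ‖y - z‖ ^ 2) x →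
      p + k • (x - z) = 0 ∧ ∀ h, 0 ≤ qf (V⁻¹ • M + (-1 : ℝ) • rk1 p + k • 1) h := by
    intro k z hmin
    refine second_order (hexp2 k z) ?_
    have ht : Tendsto (fun h : En n => x + h) (𝓝 0) (𝓝 x) := by
      have : Continuous (fun h : En n => x + h) := by fun_prop
      simpa using this.tendsto 0
    filter_upwards [ht.eventually hmin] with h hh
    simpa using hh
  refine ⟨p, fun k z hl => ?_, fun k z κ hk hl hκ => ?_⟩
  · have := (hmin k z hl).1
    rw [eq_neg_of_add_eq_zero_left this, ← smul_neg, neg_sub]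
  obtain ⟨hp0, hN⟩ := hmin k z hl
  set N := V⁻¹ • M + (-1 : ℝ) • rk1 p + k • (1 : Matrix (Fin n) (Fin n) ℝ) with hNdef
  refine ⟨N.trace, trace_nonneg (hsym k) hN, fun ε hε => ?_, ?_⟩
  · have h1 := (hexp2 k z).bound (half_pos hε)
    have ht : Tendsto (fun y : En n => y - x) (𝓝 x) (𝓝 0) := by
      have : Continuous (fun y : En n => y - x) := by fun_prop
      simpa using this.tendsto x
    filter_upwards [ht.eventually h1] with y hy
    rw [hp0, inner_zero_left, Real.norm_eq_abs, Real.norm_eq_abs, abs_of_nonneg (sq_nonneg ‖y - x‖),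
      add_sub_cancel] at hy
    have h2 := (abs_le.1 hy).2
    have h3 := qf_le_trace (hsym k) hN (y - x)
    rw [← hNdef] at h2 h3
    linarith
  · -- the inequality
    have hct : V⁻¹ * c ≤ -κ := by
      have hd : HasDerivAt (fun s => Real.log (v (x, s))) (c / V) t := hc.log hv.ne'
      have hs := (hasDerivAt_iff_tendsto_slope.1 hd)
      have hs' : Tendsto (slope (fun s => Real.log (v (x, s))) t) (𝓝[<] t) (𝓝 (c / V)) :=
        hs.mono_left (nhdsWithin_mono _ fun s hs => ne_of_lt hs)
      have : c / V ≤ -κ := by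
        refine le_of_tendsto hs' ?_
        filter_upwards [hκ, self_mem_nhdsWithin] with s h1 h2
        have h2 : s < t := h2
        rw [slope_def_field, div_le_iff_of_neg (by linarith)]
        linarith
      rw [div_eq_inv_mul] at this; exact this
    have htr := Ell.trace_le ha (hsym k) hN
    rw [dotM_add, dotM_add, dotM_smul, dotM_smul, dotM_smul, ← hNdef] at htr
    have h1 := dotM_rk1 ha p
    have h2 : k * dotM a 1 ≤ k * (n * ν) := mul_le_mul_of_nonneg_left (Ell.diag hν ha) hk
    have h3 : N.trace / ν + κ + ‖p‖ ^ 2 / ν - n * ν * k ≤ V⁻¹ * |c - dotM a M| := by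
      have : V⁻¹ * (dotM a M - c) ≤ V⁻¹ * |c - dotM a M| := by
        gcongr; rw [abs_sub_comm]; exact le_abs_self _
      rw [div_eq_inv_mul, div_eq_inv_mul]
      nlinarith
    calc _ ≤ ENNReal.ofReal (V⁻¹ * |c - dotM a M|) := ENNReal.ofReal_le_ofReal h3
      _ = ENNReal.ofReal V⁻¹ * ENNReal.ofReal |c - dotM a M| := ENNReal.ofReal_mul hVi.le
      _ ≤ ENNReal.ofReal V⁻¹ * (β * ENNReal.ofReal ‖G‖) := by gcongr
      _ = β * ENNReal.ofReal ‖p‖ := by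
        rw [hp, norm_smul, Real.norm_eq_abs, abs_of_pos hVi, ENNReal.ofReal_mul hVi.le]; ring

end

section
open Asymptotics Filter Topology

lemma vol_lipschitz_image {f : En n → En n} {A : Set (En n)} {ℓ : NNReal}
    (h : LipschitzOnWith ℓ f A) : volume (f '' A) ≤ (ℓ : ℝ≥0∞) ^ n * volume A := by
  have h1 := h.hausdorffMeasure_image_le (d := (n : ℝ)) (by positivity)
  have hfr : (n : ℝ) = (Module.finrank ℝ (En n) : ℝ) := by simp
  have h2 : (volume : Measure (En n)) = Measure.addHaarScalarFactor (volume : Measure (En n))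
      (Measure.hausdorffMeasure (Module.finrank ℝ (En n))) •
        (Measure.hausdorffMeasure (Module.finrank ℝ (En n)) : Measure (En n)) :=
    Measure.isAddLeftInvariant_eq_smul _ _
  rw [h2]
  simp only [Measure.smul_apply]
  rw [hfr] at h1
  rw [ENNReal.smul_def, ENNReal.smul_def, smul_eq_mul, smul_eq_mul]
  calc _ ≤ _ := mul_le_mul_right h1 _
    _ = _ := by
      have h3 : (ℓ : ℝ≥0∞) ^ (Module.finrank ℝ (En n)) = (ℓ : ℝ≥0∞) ^ n := by simp
      rw [ENNReal.rpow_natCast, h3]; ring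

/-- Lemma B0 -/
lemma vol_ptlip_image {f : En n → En n} {E : Set (En n)} {ℓ : NNReal}
    (h : ∀ x ∈ E, ∃ r > 0, ∀ x' ∈ E, dist x' x < r → dist (f x') (f x) ≤ ℓ * dist x' x) :
    volume (f '' E) ≤ (ℓ : ℝ≥0∞) ^ n * volume E := by
  let Em : ℕ → Set (En n) := fun m => {x ∈ E | ∀ x' ∈ E, dist x' x < 1 / (m + 1 : ℝ) →
    dist (f x') (f x) ≤ ℓ * dist x' x}
  have hEm : ∀ m, Em m ⊆ E := fun m x hx => hx.1
  have hmono : Monotone Em := by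
    intro a b hab x hx
    refine ⟨hx.1, fun x' hx' hd => hx.2 x' hx' (hd.trans_le ?_)⟩
    gcongr
  have hU : E = ⋃ m, Em m := by
    refine Subset.antisymm (fun x hx => ?_) (iUnion_subset hEm)
    obtain ⟨r, hr, hx'⟩ := h x hx
    obtain ⟨m, hm⟩ := exists_nat_one_div_lt hr
    exact mem_iUnion.2 ⟨m, hx, fun x' h1 h2 => hx' x' h1 (h2.trans hm)⟩
  have hm : ∀ m, volume (f '' Em m) ≤ (ℓ : ℝ≥0∞) ^ n * volume E := by
    intro m
    have hε : (0:ℝ) < 1 / (m + 1) / 2 := by positivity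
    let P : ℕ → Set (En n) := disjointed (fun i => ball (TopologicalSpace.denseSeq (En n) i) (1 / (m + 1) / 2))
    have hPm : ∀ i, MeasurableSet (P i) := fun i => MeasurableSet.disjointed (fun i => measurableSet_ball) i
    have hPd : Pairwise (Function.onFun Disjoint P) := disjoint_disjointed _
    have hPU : ⋃ i, P i = univ := by
      rw [iUnion_disjointed]
      refine eq_univ_of_forall fun x => ?_
      obtain ⟨i, hi⟩ := (TopologicalSpace.denseRange_denseSeq (En n)).exists_dist_lt x hε
      exact mem_iUnion.2 ⟨i, hi⟩
    have hlip : ∀ i, volume (f '' (Em m ∩ P i)) ≤ (ℓ : ℝ≥0∞) ^ n * volume (P i ∩ E) := by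
      intro i
      have : LipschitzOnWith ℓ f (Em m ∩ P i) := by
        refine LipschitzOnWith.of_dist_le_mul fun x hx y hy => ?_
        refine hy.1.2 x hx.1.1 ?_
        have h1 := disjointed_subset _ _ hx.2
        have h2 := disjointed_subset _ _ hy.2
        rw [mem_ball] at h1 h2
        linarith [dist_triangle_right x y (TopologicalSpace.denseSeq (En n) i)]
      refine (vol_lipschitz_image this).trans ?_
      have hsub : Em m ∩ P i ⊆ P i ∩ E := fun x hx => ⟨hx.2, hx.1.1⟩
      exact mul_le_mul_right (measure_mono hsub) _
    calc volume (f '' Em m) = volume (⋃ i, f '' (Em m ∩ P i)) := by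
          rw [← image_iUnion, ← inter_iUnion, hPU, inter_univ]
      _ ≤ ∑' i, volume (f '' (Em m ∩ P i)) := measure_iUnion_le _
      _ ≤ ∑' i, (ℓ : ℝ≥0∞) ^ n * volume (P i ∩ E) := ENNReal.tsum_le_tsum hlip
      _ = (ℓ : ℝ≥0∞) ^ n * ∑' i, (volume.restrict E) (P i) := by
          rw [ENNReal.tsum_mul_left]; congr 2; funext i; rw [Measure.restrict_apply (hPm i)]
      _ = (ℓ : ℝ≥0∞) ^ n * volume E := by
          rw [← measure_iUnion hPd hPm, hPU, Measure.restrict_apply_univ]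
  have : f '' E = ⋃ m, f '' Em m := by rw [← image_iUnion, ← hU]
  rw [this, Monotone.measure_iUnion (fun a b hab => image_mono (hmono hab))]
  exact iSup_le hm

/-- Lemma B -/
lemma vol_image_le_lintegral (hn : 0 < n) {f : En n → En n} {E : Set (En n)} (hE : MeasurableSet E)
    {β : En n → ℝ≥0∞} (hβ : Measurable β) (hpos : ∀ x ∈ E, 0 < β x)
    (h : ∀ x ∈ E, ∃ ℓ : NNReal, (ℓ : ℝ≥0∞) ≤ β x ∧ ∃ r > 0, ∀ x' ∈ E, dist x' x < r →
      dist (f x') (f x) ≤ ℓ * dist x' x) :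
    volume (f '' E) ≤ 2 ^ n * ∫⁻ x in E, β x ^ n := by
  by_cases hfin : ∫⁻ x in E, β x ^ n = ∞
  · rw [hfin, ENNReal.mul_top (by positivity)]; exact le_top
  let L : ℤ → Set (En n) := fun i => E ∩ β ⁻¹' Ioc ((2:ℝ≥0∞) ^ i) (2 ^ (i + 1))
  let T : Set (En n) := E ∩ β ⁻¹' {∞}
  have hLm : ∀ i, MeasurableSet (L i) := fun i => hE.inter (hβ measurableSet_Ioc)
  have hTm : MeasurableSet T := hE.inter (hβ (measurableSet_singleton _))
  have hcov : E ⊆ T ∪ ⋃ i, L i := by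
    intro x hx
    by_cases hx' : β x = ∞
    · exact Or.inl ⟨hx, hx'⟩
    · obtain ⟨i, hi⟩ := ENNReal.exists_mem_Ioc_zpow (y := 2) (hpos x hx).ne' hx' (by norm_num) (by norm_num)
      exact Or.inr (mem_iUnion.2 ⟨i, hx, hi⟩)
  have hT0 : volume T = 0 := by
    have h1 : ∀ᵐ x ∂(volume.restrict E), β x ^ n < ∞ := ae_lt_top (by fun_prop) hfin
    have h2 := (ae_restrict_iff' hE).1 h1
    refine measure_mono_null (fun x hx => ?_) h2
    simp only [mem_compl_iff, mem_ofPred_eq, not_forall]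
    refine ⟨hx.1, ?_⟩
    have : β x = ∞ := hx.2
    rw [this, ENNReal.top_pow hn.ne']; simp
  have hT : volume (f '' T) = 0 := by
    let Tm : ℕ → Set (En n) := fun m => {x ∈ T | ∃ r > 0, ∀ x' ∈ E, dist x' x < r →
      dist (f x') (f x) ≤ (m : NNReal) * dist x' x}
    have hTU : f '' T ⊆ ⋃ m, f '' Tm m := by
      rintro _ ⟨x, hx, rfl⟩
      obtain ⟨ℓ, -, r, hr, hx'⟩ := h x hx.1
      obtain ⟨m, hm⟩ := exists_nat_ge ℓ
      refine mem_iUnion.2 ⟨m, x, ⟨hx, r, hr, fun x' h1 h2 => (hx' x' h1 h2).trans ?_⟩, rfl⟩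
      gcongr
    refine measure_mono_null hTU (measure_iUnion_null fun m => ?_)
    have := vol_ptlip_image (f := f) (E := Tm m) (ℓ := (m : NNReal)) (fun x hx => by
      obtain ⟨r, hr, hx'⟩ := hx.2
      exact ⟨r, hr, fun x' h1 h2 => hx' x' h1.1.1 h2⟩)
    have h0 : volume (Tm m) = 0 := measure_mono_null (fun x hx => hx.1) hT0
    rw [h0, mul_zero] at this
    exact le_antisymm this bot_le
  have hL : ∀ i, volume (f '' L i) ≤ 2 ^ n * ∫⁻ x in L i, β x ^ n := by
    intro i
    have hne : ((2:NNReal) ^ (i+1) : NNReal) = ((2:ℝ≥0∞) ^ (i+1)) := by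
      rw [ENNReal.coe_zpow (by norm_num)]; rfl
    have := vol_ptlip_image (f := f) (E := L i) (ℓ := (2:NNReal) ^ (i+1)) (fun x hx => by
      obtain ⟨ℓ, h1, r, hr, hx'⟩ := h x hx.1
      refine ⟨r, hr, fun x' h2 h3 => (hx' x' h2.1 h3).trans ?_⟩
      gcongr
      have h4 := h1.trans hx.2.2
      rw [← hne] at h4
      exact_mod_cast h4)
    rw [hne] at this
    refine this.trans ?_
    rw [ENNReal.zpow_add (by norm_num) (by norm_num), zpow_one, mul_comm ((2:ℝ≥0∞)^i) 2, mul_pow, mul_assoc]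
    gcongr
    rw [← setLIntegral_const]
    refine setLIntegral_mono' (hLm i) fun x hx => ?_
    gcongr
    exact hx.2.1.le
  have hLd : Pairwise (Function.onFun Disjoint L) := by
    have : ∀ i j : ℤ, i < j → Disjoint (L i) (L j) := by
      intro i j hij
      refine disjoint_left.2 fun x h1 h2 => ?_
      have h3 : β x ≤ 2 ^ (i+1) := h1.2.2
      have h4 : (2:ℝ≥0∞) ^ j < β x := h2.2.1
      have h5 : (2:ℝ≥0∞) ^ (i+1) ≤ 2 ^ j := ENNReal.zpow_le_of_le (by norm_num) (by omega)
      exact absurd (h4.trans_le (h3.trans h5)) (lt_irrefl _)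
    intro i j hij
    rcases lt_or_gt_of_ne hij with h | h
    · exact this i j h
    · exact (this j i h).symm
  calc volume (f '' E) ≤ volume (f '' T ∪ ⋃ i, f '' L i) := by
        rw [← image_iUnion, ← image_union]; exact measure_mono (image_mono hcov)
    _ ≤ volume (f '' T) + ∑' i, volume (f '' L i) :=
        (measure_union_le _ _).trans (by gcongr; exact measure_iUnion_le _)
    _ ≤ ∑' i, 2 ^ n * ∫⁻ x in L i, β x ^ n := by rw [hT, zero_add]; exact ENNReal.tsum_le_tsum hL
    _ = 2 ^ n * ∫⁻ x in ⋃ i, L i, β x ^ n := by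
        rw [ENNReal.tsum_mul_left, lintegral_iUnion hLm hLd]
    _ ≤ _ := by
        gcongr
        exact iUnion_subset fun i x hx => hx.1

end

section
open Asymptotics Filter Topology

/-- contact setting -/
structure CS (ν : ℝ) (β : En n → ℝ≥0∞) (x0 : En n) (R ta tb : ℝ) (w : En n × ℝ → ℝ) : Prop where
  wc : ContinuousOn w (closedBall x0 R ×ˢ Icc ta tb)
  ls : ∀ x ∈ ball x0 R, ∀ t ∈ Ioc ta tb, LS ν (β x) w x t

def gfun (w : En n × ℝ → ℝ) (τ : ℝ → ℝ) (k : ℝ) (z : En n) (X : En n × ℝ) : ℝ :=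
  w X + τ X.2 + k / 2 * ‖X.1 - z‖ ^ 2

def Contact (x0 : En n) (R ta tb : ℝ) (w : En n × ℝ → ℝ) (τ : ℝ → ℝ) (k : ℝ) (z : En n)
    (X : En n × ℝ) : Prop :=
  X ∈ closedBall x0 R ×ˢ Icc ta tb ∧
    ∀ Y ∈ closedBall x0 R ×ˢ Icc ta tb, gfun w τ k z X ≤ gfun w τ k z Y

def bad (β : En n → ℝ≥0∞) (Kh k : ℝ) (x z : En n) : Prop :=
  ∃ r : ℝ, 0 ≤ r ∧ ENNReal.ofReal r < β x ∧ Kh < r * (k * ‖x - z‖)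

variable {ν : ℝ} {β : En n → ℝ≥0∞} {x0 : En n} {R ta tb : ℝ} {w : En n × ℝ → ℝ} {τ : ℝ → ℝ}

lemma Contact.localMin {k : ℝ} {z : En n} {X : En n × ℝ} (h : Contact x0 R ta tb w τ k z X)
    (hx : X.1 ∈ ball x0 R) : IsLocalMin (fun y => w (y, X.2) + k / 2 * ‖y - z‖ ^ 2) X.1 := by
  filter_upwards [isOpen_ball.mem_nhds hx] with y hy
  have := h.2 (y, X.2) ⟨ball_subset_closedBall hy, h.1.2⟩
  simp only [gfun] at this
  linarith

lemma Contact.left {k : ℝ} {z : En n} {X : En n × ℝ} (h : Contact x0 R ta tb w τ k z X)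
    (ht : ta < X.2) {κ : ℝ} (hκ : ∀ᶠ s in 𝓝[<] X.2, κ * (X.2 - s) ≤ τ X.2 - τ s) :
    ∀ᶠ s in 𝓝[<] X.2, w (X.1, X.2) + κ * (X.2 - s) ≤ w (X.1, s) := by
  have h1 : ∀ᶠ s in 𝓝[<] X.2, ta < s :=
    (eventually_gt_nhds ht).filter_mono nhdsWithin_le_nhds
  filter_upwards [hκ, h1, self_mem_nhdsWithin] with s hs h1 h2
  have h2 : s < X.2 := h2
  have := h.2 (X.1, s) ⟨h.1.1, h1.le, h2.le.trans h.1.2.2⟩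
  simp only [gfun] at this
  linarith

lemma Contact.same {k k' : ℝ} {z z' : En n} {X X' : En n × ℝ}
    (h : Contact x0 R ta tb w τ k z X) (h' : Contact x0 R ta tb w τ k' z' X') (he : X.1 = X'.1) :
    Contact x0 R ta tb w τ k' z' X := by
  refine ⟨h.1, fun Y hY => le_trans ?_ (h'.2 Y hY)⟩
  have := h.2 X' h'.1
  simp only [gfun] at this ⊢
  rw [he] at this ⊢
  linarith

lemma CS.grad (hcs : CS ν β x0 R ta tb w) {k k' : ℝ} {z z' : En n} {X X' : En n × ℝ}
    (h : Contact x0 R ta tb w τ k z X) (h' : Contact x0 R ta tb w τ k' z' X') (he : X.1 = X'.1)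
    (hx : X.1 ∈ ball x0 R) (ht : ta < X.2) : k • (z - X.1) = k' • (z' - X.1) := by
  obtain ⟨p, hp, -⟩ := hcs.ls X.1 hx X.2 ⟨ht, h.1.2.2⟩
  rw [← hp k z (h.localMin hx), ← hp k' z' ((h.same h' he).localMin hx)]

/-- quadratic upper bound at a contact point -/
def QB (w : En n × ℝ → ℝ) (k : ℝ) (z : En n) (X : En n × ℝ) (L : ℝ) : Prop :=
  ∀ᶠ y in 𝓝 X.1, w (y, X.2) + k / 2 * ‖y - z‖ ^ 2 ≤
    w X + k / 2 * ‖X.1 - z‖ ^ 2 + L / 2 * ‖y - X.1‖ ^ 2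

lemma CS.basic (hcs : CS ν β x0 R ta tb w) {k : ℝ} (hk : 0 ≤ k) {z : En n} {X : En n × ℝ}
    (h : Contact x0 R ta tb w τ k z X) (hx : X.1 ∈ ball x0 R) (ht : ta < X.2) {κ : ℝ}
    (hκ : ∀ᶠ s in 𝓝[<] X.2, κ * (X.2 - s) ≤ τ X.2 - τ s) :
    ∃ A : ℝ, 0 ≤ A ∧ (∀ ε > 0, QB w k z X (A + ε)) ∧
      ENNReal.ofReal (A / ν + κ + (k * ‖X.1 - z‖) ^ 2 / ν - n * ν * k) ≤
        β X.1 * ENNReal.ofReal (k * ‖X.1 - z‖) := by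
  obtain ⟨p, hp, hA⟩ := hcs.ls X.1 hx X.2 ⟨ht, h.1.2.2⟩
  obtain ⟨A, hA0, h1, h2⟩ := hA k z κ hk (h.localMin hx) (h.left ht hκ)
  refine ⟨A, hA0, h1, ?_⟩
  have : ‖p‖ = k * ‖X.1 - z‖ := by
    rw [hp k z (h.localMin hx), norm_smul, Real.norm_eq_abs, abs_of_nonneg hk, norm_sub_rev]
  rwa [this] at h2

lemma CS.notBad (hcs : CS ν β x0 R ta tb w) {k : ℝ} (hk : 0 ≤ k) {z : En n} {X : En n × ℝ}
    (h : Contact x0 R ta tb w τ k z X) (hx : X.1 ∈ ball x0 R) (ht : ta < X.2) {κ : ℝ}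
    (hκ : ∀ᶠ s in 𝓝[<] X.2, κ * (X.2 - s) ≤ τ X.2 - τ s) {Kh : ℝ} (hK : n * ν * k ≤ Kh)
    (hK0 : 0 ≤ Kh) (hb : ¬ bad β Kh k X.1 z) :
    ∃ A : ℝ, 0 ≤ A ∧ (∀ ε > 0, QB w k z X (A + ε)) ∧
      A / ν + κ + (k * ‖X.1 - z‖) ^ 2 / ν ≤ 2 * Kh := by
  obtain ⟨A, hA0, h1, h2⟩ := hcs.basic hk h hx ht hκ
  refine ⟨A, hA0, h1, ?_⟩
  set q := k * ‖X.1 - z‖ with hq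
  have hq0 : 0 ≤ q := by positivity
  have h3 : β X.1 * ENNReal.ofReal q ≤ ENNReal.ofReal Kh := by
    rcases hq0.eq_or_lt with h0 | h0
    · rw [← h0]; simp
    by_contra hcon
    push Not at hcon
    have h4 : ENNReal.ofReal (Kh / q) < β X.1 := by
      rw [ENNReal.ofReal_div_of_pos h0]
      exact ENNReal.div_lt_of_lt_mul hcon
    obtain ⟨r, hr1, hr2⟩ := ENNReal.lt_iff_exists_nnreal_btwn.1 h4
    refine hb ⟨r, r.2, by simpa using hr2, ?_⟩
    have : Kh / q < r := by
      rw [← ENNReal.ofReal_coe_nnreal] at hr1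
      exact (ENNReal.ofReal_lt_ofReal_iff_of_nonneg (by positivity)).1 hr1
    rwa [div_lt_iff₀ h0] at this
  have h5 := h2.trans h3
  rw [ENNReal.ofReal_le_ofReal_iff hK0] at h5
  linarith

lemma CS.isBad (hν : 1 ≤ ν) (hcs : CS ν β x0 R ta tb w) {k : ℝ} (hk : 0 < k) {z : En n} {X : En n × ℝ}
    (h : Contact x0 R ta tb w τ k z X) (hx : X.1 ∈ ball x0 R) (ht : ta < X.2)
    {Kh : ℝ} (hK : n * ν * k ≤ Kh) (hK0 : 0 < Kh)
    (hκ : ∀ s t, s ≤ t → -Kh * (t - s) ≤ τ t - τ s) (hb : bad β Kh k X.1 z) :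
    ∃ L : ℝ, 0 ≤ L ∧ QB w k z X L ∧
      ENNReal.ofReal (2 * L / k) ≤ ENNReal.ofReal (12 * ν) * β X.1 * ENNReal.ofReal ‖X.1 - z‖ := by
  obtain ⟨A, hA0, h1, h2⟩ := hcs.basic hk.le h hx ht (κ := -Kh)
    (by filter_upwards [self_mem_nhdsWithin] with s hs using hκ s X.2 (le_of_lt hs))
  set q := k * ‖X.1 - z‖ with hq
  have hq0 : 0 ≤ q := by positivity
  have hν0 : 0 < ν := by linarith
  refine ⟨A + ν * Kh, by positivity, h1 _ (by positivity), ?_⟩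
  obtain ⟨r, hr0, hr1, hr2⟩ := hb
  have h3 : ENNReal.ofReal Kh ≤ β X.1 * ENNReal.ofReal q := by
    calc _ ≤ ENNReal.ofReal (r * q) := ENNReal.ofReal_le_ofReal hr2.le
      _ = ENNReal.ofReal r * ENNReal.ofReal q := ENNReal.ofReal_mul hr0
      _ ≤ _ := by gcongr
  have h4 : ENNReal.ofReal (A / ν) ≤ 3 * (β X.1 * ENNReal.ofReal q) := by
    have : A / ν ≤ (A / ν + -Kh + q ^ 2 / ν - n * ν * k) + (Kh + Kh) := by
      have : 0 ≤ q ^ 2 / ν := by positivity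
      linarith
    calc _ ≤ _ := ENNReal.ofReal_le_ofReal this
      _ ≤ _ := ENNReal.ofReal_add_le
      _ ≤ β X.1 * ENNReal.ofReal q + (β X.1 * ENNReal.ofReal q + β X.1 * ENNReal.ofReal q) := by
        rw [ENNReal.ofReal_add hK0.le hK0.le]; gcongr
      _ = _ := by ring
  have h5 : 2 * (A + ν * Kh) / k = (2 * ν / k) * (A / ν + Kh) := by field_simp
  rw [h5, ENNReal.ofReal_mul (by positivity), ENNReal.ofReal_add (by positivity) hK0.le]
  calc _ ≤ ENNReal.ofReal (2 * ν / k) * (3 * (β X.1 * ENNReal.ofReal q) + β X.1 * ENNReal.ofReal q) := by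
        gcongr
    _ = (ENNReal.ofReal (2 * ν / k) * 4 * ENNReal.ofReal q) * β X.1 := by ring
    _ = (ENNReal.ofReal (12 * ν) * ENNReal.ofReal ‖X.1 - z‖ * ENNReal.ofReal (8/12)) * β X.1 := by
        congr 1
        have : (4:ℝ≥0∞) = ENNReal.ofReal 4 := by norm_num
        rw [this, ← ENNReal.ofReal_mul (by positivity), ← ENNReal.ofReal_mul (by positivity),
          ← ENNReal.ofReal_mul (by positivity), ← ENNReal.ofReal_mul (by positivity), hq]
        congr 1; field_simp; ring
    _ ≤ (ENNReal.ofReal (12 * ν) * ENNReal.ofReal ‖X.1 - z‖ * 1) * β X.1 := by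
        gcongr; rw [ENNReal.ofReal_le_one]; norm_num
    _ = _ := by ring

lemma CS.lip (hcs : CS ν β x0 R ta tb w) {k : ℝ} (hk : 0 < k) {z : En n} {X : En n × ℝ}
    (h : Contact x0 R ta tb w τ k z X) (hx : X.1 ∈ ball x0 R) (ht : ta < X.2) {L : ℝ}
    (hq : QB w k z X L) :
    ∃ r > 0, ∀ (z' : En n) (X' : En n × ℝ), Contact x0 R ta tb w τ k z' X' → dist X'.1 X.1 < r →
      dist z' z ≤ 2 * L / k * dist X'.1 X.1 := by
  obtain ⟨r, hr, hball⟩ := Metric.eventually_nhds_iff.1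
    (hq.and (isOpen_ball.eventually_mem hx))
  refine ⟨r / 2, by positivity, fun z' X' h' hd => ?_⟩
  by_cases hX : X'.1 = X.1
  · have := hcs.grad h h' hX.symm hx ht
    have h2 : z - X.1 = z' - X.1 := smul_right_injective (En n) hk.ne' this
    have h3 : z = z' := by simpa using h2
    rw [h3, hX]; simp
  by_cases hz : z' = z
  · have hL : 0 ≤ L := by
      by_contra hL
      push Not at hL
      have hne : ∃ y, y ≠ X.1 ∧ dist y X.1 < r := ⟨X'.1, hX, by linarith⟩
      obtain ⟨y, hy, hyr⟩ := hne
      have h1 := (hball hyr).1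
      have h2 := h.2 (y, X.2) ⟨ball_subset_closedBall (hball hyr).2, h.1.2⟩
      simp only [gfun] at h2
      have : 0 < ‖y - X.1‖ ^ 2 := by
        have := sub_ne_zero.2 hy
        positivity
      nlinarith
    rw [hz, dist_self]; positivity
  set d := dist X'.1 X.1 with hdd
  have hd0 : 0 < d := dist_pos.2 hX
  have hzn : 0 < ‖z - z'‖ := norm_pos_iff.2 (sub_ne_zero.2 (Ne.symm hz))
  set e := (d / ‖z - z'‖) • (z - z') with he
  have hen : ‖e‖ = d := by
    rw [he, norm_smul, Real.norm_eq_abs, abs_of_pos (by positivity)]; field_simp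
  set y := X'.1 - e with hy
  have hyd : dist y X.1 ≤ 2 * d := by
    calc dist y X.1 ≤ dist y X'.1 + dist X'.1 X.1 := dist_triangle _ _ _
      _ = 2 * d := by rw [hy, dist_eq_norm, sub_sub_cancel_left, norm_neg, hen]; ring
  obtain ⟨h1, h2⟩ := hball (show dist y X.1 < r by linarith)
  have h3 := h'.2 (y, X.2) ⟨ball_subset_closedBall h2, h.1.2⟩
  have h4 := h.2 X' h'.1
  simp only [gfun] at h3 h4
  have e1 : ∀ a : En n, ‖a - z'‖ ^ 2 - ‖a - z‖ ^ 2 = 2 * ⟪z - z', a⟫ + (‖z'‖ ^ 2 - ‖z‖ ^ 2) := by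
    intro a
    rw [norm_sub_sq_real, norm_sub_sq_real, inner_sub_left, real_inner_comm z, real_inner_comm z']
    ring
  have e2 := e1 y
  have e3 := e1 X'.1
  have e4 : ⟪z - z', y⟫ = ⟪z - z', X'.1⟫ - d * ‖z - z'‖ := by
    rw [hy, inner_sub_right, he, real_inner_smul_right, real_inner_self_eq_norm_sq]
    field_simp
  have e5 : ‖y - X.1‖ ≤ 2 * d := by rwa [← dist_eq_norm]
  have e6 : L / 2 * ‖y - X.1‖ ^ 2 ≥ k * (d * ‖z - z'‖) := by
    rw [e4] at e2
    nlinarith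
  have hL : 0 ≤ L := by
    by_contra hL
    push Not at hL
    have : 0 < k * (d * ‖z - z'‖) := by positivity
    nlinarith [sq_nonneg ‖y - X.1‖]
  have e7 : ‖y - X.1‖ ^ 2 ≤ (2 * d) ^ 2 := by gcongr
  rw [dist_comm, dist_eq_norm]
  have e8 : k * (d * ‖z - z'‖) ≤ L / 2 * (2 * d) ^ 2 := by nlinarith
  rw [div_mul_eq_mul_div, le_div_iff₀ hk]
  nlinarith

end

section
open Asymptotics Filter Topology

lemma sigmaCompact_inter {α : Type*} [MetricSpace α] {C U : Set α} (hC : IsCompact C)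
    (hU : IsOpen U) : IsSigmaCompact (C ∩ U) := by
  obtain ⟨F, hF, -, hU', -⟩ := hU.exists_iUnion_isClosed
  refine ⟨fun i => C ∩ F i, fun i => hC.inter_right (hF i), ?_⟩
  rw [← inter_iUnion, hU']

lemma sigmaCompact_meas {α : Type*} [MetricSpace α] [MeasurableSpace α] [BorelSpace α]
    {C : Set α} (hC : IsSigmaCompact C) : MeasurableSet C := by
  obtain ⟨F, hF, h⟩ := hC
  rw [← h]
  exact MeasurableSet.iUnion fun i => (hF i).measurableSet

variable {ν : ℝ} {β : En n → ℝ≥0∞} {x0 : En n} {R ta tb : ℝ} {w : En n × ℝ → ℝ} {τ : ℝ → ℝ}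

def CSet (x0 : En n) (R ta tb : ℝ) (w : En n × ℝ → ℝ) (τ : ℝ → ℝ → ℝ) (k : ℝ) (Zs : Set (En n))
    (Sg : Set ℝ) : Set ((En n × ℝ) × En n × ℝ) :=
  {p | p.2.1 ∈ Zs ∧ p.2.2 ∈ Sg ∧ Contact x0 R ta tb w (τ p.2.2) k p.2.1 p.1}

lemma CSet_compact (hw : ContinuousOn w (closedBall x0 R ×ˢ Icc ta tb)) {τ : ℝ → ℝ → ℝ}
    (hτ : Continuous (fun q : ℝ × ℝ => τ q.1 q.2)) (k : ℝ) {Zs : Set (En n)} (hZ : IsCompact Zs)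
    {Sg : Set ℝ} (hS : IsCompact Sg) : IsCompact (CSet x0 R ta tb w τ k Zs Sg) := by
  set K : Set (En n × ℝ) := closedBall x0 R ×ˢ Icc ta tb with hK
  have hKc : IsCompact K := (isCompact_closedBall x0 R).prod isCompact_Icc
  set C0 : Set ((En n × ℝ) × En n × ℝ) := K ×ˢ (Zs ×ˢ Sg) with hC0
  have hC0c : IsCompact C0 := hKc.prod (hZ.prod hS)
  have heq : CSet x0 R ta tb w τ k Zs Sg = C0 ∩ ⋂ Y ∈ K, {p ∈ C0 |
      w p.1 + τ p.2.2 p.1.2 + k / 2 * ‖p.1.1 - p.2.1‖ ^ 2 ≤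
      w Y + τ p.2.2 Y.2 + k / 2 * ‖Y.1 - p.2.1‖ ^ 2} := by
    ext p
    constructor
    · rintro ⟨h1, h2, h3⟩
      have : p ∈ C0 := ⟨h3.1, h1, h2⟩
      exact ⟨this, mem_iInter₂.2 fun Y hY => ⟨this, h3.2 Y hY⟩⟩
    · rintro ⟨h1, h2⟩
      exact ⟨h1.2.1, h1.2.2, h1.1, fun Y hY => (mem_iInter₂.1 h2 Y hY).2⟩
  rw [heq]
  refine hC0c.inter_right (isClosed_biInter fun Y hY => ?_)
  have c1 : Continuous (fun p : (En n × ℝ) × En n × ℝ => τ p.2.2 p.1.2) :=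
    hτ.comp (by fun_prop : Continuous fun p : (En n × ℝ) × En n × ℝ => (p.2.2, p.1.2))
  have c2 : Continuous (fun p : (En n × ℝ) × En n × ℝ => τ p.2.2 Y.2) :=
    hτ.comp (by fun_prop : Continuous fun p : (En n × ℝ) × En n × ℝ => (p.2.2, Y.2))
  refine hC0c.isClosed.isClosed_le ?_ ?_
  · refine ContinuousOn.add (ContinuousOn.add ?_ c1.continuousOn) (by fun_prop)
    exact hw.comp continuousOn_fst fun p hp => hp.1
  · exact (by fun_prop : Continuous fun p : (En n × ℝ) × En n × ℝ =>
      w Y + τ p.2.2 Y.2 + k / 2 * ‖Y.1 - p.2.1‖ ^ 2).continuousOn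

lemma bad_open (hβ : LowerSemicontinuous β) (Kh k : ℝ) :
    IsOpen {q : En n × En n | bad β Kh k q.1 q.2} := by
  have : {q : En n × En n | bad β Kh k q.1 q.2} = ⋃ r : ℝ, ⋃ _ : 0 ≤ r,
      ({q : En n × En n | ENNReal.ofReal r < β q.1} ∩ {q | Kh < r * (k * ‖q.1 - q.2‖)}) := by
    ext q
    simp only [bad, mem_iUnion, exists_prop]
    rfl
  rw [this]
  refine isOpen_iUnion fun r => isOpen_iUnion fun _ => IsOpen.inter ?_ ?_
  · exact (hβ.isOpen_preimage _).preimage continuous_fst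
  · exact isOpen_lt (by fun_prop) (by fun_prop)

/-- interior bad contact -/
def BadC (β : En n → ℝ≥0∞) (x0 : En n) (R ta tb : ℝ) (w : En n × ℝ → ℝ) (τ : ℝ → ℝ) (Kh k : ℝ)
    (z : En n) (X : En n × ℝ) : Prop :=
  Contact x0 R ta tb w τ k z X ∧ X.1 ∈ ball x0 R ∧ ta < X.2 ∧ bad β Kh k X.1 z

lemma BadC_open (hβ : LowerSemicontinuous β) (Kh k : ℝ) (x0 : En n) (R ta : ℝ) :
    IsOpen {p : (En n × ℝ) × En n × ℝ | p.1.1 ∈ ball x0 R ∧ ta < p.1.2 ∧ bad β Kh k p.1.1 p.2.1} := by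
  refine IsOpen.inter ?_ (IsOpen.inter ?_ ?_)
  · exact isOpen_ball.preimage (by fun_prop : Continuous fun p : (En n × ℝ) × En n × ℝ => p.1.1)
  · exact isOpen_Ioi.preimage (by fun_prop : Continuous fun p : (En n × ℝ) × En n × ℝ => p.1.2)
  · exact (bad_open hβ Kh k).preimage
      (by fun_prop : Continuous fun p : (En n × ℝ) × En n × ℝ => (p.1.1, p.2.1))

/-- projection to x of bad contacts satisfying a closed condition is measurable -/
lemma BadC_meas (hβ : LowerSemicontinuous β) (hw : ContinuousOn w (closedBall x0 R ×ˢ Icc ta tb))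
    (hτ : Continuous τ) (Kh k : ℝ) {Zs : Set (En n)} (hZ : IsCompact Zs)
    {P : En n → En n → Prop} (hP : IsClosed {q : En n × En n | P q.1 q.2}) :
    MeasurableSet {x : En n | ∃ z ∈ Zs, ∃ X : En n × ℝ, BadC β x0 R ta tb w τ Kh k z X ∧ X.1 = x ∧ P x z} := by
  have hc := CSet_compact (x0 := x0) (R := R) (ta := ta) (tb := tb) hw (τ := fun _ => τ)
    (by fun_prop) k hZ (isCompact_singleton (x := (0:ℝ)))
  have hc2 := hc.inter_right (hP.preimage
    (by fun_prop : Continuous fun p : (En n × ℝ) × En n × ℝ => (p.1.1, p.2.1)))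
  have hs := (sigmaCompact_inter hc2 (BadC_open hβ Kh k x0 R ta)).image
    (by fun_prop : Continuous fun p : (En n × ℝ) × En n × ℝ => p.1.1)
  convert sigmaCompact_meas hs using 1
  ext x
  constructor
  · rintro ⟨z, hz, X, ⟨h1, h2, h3, h4⟩, rfl, h5⟩
    exact ⟨(X, z, 0), ⟨⟨⟨hz, rfl, h1⟩, h5⟩, h2, h3, h4⟩, rfl⟩
  · rintro ⟨⟨X, z, s⟩, ⟨⟨⟨hz, hs, h1⟩, h5⟩, h2, h3, h4⟩, rfl⟩
    exact ⟨z, hz, X, ⟨h1, h2, h3, h4⟩, rfl, h5⟩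

lemma bad_vol (hn : 0 < n) (hν : 1 ≤ ν) (hβ : LowerSemicontinuous β) (hcs : CS ν β x0 R ta tb w)
    {k : ℝ} (hk : 0 < k) {Kh : ℝ} (hK : n * ν * k ≤ Kh) (hK0 : 0 < Kh)
    (hκ : ∀ s t, s ≤ t → -Kh * (t - s) ≤ τ t - τ s) {ρ : ℝ} (hρ : 0 < ρ) {E : Set (En n)}
    (hEm : MeasurableSet E)
    (hE : ∀ x ∈ E, ∃ z X, BadC β x0 R ta tb w τ Kh k z X ∧ X.1 = x ∧ ‖x - z‖ ≤ ρ) :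
    volume {z | ∃ X, BadC β x0 R ta tb w τ Kh k z X ∧ X.1 ∈ E} ≤
      ENNReal.ofReal (24 * ν * ρ) ^ n * ∫⁻ x in E, β x ^ n := by
  classical
  have hν0 : 0 < ν := by linarith
  choose! f F hF using hE
  have hsub : {z | ∃ X, BadC β x0 R ta tb w τ Kh k z X ∧ X.1 ∈ E} ⊆ f '' E := by
    rintro z ⟨X, hX, hXE⟩
    refine ⟨X.1, hXE, ?_⟩
    have h1 := hF X.1 hXE
    have := hcs.grad hX.1 h1.1.1 h1.2.1.symm hX.2.1 hX.2.2.1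
    have h2 : z - X.1 = f X.1 - X.1 := smul_right_injective (En n) hk.ne' this
    simpa using h2.symm
  have hβm := hβ.measurable
  have hB := vol_image_le_lintegral hn hEm (f := f) (β := fun x => ENNReal.ofReal (12 * ν * ρ) * β x)
    (by fun_prop) ?_ ?_
  · refine (measure_mono hsub).trans (hB.trans_eq ?_)
    simp_rw [mul_pow]
    rw [lintegral_const_mul _ (by fun_prop), ← mul_assoc, ← mul_pow]
    congr 2
    have : (2:ℝ≥0∞) = ENNReal.ofReal 2 := by norm_num
    rw [this, ← ENNReal.ofReal_mul (by norm_num)]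
    congr 1; ring
  · intro x hx
    obtain ⟨⟨-, -, -, r, hr, hrβ, -⟩, h2, -⟩ := hF x hx
    rw [h2] at hrβ
    refine ENNReal.mul_pos ?_ (pos_of_gt hrβ).ne'
    simp; positivity
  · intro x hx
    obtain ⟨⟨h1, h2, h3, h4⟩, h5, h6⟩ := hF x hx
    obtain ⟨L, hL0, hQ, hL⟩ := hcs.isBad hν hk h1 h2 h3 hK hK0 hκ h4
    obtain ⟨r, hr, hlip⟩ := hcs.lip hk h1 h2 h3 hQ
    refine ⟨Real.toNNReal (2 * L / k), ?_, r, hr, fun x' hx' hd => ?_⟩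
    · refine hL.trans ?_
      rw [h5, ENNReal.ofReal_mul (p := 12 * ν) (by positivity)]
      calc _ = ENNReal.ofReal (12 * ν) * ENNReal.ofReal ‖x - f x‖ * β x := by ring
        _ ≤ _ := by gcongr
    · rw [Real.coe_toNNReal _ (by positivity)]
      have h7 := hF x' hx'
      have := hlip (f x') (F x') h7.1.1
      rw [h5, h7.2.1] at this
      exact this hd

/-- the set of bad z -/
def BadZ (β : En n → ℝ≥0∞) (x0 : En n) (R ta tb : ℝ) (w : En n × ℝ → ℝ) (τ : ℝ → ℝ) (Kh k : ℝ)
    (Zs : Set (En n)) : Set (En n) := {z ∈ Zs | ∃ X, BadC β x0 R ta tb w τ Kh k z X}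

/-- one level bound -/
lemma BadZ_one (hn : 0 < n) (hν : 1 ≤ ν) {S : ℝ≥0∞} (hβ : Drift S β) (hcs : CS ν β x0 R ta tb w)
    (hR : 0 < R) (hτ : Continuous τ) {Zs : Set (En n)} (hZ : IsCompact Zs) (hZR : Zs ⊆ closedBall x0 R)
    {k : ℝ} (hk : 0 < k) {Kh : ℝ} (hK : n * ν * k ≤ Kh) (hK0 : 0 < Kh)
    (hκ : ∀ s t, s ≤ t → -Kh * (t - s) ≤ τ t - τ s) :
    volume (BadZ β x0 R ta tb w τ Kh k Zs) ≤ ENNReal.ofReal (48 * ν * R) ^ n * S := by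
  have hm := BadC_meas (x0 := x0) (R := R) (ta := ta) (tb := tb) (τ := τ) hβ.lsc hcs.wc hτ Kh k hZ
    (P := fun _ _ => True) (by simp)
  set E := {x : En n | ∃ z ∈ Zs, ∃ X : En n × ℝ, BadC β x0 R ta tb w τ Kh k z X ∧ X.1 = x ∧ True} with hE
  have := bad_vol (ρ := 2 * R) hn hν hβ.lsc hcs hk hK hK0 hκ (by positivity) hm (by
    rintro x ⟨z, hz, X, h1, h2, -⟩
    refine ⟨z, X, h1, h2, ?_⟩
    have h3 := hZR hz
    have h4 := h1.1.1.1
    rw [h2] at h4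
    rw [← dist_eq_norm]
    rw [mem_closedBall] at h3 h4
    linarith [dist_triangle_right x z x0])
  calc _ ≤ volume {z | ∃ X, BadC β x0 R ta tb w τ Kh k z X ∧ X.1 ∈ E} := by
        refine measure_mono ?_
        rintro z ⟨hz, X, hX⟩
        exact ⟨X, hX, z, hz, X, hX, rfl, trivial⟩
    _ ≤ _ := this
    _ ≤ ENNReal.ofReal (24 * ν * (2 * R)) ^ n * ∫⁻ x, β x ^ n := by
        exact mul_le_mul_right (setLIntegral_le_lintegral _ _) _
    _ ≤ _ := by
        rw [show 24 * ν * (2 * R) = 48 * ν * R by ring]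
        gcongr; exact hβ.int

/-- Lemma D: multi-level bound -/
lemma BadZ_sum (hn : 0 < n) (hν : 1 ≤ ν) {S : ℝ≥0∞} (hβ : Drift S β) (hcs : CS ν β x0 R ta tb w)
    (hR : 0 < R) (hτ : Continuous τ) {Zs : Set (En n)} (hZ : IsCompact Zs) (hZR : Zs ⊆ closedBall x0 R)
    {k : ℕ → ℝ} (hk : ∀ j, 0 < k j) {Kh : ℝ} {J : ℕ} (hK : ∀ j < J, n * ν * k j ≤ Kh) (hK0 : 0 < Kh)
    (hκ : ∀ s t, s ≤ t → -Kh * (t - s) ≤ τ t - τ s) {η : ℝ} (hη : 0 < η)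
    (hkk : ∀ i j, i < j → k i * (2 * R) < k j * η) :
    ∑ j ∈ Finset.range J, volume (BadZ β x0 R ta tb w τ Kh (k j) Zs) ≤
      ENNReal.ofReal (48 * ν * R) ^ n * S + J * (ENNReal.ofReal (24 * ν * η) ^ n * S) := by
  let EL : ℕ → Set (En n) := fun j => {x | ∃ z ∈ Zs, ∃ X : En n × ℝ,
    BadC β x0 R ta tb w τ Kh (k j) z X ∧ X.1 = x ∧ η ≤ ‖x - z‖}
  let ES : ℕ → Set (En n) := fun j => {x | ∃ z ∈ Zs, ∃ X : En n × ℝ,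
    BadC β x0 R ta tb w τ Kh (k j) z X ∧ X.1 = x ∧ ‖x - z‖ ≤ η}
  have hELm : ∀ j, MeasurableSet (EL j) := fun j => BadC_meas hβ.lsc hcs.wc hτ Kh (k j) hZ
    (P := fun x z => η ≤ ‖x - z‖) (isClosed_le (by fun_prop) (by fun_prop))
  have hESm : ∀ j, MeasurableSet (ES j) := fun j => BadC_meas hβ.lsc hcs.wc hτ Kh (k j) hZ
    (P := fun x z => ‖x - z‖ ≤ η) (isClosed_le (by fun_prop) (by fun_prop))
  have hdist : ∀ j z X, z ∈ Zs → BadC β x0 R ta tb w τ Kh (k j) z X → ‖X.1 - z‖ ≤ 2 * R := by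
    intro j z X hz h1
    have h3 := hZR hz
    have h4 := h1.1.1.1
    rw [← dist_eq_norm]
    rw [mem_closedBall] at h3 h4
    linarith [dist_triangle_right X.1 z x0]
  have hdisj : ∀ i j, i < j → Disjoint (EL i) (EL j) := by
    intro i j hij
    refine disjoint_left.2 ?_
    rintro x ⟨z, hz, X, hX, hXx, hη1⟩ ⟨z', hz', X', hX', hXx', hη2⟩
    have h1 := hcs.grad hX.1 hX'.1 (hXx.trans hXx'.symm) hX.2.1 hX.2.2.1
    have h2 : k i * ‖x - z‖ = k j * ‖x - z'‖ := by
      have := congrArg norm h1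
      rw [norm_smul, norm_smul, Real.norm_eq_abs, Real.norm_eq_abs, abs_of_pos (hk i),
        abs_of_pos (hk j), norm_sub_rev, norm_sub_rev z', hXx] at this
      exact this
    have h3 := hdist i z X hz hX
    rw [hXx] at h3
    have h4 := hkk i j hij
    have h5 := mul_le_mul_of_nonneg_left h3 (hk i).le
    have h6 := mul_le_mul_of_nonneg_left hη2 (hk j).le
    linarith
  have hpd : Pairwise (Function.onFun Disjoint EL) := by
    intro i j hij
    rcases lt_or_gt_of_ne hij with h | h
    · exact hdisj i j h
    · exact (hdisj j i h).symm
  have hone : ∀ j ∈ Finset.range J, volume (BadZ β x0 R ta tb w τ Kh (k j) Zs) ≤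
      ENNReal.ofReal (48 * ν * R) ^ n * (∫⁻ x in EL j, β x ^ n) + ENNReal.ofReal (24 * ν * η) ^ n * S := by
    intro j hj
    have hj := Finset.mem_range.1 hj
    have b1 := bad_vol (ρ := 2 * R) hn hν hβ.lsc hcs (hk j) (hK j hj) hK0 hκ (by positivity) (hELm j) (by
      rintro x ⟨z, hz, X, h1, h2, -⟩
      exact ⟨z, X, h1, h2, h2 ▸ hdist j z X hz h1⟩)
    have b2 := bad_vol (ρ := η) hn hν hβ.lsc hcs (hk j) (hK j hj) hK0 hκ hη (hESm j) (by
      rintro x ⟨z, hz, X, h1, h2, h3⟩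
      exact ⟨z, X, h1, h2, h3⟩)
    calc _ ≤ volume ({z | ∃ X, BadC β x0 R ta tb w τ Kh (k j) z X ∧ X.1 ∈ EL j} ∪
          {z | ∃ X, BadC β x0 R ta tb w τ Kh (k j) z X ∧ X.1 ∈ ES j}) := by
          refine measure_mono ?_
          rintro z ⟨hz, X, hX⟩
          rcases le_total η ‖X.1 - z‖ with h | h
          · exact Or.inl ⟨X, hX, z, hz, X, hX, rfl, h⟩
          · exact Or.inr ⟨X, hX, z, hz, X, hX, rfl, h⟩
      _ ≤ _ := measure_union_le _ _
      _ ≤ _ := by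
        refine add_le_add (b1.trans_eq ?_) (b2.trans ?_)
        · rw [show 24 * ν * (2 * R) = 48 * ν * R by ring]
        · exact mul_le_mul_right ((setLIntegral_le_lintegral _ _).trans hβ.int) _
  refine (Finset.sum_le_sum hone).trans ?_
  rw [Finset.sum_add_distrib, Finset.sum_const, Finset.card_range, nsmul_eq_mul, ← Finset.mul_sum]
  refine add_le_add_left (mul_le_mul_right ?_ _) _
  rw [← lintegral_biUnion_finset (fun i _ j _ hij => hpd hij) (fun j _ => hELm j)]
  exact (setLIntegral_le_lintegral _ _).trans hβ.int

/-- Corollary of Lemma D: some level has a good `z`. -/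
lemma exists_good (hn : 0 < n) (hν : 1 ≤ ν) (S : NNReal) (hR : 0 < R) {ρ : ℝ} (hρ : 0 < ρ) (hρR : ρ ≤ R) :
    ∃ (J : ℕ) (θ : ℝ), 1 ≤ θ ∧ ∀ (β : En n → ℝ≥0∞) (x0 : En n) (ta tb : ℝ) (w : En n × ℝ → ℝ) (τ : ℝ → ℝ)
      (k1 Kh : ℝ), Drift S β → CS ν β x0 R ta tb w → Continuous τ → 0 < k1 →
      n * ν * (k1 * θ ^ J) ≤ Kh → (∀ s t, s ≤ t → -Kh * (t - s) ≤ τ t - τ s) →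
      ∃ k, k1 ≤ k ∧ k ≤ k1 * θ ^ J ∧ ∃ z ∈ closedBall x0 ρ, ∀ X,
        ¬ BadC β x0 R ta tb w τ Kh k z X := by
  have hν0 : 0 < ν := by linarith
  set V : ℝ≥0∞ := volume (closedBall (0 : En n) ρ) with hV
  have hV0 : 0 < V := measure_closedBall_pos _ _ hρ
  have hVt : V ≠ ∞ := measure_closedBall_lt_top.ne
  set Vr := V.toReal
  have hVr : 0 < Vr := ENNReal.toReal_pos hV0.ne' hVt
  obtain ⟨η, hη, hη2⟩ : ∃ η : ℝ, 0 < η ∧ (24 * ν * η) ^ n * S < Vr / 4 := by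
    have : Tendsto (fun η : ℝ => (24 * ν * η) ^ n * S) (𝓝[>] 0) (𝓝 0) := by
      have hc : Continuous (fun η : ℝ => (24 * ν * η) ^ n * S) := by fun_prop
      have := hc.tendsto 0
      simp only [mul_zero, zero_pow hn.ne', zero_mul] at this
      exact this.mono_left nhdsWithin_le_nhds
    obtain ⟨η, h1, h2⟩ := ((this.eventually_lt_const (show 0 < Vr / 4 by positivity)).and
      self_mem_nhdsWithin).exists
    exact ⟨η, h2, h1⟩
  obtain ⟨J, hJ⟩ := exists_nat_gt ((48 * ν * R) ^ n * S / (Vr / 4))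
  have hJ0 : 0 < J := by
    have : (0:ℝ) < J := lt_of_le_of_lt (by positivity) hJ
    exact_mod_cast this
  set θ := max 1 (2 * R / η + 1) with hθ
  have hθ1 : 1 ≤ θ := le_max_left _ _
  have hθ2 : 2 * R < θ * η := by
    have : 2 * R / η < θ := lt_of_lt_of_le (by linarith) (le_max_right _ _)
    rwa [div_lt_iff₀ hη] at this
  refine ⟨J, θ, hθ1, fun β x0 ta tb w τ k1 Kh hβ hcs hτ hk1 hK hκ => ?_⟩
  by_contra hcon
  push Not at hcon
  have hθ0 : 0 < θ := by linarith
  have hK0 : 0 < Kh := lt_of_lt_of_le (by positivity) hK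
  have hle : ∀ j, j ≤ J → θ ^ j ≤ θ ^ J := fun j hj => pow_le_pow_right₀ hθ1 hj
  have hsum := BadZ_sum (k := fun j => k1 * θ ^ j) (J := J) (η := η) (Zs := closedBall x0 ρ) hn hν hβ hcs hR hτ
    (isCompact_closedBall _ _) (closedBall_subset_closedBall hρR)
    (fun j => by positivity) (fun j hj => le_trans (by have := hle j hj.le; gcongr) hK) hK0 hκ hη
    (fun i j hij => by
      have h1 : θ ^ (i + 1) ≤ θ ^ j := pow_le_pow_right₀ hθ1 hij
      calc k1 * θ ^ i * (2 * R) < k1 * θ ^ i * (θ * η) := by gcongr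
        _ = k1 * θ ^ (i + 1) * η := by ring
        _ ≤ _ := by gcongr)
  have hfull : ∀ j ∈ Finset.range J, V ≤ volume (BadZ β x0 R ta tb w τ Kh (k1 * θ ^ j) (closedBall x0 ρ)) := by
    intro j hj
    have hj := (Finset.mem_range.1 hj).le
    have : V = volume (closedBall x0 ρ) := by
      rw [hV, Measure.addHaar_closedBall_center volume x0]
    rw [this]
    refine measure_mono fun z hz => ⟨hz, ?_⟩
    refine hcon (k1 * θ ^ j) (le_mul_of_one_le_right hk1.le (one_le_pow₀ hθ1)) ?_ z hz
    have := hle j hj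
    gcongr
  have h1 := (Finset.sum_le_sum hfull).trans hsum
  rw [Finset.sum_const, Finset.card_range, nsmul_eq_mul] at h1
  have hVe : V = ENNReal.ofReal Vr := (ENNReal.ofReal_toReal hVt).symm
  have hSe : (S : ℝ≥0∞) = ENNReal.ofReal S := by simp
  have hJe : (J : ℝ≥0∞) = ENNReal.ofReal J := by simp
  rw [hVe, hSe, hJe, ← ENNReal.ofReal_pow (by positivity), ← ENNReal.ofReal_pow (by positivity),
    ← ENNReal.ofReal_mul (by positivity), ← ENNReal.ofReal_mul (by positivity),
    ← ENNReal.ofReal_mul (by positivity), ← ENNReal.ofReal_mul (by positivity),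
    ← ENNReal.ofReal_add (by positivity) (by positivity), ENNReal.ofReal_le_ofReal_iff (by positivity)] at h1
  rw [div_lt_iff₀ (by positivity)] at hJ
  have hJr : (0:ℝ) < J := by exact_mod_cast hJ0
  have h2 := mul_lt_mul_of_pos_left hη2 hJr
  nlinarith

end

section
open Asymptotics Filter Topology

variable {ν : ℝ} {β : En n → ℝ≥0∞} {x0 : En n} {R ta tb : ℝ} {w v : En n × ℝ → ℝ} {τ : ℝ → ℝ}

lemma contact_exists (hw : ContinuousOn w (closedBall x0 R ×ˢ Icc ta tb)) (hτ : Continuous τ)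
    (hR : 0 ≤ R) (htt : ta ≤ tb) (k : ℝ) (z : En n) : ∃ X, Contact x0 R ta tb w τ k z X := by
  have hc : IsCompact (closedBall x0 R ×ˢ Icc ta tb) := (isCompact_closedBall x0 R).prod isCompact_Icc
  have hne : (closedBall x0 R ×ˢ Icc ta tb).Nonempty :=
    ⟨(x0, ta), mem_closedBall_self hR, le_rfl, htt⟩
  have hg : ContinuousOn (gfun w τ k z) (closedBall x0 R ×ˢ Icc ta tb) := by
    unfold gfun
    have h2 : Continuous fun X : En n × ℝ => τ X.2 := by fun_prop
    have h3 : Continuous fun X : En n × ℝ => k / 2 * ‖X.1 - z‖ ^ 2 := by fun_prop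
    exact (hw.add h2.continuousOn).add h3.continuousOn
  obtain ⟨X, hX, h⟩ := hc.exists_isMinOn hne hg
  exact ⟨X, hX, fun Y hY => h hY⟩

lemma CS.ofSol (hν : 1 ≤ ν) (h : Sol ν β (closedBall x0 R ×ˢ Icc ta tb) v)
    (hv : ∀ X ∈ closedBall x0 R ×ˢ Icc ta tb, 0 ≤ v X) {δ : ℝ} (hδ : 0 < δ) :
    CS ν β x0 R ta tb (fun X => Real.log (v X + δ)) := by
  have h1 := h.affine 1 δ
  simp only [one_mul] at h1
  refine ⟨h1.cont.log fun X hX => ?_, fun x hx t ht => ?_⟩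
  · have := hv X hX
    positivity
  · have hm : (x, t) ∈ closedBall x0 R ×ˢ Icc ta tb := ⟨ball_subset_closedBall hx, ht.1.le, ht.2⟩
    have := hv _ hm
    exact (h1.pt _ hm).log hν (by simp only; positivity)

lemma norm_sub_bounds {x z : En n} {a b : ℝ} (hz : ‖z‖ ≤ b) (hx : a ≤ ‖x‖) : a - b ≤ ‖x - z‖ := by
  have := norm_sub_norm_le x z
  linarith

lemma U1 (hn : 0 < n) (hν : 1 ≤ ν) (S : NNReal) : ∃ T0 c : ℝ, 0 < T0 ∧ T0 ≤ 1 / 8 ∧ 0 < c ∧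
    ∀ (β : En n → ℝ≥0∞) (v : En n × ℝ → ℝ) (T : ℝ), T ≤ T0 → Drift S β →
      Sol ν β (closedBall 0 1 ×ˢ Icc 0 T) v → (∀ X ∈ closedBall 0 1 ×ˢ Icc 0 T, 0 ≤ v X) →
      (∀ x ∈ closedBall (0 : En n) 1, 1 ≤ v (x, 0)) →
      ∀ x ∈ closedBall (0 : En n) (1 / 8), ∀ t ∈ Icc 0 T, c ≤ v (x, t) := by
  obtain ⟨J, θ, hθ, H⟩ := exists_good (n := n) (R := 1) (ρ := 1 / 16) hn hν S (by norm_num) (by norm_num)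
    (by norm_num)
  have hn' : (1:ℝ) ≤ n := by exact_mod_cast hn
  set kM := 8 * θ ^ J with hkM
  have hkM8 : 8 ≤ kM := by
    have := one_le_pow₀ hθ (n := J)
    linarith
  set Kh := n * ν * kM with hKh
  have hKh8 : 8 ≤ Kh := by
    have : 1 ≤ n * ν := one_le_mul_of_one_le_of_one_le hn' hν
    nlinarith
  set δ := Real.exp (-(3 + kM)) with hδ
  have hδ0 : 0 < δ := Real.exp_pos _
  refine ⟨1 / (3 * Kh), δ, by positivity, ?_, hδ0, ?_⟩
  · rw [div_le_div_iff₀ (by positivity) (by norm_num)]; linarith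
  intro β v T hT hβ hs hv h1 x hx t ht
  by_contra hlt
  push Not at hlt
  have hsub : closedBall (0 : En n) 1 ×ˢ Icc 0 t ⊆ closedBall 0 1 ×ˢ Icc 0 T :=
    prod_mono le_rfl (Icc_subset_Icc_right ht.2)
  have hv' : ∀ X ∈ closedBall (0 : En n) 1 ×ˢ Icc 0 t, 0 ≤ v X := fun X hX => hv X (hsub hX)
  have hcs := CS.ofSol hν (hs.mono hsub) hv' hδ0
  have hsl : ∀ s t, s ≤ t → -Kh * (t - s) ≤ 3 * Kh * t - 3 * Kh * s := by
    intro s t hst; nlinarith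
  obtain ⟨k, hk1, hk2, z, hz, hbad⟩ := H β 0 0 t _ (fun t => 3 * Kh * t) 8 Kh hβ hcs (by fun_prop)
    (by norm_num) le_rfl hsl
  have hk0 : 0 < k := by linarith
  obtain ⟨X, hX⟩ := contact_exists (τ := fun t => 3 * Kh * t) hcs.wc (by fun_prop) zero_le_one ht.1 k z
  have hz' : ‖z‖ ≤ 1 / 16 := by simpa using hz
  have hx' : ‖x‖ ≤ 1 / 8 := by simpa using hx
  have hXb : ‖X.1‖ ≤ 1 := by simpa using hX.1.1
  have hpt := hX.2 (x, t) ⟨by simp; linarith, ht.1, le_rfl⟩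
  simp only [gfun] at hpt
  have hvx := hv (x, t) ⟨by simp; linarith, ht⟩
  have hlog : Real.log (v (x, t) + δ) ≤ Real.log 2 + Real.log δ := by
    rw [← Real.log_mul (by norm_num) hδ0.ne']
    exact Real.log_le_log (by positivity) (by linarith)
  have hlogδ : Real.log δ = -(3 + kM) := Real.log_exp _
  have hl2 := Real.log_two_lt_d9
  have h3 : 3 * Kh * t ≤ 1 := by
    have := ht.2.trans hT
    rw [le_div_iff₀ (by positivity)] at this
    linarith
  have h4 : ‖x - z‖ ≤ 3 / 16 := (norm_sub_le _ _).trans (by linarith)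
  have h4' : ‖x - z‖ ^ 2 ≤ (3 / 16) ^ 2 := by gcongr
  have h5 : k / 2 * ‖x - z‖ ^ 2 ≤ k / 2 * (3 / 16) ^ 2 := by gcongr
  have hvX := hv' X hX.1
  have hXt : 0 ≤ 3 * Kh * X.2 := mul_nonneg (by positivity) hX.1.2.1
  have hq : 0 ≤ k / 2 * ‖X.1 - z‖ ^ 2 := by positivity
  by_cases hlat : X.1 ∈ ball (0 : En n) 1
  · rcases hX.1.2.1.eq_or_lt with h0 | h0
    · have : 1 ≤ v X := by
        have := h1 X.1 hX.1.1
        rwa [h0] at this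
      have : 0 ≤ Real.log (v X + δ) := Real.log_nonneg (by linarith)
      linarith
    · have hnb : ¬ bad β Kh k X.1 z := fun hb => hbad X ⟨hX, hlat, h0, hb⟩
      obtain ⟨A, hA, -, hA2⟩ := hcs.notBad hk0.le hX hlat h0 (κ := 3 * Kh)
        (Eventually.of_forall fun s => le_of_eq (by ring))
        (mul_le_mul_of_nonneg_left hk2 (by positivity)) (by positivity) hnb
      have : 0 ≤ (k * ‖X.1 - z‖) ^ 2 / ν := by positivity
      have : 0 ≤ A / ν := by positivity
      linarith
  · have : ‖X.1‖ = 1 := le_antisymm hXb (by simpa using hlat)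
    have h6 := norm_sub_bounds hz' this.ge
    have h7 : (15 / 16) ^ 2 ≤ ‖X.1 - z‖ ^ 2 := by
      apply pow_le_pow_left₀ (by norm_num); linarith
    have h8 : k / 2 * (15 / 16) ^ 2 ≤ k / 2 * ‖X.1 - z‖ ^ 2 := by gcongr
    have : Real.log δ ≤ Real.log (v X + δ) := Real.log_le_log hδ0 (by linarith)
    linarith

set_option maxHeartbeats 800000 in
lemma U2 (hn : 0 < n) (hν : 1 ≤ ν) (S : NNReal) {T : ℝ} (hT : 0 < T) : ∃ c : ℝ, 0 < c ∧
    ∀ (β : En n → ℝ≥0∞) (v : En n × ℝ → ℝ) (t1 : ℝ), T ≤ t1 → Drift S β →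
      Sol ν β (closedBall 0 3 ×ˢ Icc 0 t1) v → (∀ X ∈ closedBall 0 3 ×ˢ Icc 0 t1, 0 ≤ v X) →
      (∀ x ∈ closedBall (0 : En n) (1 / 8), ∀ t ∈ Icc 0 t1, 1 ≤ v (x, t)) →
      ∀ x ∈ closedBall (0 : En n) 2, c ≤ v (x, t1) := by
  obtain ⟨J, θ, hθ, H⟩ := exists_good (n := n) (R := 3) (ρ := 1 / 16) hn hν S (by norm_num) (by norm_num)
    (by norm_num)
  have hn' : (1:ℝ) ≤ n := by exact_mod_cast hn
  have hν0 : 0 < ν := by linarith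
  set Θ := θ ^ J with hΘd
  have hΘ : 1 ≤ Θ := one_le_pow₀ hθ
  set C := 4 * Θ / T + n * ν * Θ with hC
  have hC0 : 0 < C := by positivity
  set k1 := 768 * ν * C + 1 with hk1d
  have hk1 : 1 ≤ k1 := by have : 0 ≤ 768 * ν * C := by positivity
                          linarith
  set kM := k1 * Θ with hkM
  have hkM1 : 1 ≤ kM := one_le_mul_of_one_le_of_one_le hk1 hΘ
  set K2 := (1 + 3 * kM) / T with hK2
  have hK20 : 0 < K2 := by positivity
  have hK2T : K2 * T = 1 + 3 * kM := by rw [hK2]; field_simp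
  set Kh := K2 + n * ν * kM with hKh
  have hKh0 : 0 < Kh := by positivity
  have hKhC : Kh ≤ k1 * C := by
    have : K2 ≤ 4 * kM / T := by rw [hK2]; gcongr; linarith
    have h2 : k1 * C = 4 * kM / T + n * ν * kM := by rw [hC, hkM]; ring
    linarith
  set δ := Real.exp (-(2 + 3 * kM)) with hδ
  have hδ0 : 0 < δ := Real.exp_pos _
  refine ⟨δ, hδ0, ?_⟩
  intro β v t1 hTt hβ hs hv h1 x hx
  by_contra hlt
  push Not at hlt
  have hsub : closedBall (0 : En n) 3 ×ˢ Icc (t1 - T) t1 ⊆ closedBall 0 3 ×ˢ Icc 0 t1 :=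
    prod_mono le_rfl (Icc_subset_Icc_left (by linarith))
  have hv' : ∀ X ∈ closedBall (0 : En n) 3 ×ˢ Icc (t1 - T) t1, 0 ≤ v X := fun X hX => hv X (hsub hX)
  have hcs := CS.ofSol hν (hs.mono hsub) hv' hδ0
  have hsl : ∀ s t, s ≤ t → -Kh * (t - s) ≤ K2 * (t1 - t) - K2 * (t1 - s) := by
    intro s t hst
    have : 0 ≤ n * ν * kM * (t - s) := mul_nonneg (by positivity) (by linarith)
    rw [hKh]; linarith
  obtain ⟨k, hk1', hk2, z, hz, hbad⟩ := H β 0 (t1 - T) t1 _ (fun t => K2 * (t1 - t)) k1 Kh hβ hcs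
    (by fun_prop) (by linarith) (by rw [hKh]; linarith) hsl
  have hk0 : 0 < k := by linarith
  obtain ⟨X, hX⟩ := contact_exists (τ := fun t => K2 * (t1 - t)) hcs.wc (by fun_prop) (by norm_num)
    (by linarith) k z
  have hz' : ‖z‖ ≤ 1 / 16 := by simpa using hz
  have hx' : ‖x‖ ≤ 2 := by simpa using hx
  have hXb : ‖X.1‖ ≤ 3 := by simpa using hX.1.1
  have hpt := hX.2 (x, t1) ⟨by simp; linarith, by simp; linarith, le_rfl⟩
  simp only [gfun] at hpt
  have hvx := hv (x, t1) ⟨by simp; linarith, by simp; linarith, le_rfl⟩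
  have hlog : Real.log (v (x, t1) + δ) ≤ Real.log 2 + Real.log δ := by
    rw [← Real.log_mul (by norm_num) hδ0.ne']
    exact Real.log_le_log (by positivity) (by linarith)
  have hlogδ : Real.log δ = -(2 + 3 * kM) := Real.log_exp _
  have hl2 := Real.log_two_lt_d9
  have h4 : ‖x - z‖ ≤ 33 / 16 := (norm_sub_le _ _).trans (by linarith)
  have h4' : ‖x - z‖ ^ 2 ≤ (33 / 16) ^ 2 := by gcongr
  have h5 : k / 2 * ‖x - z‖ ^ 2 ≤ k / 2 * (33 / 16) ^ 2 := by gcongr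
  have hvX := hv' X hX.1
  have hXt : 0 ≤ K2 * (t1 - X.2) := mul_nonneg hK20.le (by linarith [hX.1.2.2])
  have hq : 0 ≤ k / 2 * ‖X.1 - z‖ ^ 2 := by positivity
  have hlow : Real.log δ ≤ Real.log (v X + δ) := Real.log_le_log hδ0 (by linarith)
  rw [sub_self, mul_zero] at hpt
  by_cases hlat : X.1 ∈ ball (0 : En n) 3
  · rcases hX.1.2.1.eq_or_lt with h0 | h0
    · have : K2 * (t1 - X.2) = K2 * T := by rw [← h0]; ring
      linarith
    · have hnb : ¬ bad β Kh k X.1 z := fun hb => hbad X ⟨hX, hlat, h0, hb⟩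
      have hnk : n * ν * k ≤ Kh := by
        have : n * ν * k ≤ n * ν * kM := mul_le_mul_of_nonneg_left hk2 (by positivity)
        rw [hKh]; linarith
      obtain ⟨A, hA, -, hA2⟩ := hcs.notBad hk0.le hX hlat h0 (κ := -K2)
        (Eventually.of_forall fun s => le_of_eq (by ring)) hnk hKh0.le hnb
      have hA3 : 0 ≤ A / ν := by positivity
      by_cases hin : ‖X.1‖ ≤ 1 / 8
      · have : 1 ≤ v X := h1 X.1 (by simpa using hin) X.2 (hsub hX.1).2
        have : 0 ≤ Real.log (v X + δ) := Real.log_nonneg (by linarith)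
        linarith
      · have h6 := norm_sub_bounds hz' (not_le.1 hin).le
        have h7 : (k1 * (1 / 16)) ^ 2 ≤ (k * ‖X.1 - z‖) ^ 2 := by
          gcongr; linarith
        have h8 : (k1 * (1 / 16)) ^ 2 / ν ≤ (k * ‖X.1 - z‖) ^ 2 / ν := by gcongr
        have h9 : 3 * (k1 * C) < (k1 * (1 / 16)) ^ 2 / ν := by
          rw [lt_div_iff₀ hν0]
          have h10 : 768 * ν * C < k1 := by rw [hk1d]; exact lt_add_one _
          have h11 := mul_lt_mul_of_pos_left h10 (show 0 < k1 by exact lt_of_lt_of_le one_pos hk1)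
          have e1 : 3 * (k1 * C) * ν = (k1 * (768 * ν * C)) / 256 := by ring
          have e2 : (k1 * (1 / 16)) ^ 2 = k1 * k1 / 256 := by ring
          rw [e1, e2]
          exact div_lt_div_of_pos_right h11 (by norm_num)
        have : K2 ≤ Kh := by
          rw [hKh]; have : 0 ≤ n * ν * kM := by positivity
          linarith
        linarith
  · have : ‖X.1‖ = 3 := le_antisymm hXb (by simpa using hlat)
    have h6 := norm_sub_bounds hz' this.ge
    have h7 : (47 / 16) ^ 2 ≤ ‖X.1 - z‖ ^ 2 := by
      apply pow_le_pow_left₀ (by norm_num); linarith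
    have h8 : k / 2 * (47 / 16) ^ 2 ≤ k / 2 * ‖X.1 - z‖ ^ 2 := by gcongr
    linarith

/-- one step -/
lemma E1 (hn : 0 < n) (hν : 1 ≤ ν) (S : NNReal) : ∃ h c : ℝ, 0 < h ∧ h ≤ 1 / 8 ∧ 0 < c ∧
    ∀ (β : En n → ℝ≥0∞) (v : En n × ℝ → ℝ) (T : ℝ), h / 2 ≤ T → T ≤ h → Drift S β →
      Sol ν β (closedBall 0 3 ×ˢ Icc 0 T) v → (∀ X ∈ closedBall 0 3 ×ˢ Icc 0 T, 0 ≤ v X) →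
      (∀ x ∈ closedBall (0 : En n) 1, 1 ≤ v (x, 0)) →
      ∀ x ∈ closedBall (0 : En n) 2, c ≤ v (x, T) := by
  obtain ⟨h, c1, hh, hh8, hc1, H1⟩ := U1 (n := n) hn hν S
  obtain ⟨c2, hc2, H2⟩ := U2 (n := n) hn hν S (T := h / 2) (by positivity)
  refine ⟨h, c1 * c2, hh, hh8, by positivity, fun β v T hT1 hT2 hβ hs hv h1 x hx => ?_⟩
  have hsub : closedBall (0 : En n) 1 ×ˢ Icc 0 T ⊆ closedBall 0 3 ×ˢ Icc 0 T :=
    prod_mono (closedBall_subset_closedBall (by norm_num)) le_rfl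
  have h3 := H1 β v T hT2 hβ (hs.mono hsub) (fun X hX => hv X (hsub hX)) h1
  have h4 := H2 β (fun X => c1⁻¹ * v X + 0) T hT1 hβ (hs.affine c1⁻¹ 0)
    (fun X hX => by have := hv X hX; positivity)
    (fun x hx t ht => by
      have := h3 x hx t ht
      simp only [add_zero]
      rw [← div_eq_inv_mul, one_le_div hc1]; exact this) x hx
  simp only [add_zero] at h4
  rwa [← div_eq_inv_mul, le_div_iff₀ hc1, mul_comm] at h4

/-- translated in time version with level `A` -/
lemma E2 (hn : 0 < n) (hν : 1 ≤ ν) (S : NNReal) : ∃ h c : ℝ, 0 < h ∧ h ≤ 1 / 8 ∧ 0 < c ∧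
    ∀ (β : En n → ℝ≥0∞) (v : En n × ℝ → ℝ) (s T A : ℝ), h / 2 ≤ T → T ≤ h → 0 < A → Drift S β →
      Sol ν β (closedBall 0 3 ×ˢ Icc s (s + T)) v → (∀ X ∈ closedBall 0 3 ×ˢ Icc s (s + T), 0 ≤ v X) →
      (∀ x ∈ closedBall (0 : En n) 1, A ≤ v (x, s)) →
      ∀ x ∈ closedBall (0 : En n) 2, c * A ≤ v (x, s + T) := by
  obtain ⟨h, c, hh, hh8, hc, H⟩ := E1 (n := n) hn hν S
  refine ⟨h, c, hh, hh8, hc, fun β v s T A hT1 hT2 hA hβ hs hv h1 x hx => ?_⟩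
  have hmt : MapsTo (psc (0 : En n) s 1) (closedBall 0 3 ×ˢ Icc 0 T) (closedBall 0 3 ×ˢ Icc s (s + T)) := by
    rintro ⟨x, t⟩ ⟨hx, ht⟩
    refine ⟨by simpa [psc] using hx, ?_⟩
    simp only [psc, mem_Icc] at ht ⊢
    constructor <;> linarith [ht.1, ht.2]
  have := H _ _ T hT1 hT2 (hβ.scale 0 one_pos) ((hs.scale one_pos hmt).affine A⁻¹ 0)
    (fun X hX => by have := hv _ (hmt hX); positivity)
    (fun x hx => by
      have := h1 x hx
      simp only [add_zero, psc, one_smul, zero_add, mul_zero]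
      rw [← div_eq_inv_mul, one_le_div hA]; exact this) x hx
  simp only [add_zero, psc, one_smul, zero_add, one_pow, one_mul] at this
  rwa [← div_eq_inv_mul, le_div_iff₀ hA] at this

lemma E3 (hn : 0 < n) (hν : 1 ≤ ν) (S : NNReal) (T : ℝ) : ∃ c : ℝ, 0 < c ∧
    ∀ (β : En n → ℝ≥0∞) (v : En n × ℝ → ℝ) (T' : ℝ), T' ≤ T → Drift S β →
      Sol ν β (closedBall 0 3 ×ˢ Icc 0 T') v → (∀ X ∈ closedBall 0 3 ×ˢ Icc 0 T', 0 ≤ v X) →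
      (∀ x ∈ closedBall (0 : En n) 1, 1 ≤ v (x, 0)) →
      ∀ x ∈ closedBall (0 : En n) 2, ∀ t ∈ Icc (1 / 8) T', c ≤ v (x, t) := by
  obtain ⟨h, c', hh, hh8, hc', H'⟩ := E2 (n := n) hn hν S
  obtain ⟨c, hc, hc1, H⟩ : ∃ c > 0, c ≤ 1 ∧  ∀ (β : En n → ℝ≥0∞) (v : En n × ℝ → ℝ) (s T A : ℝ), h / 2 ≤ T → T ≤ h → 0 < A → Drift S β →
      Sol ν β (closedBall 0 3 ×ˢ Icc s (s + T)) v → (∀ X ∈ closedBall 0 3 ×ˢ Icc s (s + T), 0 ≤ v X) →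
      (∀ x ∈ closedBall (0 : En n) 1, A ≤ v (x, s)) →
      ∀ x ∈ closedBall (0 : En n) 2, c * A ≤ v (x, s + T) := by
    refine ⟨min c' 1, by positivity, min_le_right _ _, fun β v s T A h1 h2 h3 h4 h5 h6 h7 x hx => ?_⟩
    refine le_trans ?_ (H' β v s T A h1 h2 h3 h4 h5 h6 h7 x hx)
    gcongr
    exact min_le_left _ _
  obtain ⟨m, hm⟩ := exists_nat_gt (T / (h / 2))
  rw [div_lt_iff₀ (by positivity)] at hm
  refine ⟨c ^ (m + 1), by positivity, fun β v T' hT' hβ hs hv h1 => ?_⟩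
  have key : ∀ j : ℕ, ∀ t, h / 2 ≤ t → t ≤ T' → t ≤ (j + 2) * (h / 2) →
      ∀ x ∈ closedBall (0 : En n) 2, c ^ (j + 1) ≤ v (x, t) := by
    intro j
    induction j with
    | zero =>
      intro t ht1 ht2 ht3 x hx
      have hsub : closedBall (0 : En n) 3 ×ˢ Icc 0 (0 + t) ⊆ closedBall 0 3 ×ˢ Icc 0 T' :=
        prod_mono le_rfl (Icc_subset_Icc_right (by linarith))
      have := H β v 0 t 1 ht1 (by push_cast at ht3; linarith) one_pos hβ (hs.mono hsub)
        (fun X hX => hv X (hsub hX)) h1 x hx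
      simpa using this
    | succ j ih =>
      intro t ht1 ht2 ht3 x hx
      by_cases h2 : t ≤ (j + 2) * (h / 2)
      · refine le_trans ?_ (ih t ht1 ht2 h2 x hx)
        exact pow_le_pow_of_le_one hc.le hc1 (by omega)
      · push Not at h2
        push_cast at ht3
        have hj : (0:ℝ) ≤ j * (h / 2) := by positivity
        have hsub : closedBall (0 : En n) 3 ×ˢ Icc (t - h / 2) (t - h / 2 + h / 2) ⊆ closedBall 0 3 ×ˢ Icc 0 T' :=
          prod_mono le_rfl (Icc_subset_Icc (by linarith) (by linarith))
        have := H β v (t - h / 2) (h / 2) (c ^ (j + 1)) le_rfl (by linarith) (by positivity) hβ (hs.mono hsub)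
          (fun X hX => hv X (hsub hX)) (fun x hx => ih (t - h / 2) (by linarith) (by linarith) (by linarith) x
            (closedBall_subset_closedBall (by norm_num) hx)) x hx
        rw [sub_add_cancel] at this
        rw [pow_succ, mul_comm]; exact this
  intro x hx t ht
  exact key m t (by linarith [ht.1]) ht.2 (by linarith [ht.2]) x hx

/-- The expansion lemma at a general location, scale and level. -/
lemma Eexp' (hn : 0 < n) (hν : 1 ≤ ν) (S : NNReal) (T : ℝ) : ∃ c : ℝ, 0 < c ∧
    ∀ (β : En n → ℝ≥0∞) (v : En n × ℝ → ℝ) (y : En n) (s s1 ρ A : ℝ), 0 < ρ → s1 ≤ s + ρ ^ 2 * T → 0 ≤ A → Drift S β →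
      Sol ν β (closedBall y (3 * ρ) ×ˢ Icc s s1) v →
      (∀ X ∈ closedBall y (3 * ρ) ×ˢ Icc s s1, 0 ≤ v X) →
      (∀ x ∈ closedBall y ρ, A ≤ v (x, s)) →
      ∀ x ∈ closedBall y (2 * ρ), ∀ t ∈ Icc (s + ρ ^ 2 / 8) s1, c * A ≤ v (x, t) := by
  obtain ⟨c, hc, H⟩ := E3 (n := n) hn hν S T
  refine ⟨c, hc, fun β v y s s1 ρ A hρ hs1 hA hβ hs hv h1 x hx t ht => ?_⟩
  rcases hA.eq_or_lt with rfl | hA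
  · rw [mul_zero]
    refine hv _ ⟨closedBall_subset_closedBall (by linarith) hx, ?_, ht.2⟩
    have := ht.1
    have : 0 ≤ ρ ^ 2 / 8 := by positivity
    linarith
  have hmt : MapsTo (psc y s ρ) (closedBall 0 3 ×ˢ Icc 0 ((s1 - s) / ρ ^ 2)) (closedBall y (3 * ρ) ×ˢ Icc s s1) := by
    rintro ⟨x, t⟩ ⟨hx, ht⟩
    simp only [mem_closedBall, dist_zero_right, mem_Icc] at hx ht
    refine ⟨?_, ?_⟩
    · simp only [psc, mem_closedBall, dist_self_add_left, norm_smul, Real.norm_eq_abs, abs_of_pos hρ]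
      nlinarith
    · simp only [psc, mem_Icc]
      have := mul_nonneg (sq_nonneg ρ) ht.1
      have := mul_le_mul_of_nonneg_left ht.2 (sq_nonneg ρ)
      rw [mul_div_cancel₀ _ (pow_pos hρ 2).ne'] at this
      constructor <;> linarith
  have hx2 : ρ⁻¹ • (x - y) ∈ closedBall (0 : En n) 2 := by
    rw [mem_closedBall, dist_eq_norm] at hx
    simp only [mem_closedBall, dist_zero_right, norm_smul, norm_inv, Real.norm_eq_abs, abs_of_pos hρ]
    rw [inv_mul_le_iff₀ hρ]; linarith
  have ht2 : (t - s) / ρ ^ 2 ∈ Icc (1 / 8) ((s1 - s) / ρ ^ 2) := by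
    constructor
    · rw [le_div_iff₀ (by positivity)]; linarith [ht.1]
    · gcongr; exact ht.2
  have := H _ _ ((s1 - s) / ρ ^ 2) (by rw [div_le_iff₀ (by positivity)]; linarith) (hβ.scale y hρ) ((hs.scale hρ hmt).affine A⁻¹ 0)
    (fun X hX => by have := hv _ (hmt hX); positivity)
    (fun x hx => by
      have := h1 (y + ρ • x) (by
        simp only [mem_closedBall, dist_zero_right] at hx
        simp only [mem_closedBall, dist_self_add_left, norm_smul, Real.norm_eq_abs, abs_of_pos hρ]
        nlinarith)
      simp only [add_zero, psc, mul_zero]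
      rw [← div_eq_inv_mul, one_le_div hA]; exact this) _ hx2 _ ht2
  simp only [add_zero, psc, smul_inv_smul₀ hρ.ne', add_sub_cancel, mul_div_cancel₀ _ (pow_pos hρ 2).ne'] at this
  rwa [← div_eq_inv_mul, le_div_iff₀ hA] at this

lemma Eexp (hn : 0 < n) (hν : 1 ≤ ν) (S : NNReal) (T : ℝ) : ∃ c : ℝ, 0 < c ∧
    ∀ (β : En n → ℝ≥0∞) (v : En n × ℝ → ℝ) (y : En n) (s ρ A : ℝ), 0 < ρ → 0 ≤ A → Drift S β →
      Sol ν β (closedBall y (3 * ρ) ×ˢ Icc s (s + ρ ^ 2 * T)) v →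
      (∀ X ∈ closedBall y (3 * ρ) ×ˢ Icc s (s + ρ ^ 2 * T), 0 ≤ v X) →
      (∀ x ∈ closedBall y ρ, A ≤ v (x, s)) →
      ∀ x ∈ closedBall y (2 * ρ), ∀ t ∈ Icc (s + ρ ^ 2 / 8) (s + ρ ^ 2 * T), c * A ≤ v (x, t) := by
  obtain ⟨c, hc, H⟩ := Eexp' (n := n) hn hν S T
  exact ⟨c, hc, fun β v y s ρ A hρ => H β v y s _ ρ A hρ le_rfl⟩

end

section
open Asymptotics Filter Topology

variable {ν : ℝ} {β : En n → ℝ≥0∞} {v : En n × ℝ → ℝ}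

lemma first_hit {f : ℝ → ℝ} {H : NNReal} (hf : LipschitzWith H f) {h1 h2 : ℝ} (h0 : f 0 ≤ h1)
    (hone : h2 ≤ f 1) {T : Set ℝ}
    (hT : ∀ σ ∈ Ioc (0:ℝ) 1, h1 < f σ → (∀ σ' ∈ Ico 0 σ, f σ' < f σ) → σ ∈ T) :
    ENNReal.ofReal (h2 - h1) ≤ H * volume T := by
  have hsub : Ioc h1 h2 ⊆ f '' T := by
    intro h hh
    have hc : IsCompact {σ ∈ Icc (0:ℝ) 1 | h ≤ f σ} := by
      have := isCompact_Icc (a := (0:ℝ)) (b := 1)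
      exact this.inter_right (isClosed_le continuous_const hf.continuous)
    obtain ⟨σ, hσ, hmin⟩ := hc.exists_isLeast ⟨1, ⟨zero_le_one, le_rfl⟩, hh.2.trans hone⟩
    have hσ0 : 0 < σ := by
      rcases hσ.1.1.eq_or_lt with e | e
      · have := hσ.2
        rw [← e] at this
        linarith [hh.1]
      · exact e
    have hlt : ∀ σ' ∈ Ico 0 σ, f σ' < h := by
      intro σ' hσ'
      by_contra hcon
      push Not at hcon
      have := hmin (show σ' ∈ {σ ∈ Icc (0:ℝ) 1 | h ≤ f σ} from ⟨⟨hσ'.1, hσ'.2.le.trans hσ.1.2⟩, hcon⟩)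
      linarith [hσ'.2]
    have hle : f σ ≤ h := by
      have ht : Tendsto f (𝓝[<] σ) (𝓝 (f σ)) := (hf.continuous.tendsto σ).mono_left nhdsWithin_le_nhds
      refine le_of_tendsto ht ?_
      have h1 : ∀ᶠ s in 𝓝[<] σ, 0 < s := (eventually_gt_nhds hσ0).filter_mono nhdsWithin_le_nhds
      filter_upwards [h1, self_mem_nhdsWithin] with s hs hs2
      exact (hlt s ⟨hs.le, hs2⟩).le
    have he : f σ = h := le_antisymm hle hσ.2
    exact ⟨σ, hT σ ⟨hσ0, hσ.1.2⟩ (by rw [he]; exact hh.1) (by rw [he]; exact hlt), he⟩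
  calc ENNReal.ofReal (h2 - h1) = volume (Ioc h1 h2) := Real.volume_Ioc.symm
    _ ≤ volume (f '' T) := measure_mono hsub
    _ ≤ _ := by
      have := hf.hausdorffMeasure_image_le zero_le_one T
      rwa [hausdorffMeasure_real, ENNReal.rpow_one] at this

def tS (H σ t : ℝ) : ℝ := -8 * t + H * max (t - σ) 0

lemma tS_cont (H : ℝ) : Continuous (fun q : ℝ × ℝ => tS H q.1 q.2) := by unfold tS; fun_prop

lemma tS_cont' (H σ : ℝ) : Continuous (tS H σ) := by unfold tS; fun_prop

set_option maxHeartbeats 1600000 in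
lemma U3core (hn : 0 < n) (hν : 1 ≤ ν) {ε : ℝ≥0∞} (hβ : Drift ε β)
    (hs : Sol ν β (closedBall 0 1 ×ˢ Icc 0 1) v) (hv : ∀ X ∈ closedBall 0 1 ×ˢ Icc 0 1, 0 ≤ v X)
    (h0 : v (0, 1) < Real.exp (-4)) :
    2 * volume (closedBall (0 : En n) (1 / 8)) ≤
      (2 + ENNReal.ofReal (4 * (n * ν * 8))) * (ENNReal.ofReal (48 * ν * 1) ^ n * ε) +
      ENNReal.ofReal (4 * (n * ν * 8)) * (ENNReal.ofReal (2 * (ν * (3 * (n * ν * 8)) + 1) / 8) ^ n *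
        volume {X : En n × ℝ | X ∈ ball 0 1 ×ˢ Ioo 0 1 ∧ v X ≤ 1}) := by
  have hν0 : 0 < ν := by linarith
  have hn' : (1:ℝ) ≤ n := by exact_mod_cast hn
  have hnν : 1 ≤ n * ν := one_le_mul_of_one_le_of_one_le hn' hν
  set Kh : ℝ := n * ν * 8 with hKh
  have hKh8 : 8 ≤ Kh := by linarith
  have hKh0 : 0 < Kh := by linarith
  set H : ℝ := 4 * Kh with hH
  have hH0 : 0 < H := by linarith
  set δ := Real.exp (-4) with hδ
  have hδ0 : 0 < δ := Real.exp_pos _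
  have hlogδ : Real.log δ = -4 := Real.log_exp _
  set w : En n × ℝ → ℝ := fun X => Real.log (v X + δ) with hw
  have hcs : CS ν β 0 1 0 1 w := CS.ofSol hν hs hv hδ0
  have hsl : ∀ σ s t, s ≤ t → -Kh * (t - s) ≤ tS H σ t - tS H σ s := by
    intro σ s t hst
    have h1 : max (s - σ) 0 ≤ max (t - σ) 0 := max_le_max (by linarith) le_rfl
    have h2 := mul_le_mul_of_nonneg_left h1 hH0.le
    have h3 : 8 * (t - s) ≤ Kh * (t - s) := mul_le_mul_of_nonneg_right hKh8 (by linarith)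
    unfold tS
    linarith
  have hex : ∀ (z : En n) (σ : ℝ), ∃ X, Contact 0 1 0 1 w (tS H σ) 8 z X := fun z σ =>
    contact_exists hcs.wc (tS_cont' H σ) zero_le_one zero_le_one 8 z
  choose Xc hXc using hex
  set m : En n → ℝ → ℝ := fun z σ => gfun w (tS H σ) 8 z (Xc z σ) with hm
  have hwlow : ∀ X ∈ closedBall (0 : En n) 1 ×ˢ Icc 0 1, -4 ≤ w X := by
    intro X hX
    rw [← hlogδ]
    exact Real.log_le_log hδ0 (by linarith [hv X hX])
  have hlip : ∀ z, LipschitzWith (Real.toNNReal H) (fun σ => -m z σ) := by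
    intro z
    have key : ∀ σ σ', m z σ ≤ m z σ' + H * |σ - σ'| := by
      intro σ σ'
      have h1 := (hXc z σ).2 _ (hXc z σ').1
      have h2 : max ((Xc z σ').2 - σ) 0 ≤ max ((Xc z σ').2 - σ') 0 + |σ - σ'| := by
        have := abs_nonneg (σ - σ')
        have := neg_abs_le (σ - σ')
        refine max_le ?_ ?_
        · linarith [le_max_left ((Xc z σ').2 - σ') 0]
        · linarith [le_max_right ((Xc z σ').2 - σ') 0]
      have h3 := mul_le_mul_of_nonneg_left h2 hH0.le
      simp only [hm]
      refine h1.trans ?_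
      simp only [gfun, tS]
      linarith
    refine LipschitzWith.of_dist_le_mul fun σ σ' => ?_
    rw [Real.coe_toNNReal _ hH0.le, Real.dist_eq, Real.dist_eq, abs_le]
    have h1 := key σ σ'
    have h2 := key σ' σ
    rw [abs_sub_comm] at h2
    constructor <;> linarith
  have hbd : ∀ z ∈ closedBall (0 : En n) (1 / 8), ∀ σ, ∀ Y ∈ closedBall (0 : En n) 1 ×ˢ Icc 0 1,
      (Y.1 ∉ ball (0 : En n) 1 ∨ Y.2 = 0) → -9 ≤ gfun w (tS H σ) 8 z Y := by
    intro z hz σ Y hY hor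
    have hwl := hwlow Y hY
    have hmx : 0 ≤ H * max (Y.2 - σ) 0 := mul_nonneg hH0.le (le_max_right _ _)
    simp only [gfun, tS]
    rcases hor with hlat | h0
    · have h1 : 1 ≤ ‖Y.1‖ := by simpa using hlat
      have hz' : ‖z‖ ≤ 1 / 8 := by simpa using hz
      have h6 := norm_sub_bounds hz' h1
      have h7 : (7 / 8) ^ 2 ≤ ‖Y.1 - z‖ ^ 2 := by
        apply pow_le_pow_left₀ (by norm_num); linarith
      linarith [hY.2.2]
    · rw [h0] at hmx ⊢
      have := sq_nonneg ‖Y.1 - z‖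
      linarith
  have hgood : ∀ z σ X, Contact 0 1 0 1 w (tS H σ) 8 z X → X.1 ∈ ball (0 : En n) 1 → 0 < X.2 →
      ¬ bad β Kh 8 X.1 z → X.2 ≤ σ := by
    intro z σ X hX hlat ht hnb
    by_contra hlt
    push Not at hlt
    obtain ⟨A, hA, -, hA2⟩ := hcs.notBad (by norm_num) hX hlat ht (κ := H - 8) (by
      have : ∀ᶠ s in 𝓝[<] X.2, σ < s := (eventually_gt_nhds hlt).filter_mono nhdsWithin_le_nhds
      filter_upwards [this] with s hs
      simp only [tS]
      rw [max_eq_left (by linarith), max_eq_left (by linarith)]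
      linarith) hKh.ge hKh0.le hnb
    have : 0 ≤ (8 * ‖X.1 - z‖) ^ 2 / ν := by positivity
    have : 0 ≤ A / ν := by positivity
    linarith
  -- the sets
  set Zs := closedBall (0 : En n) (1 / 8) with hZs
  have hZc : IsCompact Zs := isCompact_closedBall _ _
  set C := CSet (0 : En n) 1 0 1 w (tS H) 8 Zs (Icc 0 1) with hC
  have hCc : IsCompact C := CSet_compact hcs.wc (tS_cont H) 8 hZc isCompact_Icc
  set Tb : Set (En n × ℝ) := Prod.snd '' (C ∩ {p : (En n × ℝ) × En n × ℝ | p.1.1 ∈ ball 0 1 ∧ 0 < p.1.2 ∧ bad β Kh 8 p.1.1 p.2.1}) with hTb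
  have hTbm : MeasurableSet Tb := sigmaCompact_meas
    ((sigmaCompact_inter hCc (BadC_open hβ.lsc Kh 8 0 1 0)).image continuous_snd)
  set C2 : Set ((En n × ℝ) × En n × ℝ) := {p ∈ C | v p.1 ≤ 1} ∩ ({p | p.1.2 = p.2.2} ∩
    {p | ¬ bad β Kh 8 p.1.1 p.2.1}) with hC2
  have hC2c : IsCompact C2 := by
    have c1 : IsCompact {p ∈ C | v p.1 ≤ 1} := by
      have : IsClosed {p ∈ C | v p.1 ≤ 1} := hCc.isClosed.isClosed_le
        (hs.cont.comp continuousOn_fst fun p hp => hp.2.2.1) continuousOn_const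
      exact hCc.of_isClosed_subset this (fun p hp => hp.1)
    refine c1.inter_right (IsClosed.inter (isClosed_eq (by fun_prop) (by fun_prop)) ?_)
    exact ((bad_open hβ.lsc Kh 8).preimage
      (by fun_prop : Continuous fun p : (En n × ℝ) × En n × ℝ => (p.1.1, p.2.1))).isClosed_compl
  set Tg : Set (En n × ℝ) := Prod.snd '' (C2 ∩ {p : (En n × ℝ) × En n × ℝ | p.1.1 ∈ ball 0 1 ∧ 0 < p.1.2}) with hTg
  have hTgm : MeasurableSet Tg := by
    refine sigmaCompact_meas ((sigmaCompact_inter hC2c (IsOpen.inter ?_ ?_)).image continuous_snd)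
    · exact isOpen_ball.preimage (by fun_prop : Continuous fun p : (En n × ℝ) × En n × ℝ => p.1.1)
    · exact isOpen_Ioi.preimage (by fun_prop : Continuous fun p : (En n × ℝ) × En n × ℝ => p.1.2)
  set D : Set (En n × ℝ) := {X : En n × ℝ | X ∈ ball 0 1 ×ˢ Ioo 0 1 ∧ v X ≤ 1} with hD
  have hDm : MeasurableSet D := by
    have hcl : IsClosed {X ∈ closedBall (0 : En n) 1 ×ˢ Icc (0:ℝ) 1 | v X ≤ 1} :=
      (isClosed_closedBall.prod isClosed_Icc).isClosed_le hs.cont continuousOn_const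
    have : D = {X ∈ closedBall (0 : En n) 1 ×ˢ Icc (0:ℝ) 1 | v X ≤ 1} ∩ (ball 0 1 ×ˢ Ioo 0 1) := by
      ext X
      constructor
      · rintro ⟨h1, h2⟩
        exact ⟨⟨⟨ball_subset_closedBall h1.1, Ioo_subset_Icc_self h1.2⟩, h2⟩, h1⟩
      · rintro ⟨⟨-, h2⟩, h1⟩
        exact ⟨h1, h2⟩
    rw [this]
    exact hcl.measurableSet.inter (isOpen_ball.prod isOpen_Ioo).measurableSet
  set bB : ℝ≥0∞ := ENNReal.ofReal (48 * ν * 1) ^ n * ε with hbB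
  set ℓ : ℝ := 2 * (ν * (3 * Kh) + 1) / 8 with hℓ
  have hℓ0 : 0 ≤ ℓ := by positivity
  -- slices
  have hslb : ∀ σ, volume ((fun z => (z, σ)) ⁻¹' Tb) ≤ bB := by
    intro σ
    refine le_trans (measure_mono ?_) (BadZ_one hn hν hβ hcs one_pos (tS_cont' H σ) hZc
      (closedBall_subset_closedBall (by norm_num)) (by norm_num) hKh.ge hKh0 (hsl σ))
    rintro z ⟨⟨X, z', σ'⟩, ⟨⟨hz, hσ, hcon⟩, h1, h2, h3⟩, he⟩
    obtain ⟨rfl, rfl⟩ := Prod.mk.inj he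
    exact ⟨hz, X, hcon, h1, h2, h3⟩
  have hslb0 : ∀ σ, σ ∉ Icc (0:ℝ) 1 → volume ((fun z => (z, σ)) ⁻¹' Tb) = 0 := by
    intro σ hσ
    have : ((fun z => (z, σ)) ⁻¹' Tb) = ∅ := by
      rw [eq_empty_iff_forall_notMem]
      rintro z ⟨⟨X, z', σ'⟩, ⟨⟨hz, hσ', hcon⟩, h1, h2, h3⟩, he⟩
      obtain ⟨rfl, rfl⟩ := Prod.mk.inj he
      exact hσ hσ'
    rw [this, measure_empty]
  have hslg : ∀ σ, σ ≠ 1 → volume ((fun z => (z, σ)) ⁻¹' Tg) ≤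
      ENNReal.ofReal ℓ ^ n * volume ((fun z => (z, σ)) ⁻¹' D) := by
    intro σ hσ1
    set E : Set (En n) := {x | ∃ z ∈ Zs, Contact 0 1 0 1 w (tS H σ) 8 z (x, σ) ∧ σ ∈ Icc (0:ℝ) 1 ∧
      x ∈ ball (0 : En n) 1 ∧ 0 < σ ∧ ¬ bad β Kh 8 x z ∧ v (x, σ) ≤ 1} with hE
    have hEf : ∀ x ∈ E, ∃ z ∈ Zs, Contact 0 1 0 1 w (tS H σ) 8 z (x, σ) ∧ σ ∈ Icc (0:ℝ) 1 ∧
      x ∈ ball (0 : En n) 1 ∧ 0 < σ ∧ ¬ bad β Kh 8 x z ∧ v (x, σ) ≤ 1 := fun x hx => hx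
    choose! f hf using hEf
    have hsub : ((fun z => (z, σ)) ⁻¹' Tg) ⊆ f '' E := by
      rintro z ⟨⟨⟨x, t⟩, z', σ'⟩, ⟨⟨⟨⟨hz, hσ', hcon⟩, hv1⟩, hts, hnb⟩, h1, h2⟩, he⟩
      obtain ⟨rfl, rfl⟩ := Prod.mk.inj he
      have hts : t = σ' := hts
      subst hts
      have hxE : x ∈ E := ⟨z', hz, hcon, hσ', h1, h2, hnb, hv1⟩
      refine ⟨x, hxE, ?_⟩
      have h3 := hf x hxE
      have h4 := hcs.grad hcon h3.2.1 rfl h1 h2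
      have h5 : z' - x = f x - x := smul_right_injective (En n) (by norm_num : (8:ℝ) ≠ 0) h4
      simpa using h5.symm
    have hvol := vol_ptlip_image (f := f) (E := E) (ℓ := Real.toNNReal ℓ) (fun x hx => by
      have h3 := hf x hx
      obtain ⟨A, hA, hQ, hA2⟩ := hcs.notBad (by norm_num) h3.2.1 h3.2.2.2.1 h3.2.2.2.2.1 (κ := -8) (by
        filter_upwards [self_mem_nhdsWithin] with s hs
        have hs : s < σ := hs
        simp only [tS]
        rw [max_eq_right (by linarith), max_eq_right (by linarith)]
        linarith) hKh.ge hKh0.le h3.2.2.2.2.2.1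
      have hA3 : A ≤ ν * (3 * Kh) := by
        have h4 : 0 ≤ (8 * ‖x - f x‖) ^ 2 / ν := by positivity
        have h5 : A / ν ≤ 3 * Kh := by
          have hA2' : A / ν + -8 + (8 * ‖x - f x‖) ^ 2 / ν ≤ 2 * Kh := hA2
          linarith
        rw [div_le_iff₀ hν0] at h5
        linarith
      obtain ⟨r, hr, hlp⟩ := hcs.lip (by norm_num) h3.2.1 h3.2.2.2.1 h3.2.2.2.2.1 (hQ 1 one_pos)
      refine ⟨r, hr, fun x' hx' hd => ?_⟩
      refine (hlp (f x') (x', σ) (hf x' hx').2.1 hd).trans ?_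
      rw [Real.coe_toNNReal _ hℓ0]
      simp only
      refine mul_le_mul_of_nonneg_right ?_ dist_nonneg
      rw [hℓ]
      gcongr)
    refine (measure_mono hsub).trans (hvol.trans ?_)
    refine mul_le_mul_right (measure_mono ?_) _
    rintro x ⟨z, hz, hcon, hσ', h1, h2, hnb, hv1⟩
    exact ⟨⟨h1, h2, lt_of_le_of_ne hσ'.2 hσ1⟩, hv1⟩
  -- total volume, from above
  have hup : volume (Tb ∪ Tg) ≤ bB + ENNReal.ofReal ℓ ^ n * volume D := by
    refine (measure_union_le _ _).trans (add_le_add ?_ ?_)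
    · rw [Measure.volume_eq_prod, Measure.prod_apply_symm hTbm]
      calc _ ≤ ∫⁻ σ, (Icc (0:ℝ) 1).indicator (fun _ => bB) σ := by
            refine lintegral_mono fun σ => ?_
            by_cases hσ : σ ∈ Icc (0:ℝ) 1
            · rw [indicator_of_mem hσ]; exact hslb σ
            · rw [indicator_of_notMem hσ]; exact (hslb0 σ hσ).le
        _ = _ := by
            rw [lintegral_indicator measurableSet_Icc, setLIntegral_const]; simp
    · rw [Measure.volume_eq_prod, Measure.prod_apply_symm hTgm, Measure.prod_apply_symm hDm,
        ← lintegral_const_mul _ (measurable_measure_prodMk_right hDm)]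
      refine lintegral_mono_ae ?_
      have : ∀ᵐ σ : ℝ, σ ≠ 1 := by simp [ae_iff]
      filter_upwards [this] with σ hσ using hslg σ hσ
  -- from below
  set B0 : Set (En n) := (fun z => (z, (0:ℝ))) ⁻¹' Tb with hB0
  have hB0m : MeasurableSet B0 := hTbm.preimage (by fun_prop)
  have hrow : ∀ z ∈ Zs \ B0, 2 ≤ ENNReal.ofReal H * volume (Prod.mk z ⁻¹' (Tb ∪ Tg)) := by
    rintro z ⟨hz, hzB⟩
    have hz' : ‖z‖ ≤ 1 / 8 := by simpa [hZs] using hz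
    have f0 : -m z 0 ≤ 9 := by
      have hX := hXc z 0
      by_cases hor : (Xc z 0).1 ∉ ball (0 : En n) 1 ∨ (Xc z 0).2 = 0
      · have := hbd z hz 0 _ hX.1 hor
        simp only [hm]; linarith
      · push Not at hor
        have ht : 0 < (Xc z 0).2 := lt_of_le_of_ne hX.1.2.1 hor.2.symm
        by_cases hb : bad β Kh 8 (Xc z 0).1 z
        · exact absurd ⟨(Xc z 0, z, 0), ⟨⟨hz, ⟨le_rfl, zero_le_one⟩, hX⟩, hor.1, ht, hb⟩, rfl⟩ hzB
        · have := hgood z 0 _ hX hor.1 ht hb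
          linarith
    have f1 : 11 ≤ -m z 1 := by
      have h1 := (hXc z 1).2 (0, 1) ⟨by simp, by simp⟩
      have h2 : gfun w (tS H 1) 8 z (0, 1) ≤ -11 := by
        have hlog : w (0, 1) ≤ Real.log 2 + Real.log δ := by
          rw [← Real.log_mul (by norm_num) hδ0.ne']
          have := hv (0, 1) ⟨by simp, by simp⟩
          exact Real.log_le_log (by positivity) (by linarith)
        have hl2 := Real.log_two_lt_d9
        have h3 : ‖(0 : En n) - z‖ ^ 2 ≤ (1 / 8) ^ 2 := by
          rw [zero_sub, norm_neg]; gcongr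
        simp only [gfun, tS, sub_self, max_self]
        linarith
      simp only [hm]; linarith
    have := first_hit (hlip z) f0 f1 (T := Prod.mk z ⁻¹' (Tb ∪ Tg)) (by
      intro σ hσ hlt hrec
      have hX := hXc z σ
      set X := Xc z σ with hXd
      have hmσ : m z σ = gfun w (tS H σ) 8 z X := rfl
      have hintr : X.1 ∈ ball (0 : En n) 1 ∧ X.2 ≠ 0 := by
        by_contra hcon
        have hor : X.1 ∉ ball (0 : En n) 1 ∨ X.2 = 0 := by
          by_contra h; push Not at h; exact hcon h
        have := hbd z hz σ X hX.1 hor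
        linarith
      have ht : 0 < X.2 := lt_of_le_of_ne hX.1.2.1 hintr.2.symm
      by_cases hb : bad β Kh 8 X.1 z
      · exact Or.inl ⟨(X, z, σ), ⟨⟨hz, ⟨hσ.1.le, hσ.2⟩, hX⟩, hintr.1, ht, hb⟩, rfl⟩
      · right
        have hle := hgood z σ X hX hintr.1 ht hb
        have heq : X.2 = σ := by
          by_contra hne
          have hlt2 : X.2 < σ := lt_of_le_of_ne hle hne
          have h1 := hrec X.2 ⟨ht.le, hlt2⟩
          have h2 := (hXc z X.2).2 X hX.1
          have h3 : gfun w (tS H X.2) 8 z X = gfun w (tS H σ) 8 z X := by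
            simp only [gfun, tS]
            rw [max_eq_right (by linarith), max_eq_right (by linarith)]
          have h4 : m z X.2 ≤ gfun w (tS H X.2) 8 z X := h2
          rw [h3, ← hmσ] at h4
          linarith
        have hv1 : v X ≤ 1 := by
          have h1 : w X < 0 := by
            have h2 : gfun w (tS H σ) 8 z X < -9 := by rw [← hmσ]; linarith
            simp only [gfun, tS] at h2
            have h3 : 0 ≤ H * max (X.2 - σ) 0 := mul_nonneg hH0.le (le_max_right _ _)
            have := sq_nonneg ‖X.1 - z‖
            linarith [hX.1.2.2]
          have h2 := (Real.log_neg_iff (by linarith [hv X hX.1])).1 h1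
          linarith
        exact ⟨(X, z, σ), ⟨⟨⟨⟨hz, ⟨hσ.1.le, hσ.2⟩, hX⟩, hv1⟩, heq, hb⟩, hintr.1, ht⟩, rfl⟩)
    have e : ENNReal.ofReal (11 - 9) = 2 := by norm_num
    rw [e] at this
    exact this
  have hlow : 2 * volume (Zs \ B0) ≤ ENNReal.ofReal H * volume (Tb ∪ Tg) := by
    have hm2 := hTbm.union hTgm
    rw [Measure.volume_eq_prod, Measure.prod_apply hm2, ← lintegral_const_mul _ (measurable_measure_prodMk_left hm2)]
    calc 2 * volume (Zs \ B0) = ∫⁻ z in Zs \ B0, 2 := by rw [setLIntegral_const]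
      _ ≤ ∫⁻ z in Zs \ B0, ENNReal.ofReal H * volume (Prod.mk z ⁻¹' (Tb ∪ Tg)) :=
        setLIntegral_mono' (hZc.measurableSet.diff hB0m) hrow
      _ ≤ _ := setLIntegral_le_lintegral _ _
  have hZv : volume Zs ≤ volume (Zs \ B0) + bB := by
    calc volume Zs ≤ volume ((Zs \ B0) ∪ B0) := measure_mono (by intro z hz; by_cases h : z ∈ B0 <;> simp [h, hz])
      _ ≤ _ := (measure_union_le _ _).trans (add_le_add le_rfl (hslb 0))
  calc 2 * volume Zs ≤ 2 * (volume (Zs \ B0) + bB) := by gcongr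
    _ = 2 * volume (Zs \ B0) + 2 * bB := by ring
    _ ≤ ENNReal.ofReal H * (bB + ENNReal.ofReal ℓ ^ n * volume D) + 2 * bB := by
        exact add_le_add (hlow.trans (mul_le_mul_right hup _)) le_rfl
    _ = _ := by ring

/-- growth lemma with small drift -/
lemma U3 (hn : 0 < n) (hν : 1 ≤ ν) : ∃ ε μ δ : ℝ, 0 < ε ∧ 0 < μ ∧ 0 < δ ∧
    ∀ (β : En n → ℝ≥0∞) (v : En n × ℝ → ℝ), Drift (ENNReal.ofReal ε) β →
      Sol ν β (closedBall 0 1 ×ˢ Icc 0 1) v → (∀ X ∈ closedBall 0 1 ×ˢ Icc 0 1, 0 ≤ v X) →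
      volume {X : En n × ℝ | X ∈ ball 0 1 ×ˢ Ioo 0 1 ∧ v X ≤ 1} ≤ ENNReal.ofReal μ →
      δ ≤ v (0, 1) := by
  have hν0 : 0 < ν := by linarith
  set V : ℝ≥0∞ := volume (closedBall (0 : En n) (1 / 8)) with hV
  have hV0 : 0 < V := measure_closedBall_pos _ _ (by norm_num)
  have hVt : V ≠ ∞ := measure_closedBall_lt_top.ne
  set Vr := V.toReal
  have hVr : 0 < Vr := ENNReal.toReal_pos hV0.ne' hVt
  have hVe : V = ENNReal.ofReal Vr := (ENNReal.ofReal_toReal hVt).symm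
  set a : ℝ := (2 + 4 * (n * ν * 8)) * (48 * ν * 1) ^ n with ha
  set b : ℝ := 4 * (n * ν * 8) * (2 * (ν * (3 * (n * ν * 8)) + 1) / 8) ^ n with hb
  have ha0 : 0 < a := by positivity
  have hb0 : 0 < b := by positivity
  refine ⟨Vr / (2 * a), Vr / (2 * b), Real.exp (-4), by positivity, by positivity, Real.exp_pos _, ?_⟩
  intro β v hβ hs hv hμ
  by_contra hlt
  push Not at hlt
  have h := U3core hn hν hβ hs hv hlt
  have hgen : ∀ c1 c2 c3 e m : ℝ, 0 ≤ c1 → 0 ≤ c2 → 0 ≤ c3 → 0 ≤ e → 0 ≤ m →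
      (2 + ENNReal.ofReal c1) * (ENNReal.ofReal c2 ^ n * ENNReal.ofReal e) +
        ENNReal.ofReal c1 * (ENNReal.ofReal c3 ^ n * ENNReal.ofReal m) =
      ENNReal.ofReal ((2 + c1) * c2 ^ n * e + c1 * c3 ^ n * m) := by
    intro c1 c2 c3 e m h1 h2 h3 h4 h5
    have e2 : (2:ℝ≥0∞) = ENNReal.ofReal 2 := by norm_num
    rw [e2, ← ENNReal.ofReal_add (by norm_num) h1, ← ENNReal.ofReal_pow h2, ← ENNReal.ofReal_pow h3,
      ← ENNReal.ofReal_mul (by positivity), ← ENNReal.ofReal_mul (by positivity),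
      ← ENNReal.ofReal_mul (by positivity), ← ENNReal.ofReal_mul (by positivity),
      ← ENNReal.ofReal_add (by positivity) (by positivity)]
    congr 1; ring
  have h2 : 2 * V ≤ ENNReal.ofReal (a * (Vr / (2 * a)) + b * (Vr / (2 * b))) := by
    refine (h.trans (add_le_add le_rfl (mul_le_mul_right (mul_le_mul_right hμ _) _))).trans_eq ?_
    exact hgen _ _ _ _ _ (by positivity) (by positivity) (by positivity) (by positivity) (by positivity)
  have e2 : a * (Vr / (2 * a)) + b * (Vr / (2 * b)) = Vr := by field_simp; ring
  rw [e2, hVe, show (2:ℝ≥0∞) = ENNReal.ofReal 2 by norm_num, ← ENNReal.ofReal_mul (by norm_num),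
    ENNReal.ofReal_le_ofReal_iff hVr.le] at h2
  linarith

end

section
open Asymptotics Filter Topology

variable {ν : ℝ} {β : En n → ℝ≥0∞} {v : En n × ℝ → ℝ}

lemma psc_vol (y : En n) (s : ℝ) {ρ : ℝ} (hρ : 0 < ρ) {A : Set (En n × ℝ)} (hA : MeasurableSet A) :
    ENNReal.ofReal ρ ^ (n + 2) * volume (psc y s ρ ⁻¹' A) = volume A := by
  have hm : MeasurableSet (psc y s ρ ⁻¹' A) := hA.preimage (psc_cont y s ρ).measurable
  rw [Measure.volume_eq_prod, Measure.prod_apply hm, Measure.prod_apply hA]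
  have h1 : ∀ x : En n, volume (Prod.mk x ⁻¹' (psc y s ρ ⁻¹' A)) =
      ENNReal.ofReal ((ρ ^ 2)⁻¹) * volume (Prod.mk (y + ρ • x) ⁻¹' A) := by
    intro x
    have e : Prod.mk x ⁻¹' (psc y s ρ ⁻¹' A) =
      (fun t => ρ ^ 2 * t) ⁻¹' ((fun t => s + t) ⁻¹' (Prod.mk (y + ρ • x) ⁻¹' A)) := by
      ext t; rfl
    rw [e, Real.volume_preimage_mul_left (by positivity), measure_preimage_add, abs_of_nonneg (by positivity)]
  simp_rw [h1]
  have hmm := measurable_measure_prodMk_left (ν := (volume : Measure ℝ)) hA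
  have hmm2 : Measurable (fun x : En n => volume (Prod.mk (y + ρ • x) ⁻¹' A)) :=
    hmm.comp (by fun_prop : Measurable fun x : En n => y + ρ • x)
  rw [lintegral_const_mul _ hmm2,
    ← lintegral_scale (fun x => volume (Prod.mk x ⁻¹' A)) hmm y hρ, ← mul_assoc, pow_add, mul_assoc (_ ^ n),
    ← ENNReal.ofReal_pow (n := 2) hρ.le, ← ENNReal.ofReal_mul (by positivity), mul_inv_cancel₀ (by positivity)]
  simp

/-- doubling -/
lemma Dbl (hn : 0 < n) (hν : 1 ≤ ν) (S : NNReal) : ∃ c : ℝ, 0 < c ∧ c ≤ 1 ∧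
    ∀ (N : ℕ) (β : En n → ℝ≥0∞) (v : En n × ℝ → ℝ) (y : En n) (s ρ A : ℝ), 0 < ρ → 0 ≤ A → Drift S β →
      Sol ν β (closedBall y (2 * (2 ^ N * ρ)) ×ˢ Icc s (s + ρ ^ 2 * (4 ^ N - 1) / 24)) v →
      (∀ X ∈ closedBall y (2 * (2 ^ N * ρ)) ×ˢ Icc s (s + ρ ^ 2 * (4 ^ N - 1) / 24), 0 ≤ v X) →
      (∀ x ∈ closedBall y ρ, A ≤ v (x, s)) →
      ∀ x ∈ closedBall y (2 ^ N * ρ), c ^ N * A ≤ v (x, s + ρ ^ 2 * (4 ^ N - 1) / 24) := by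
  obtain ⟨c', hc', H⟩ := Eexp (n := n) hn hν S (1 / 8)
  refine ⟨min c' 1, by positivity, min_le_right _ _, fun N => ?_⟩
  induction N with
  | zero =>
    intro β v y s ρ A hρ hA hβ hs hv h1 x hx
    simpa using h1 x (by simpa using hx)
  | succ N ih =>
    intro β v y s ρ A hρ hA hβ hs hv h1 x hx
    have h4 : (1:ℝ) ≤ 4 ^ N := one_le_pow₀ (by norm_num)
    have h2p : (0:ℝ) < 2 ^ N * ρ := by positivity
    have hρ2 : 0 < ρ ^ 2 := by positivity
    have e4 : ρ ^ 2 * (4 ^ (N + 1) - 1) / 24 = ρ ^ 2 * (4 ^ N - 1) / 24 + (2 ^ N * ρ) ^ 2 * (1 / 8) := by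
      rw [mul_pow, ← pow_mul, mul_comm N 2, pow_mul, pow_succ]; norm_num; ring
    have hnn : 0 ≤ ρ ^ 2 * (4 ^ N - 1) / 24 := by
      have : (0:ℝ) ≤ 4 ^ N - 1 := by linarith
      positivity
    have hnn2 : 0 ≤ (2 ^ N * ρ) ^ 2 * (1 / 8) := by positivity
    have e2 : (2:ℝ) ^ (N + 1) * ρ = 2 * (2 ^ N * ρ) := by rw [pow_succ]; ring
    rw [e4] at hs hv ⊢
    rw [e2] at hs hv hx
    have sub1 : closedBall y (2 * (2 ^ N * ρ)) ×ˢ Icc s (s + ρ ^ 2 * (4 ^ N - 1) / 24) ⊆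
        closedBall y (2 * (2 * (2 ^ N * ρ))) ×ˢ Icc s (s + (ρ ^ 2 * (4 ^ N - 1) / 24 + (2 ^ N * ρ) ^ 2 * (1 / 8))) :=
      prod_mono (closedBall_subset_closedBall (by linarith)) (Icc_subset_Icc_right (by linarith))
    have h3 := ih β v y s ρ A hρ hA hβ (hs.mono sub1) (fun X hX => hv X (sub1 hX)) h1
    have sub2 : closedBall y (3 * (2 ^ N * ρ)) ×ˢ Icc (s + ρ ^ 2 * (4 ^ N - 1) / 24)
        (s + ρ ^ 2 * (4 ^ N - 1) / 24 + (2 ^ N * ρ) ^ 2 * (1 / 8)) ⊆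
        closedBall y (2 * (2 * (2 ^ N * ρ))) ×ˢ Icc s (s + (ρ ^ 2 * (4 ^ N - 1) / 24 + (2 ^ N * ρ) ^ 2 * (1 / 8))) :=
      prod_mono (closedBall_subset_closedBall (by linarith)) (Icc_subset_Icc (by linarith) (by linarith))
    have h5 := H β v y (s + ρ ^ 2 * (4 ^ N - 1) / 24) (2 ^ N * ρ) (min c' 1 ^ N * A) h2p (by positivity) hβ (hs.mono sub2)
      (fun X hX => hv X (sub2 hX)) h3 x hx (s + (ρ ^ 2 * (4 ^ N - 1) / 24 + (2 ^ N * ρ) ^ 2 * (1 / 8)))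
      ⟨by linarith, by linarith⟩
    refine le_trans ?_ h5
    rw [pow_succ, mul_comm (_ ^ N), mul_assoc]
    gcongr
    exact min_le_left _ _

/-- chain along a segment -/
lemma Chain (hn : 0 < n) (hν : 1 ≤ ν) (S : NNReal) (M : ℕ) (hM : 0 < M) (T : ℝ) : ∃ c : ℝ, 0 < c ∧
    ∀ (β : En n → ℝ≥0∞) (v : En n × ℝ → ℝ) (y x' : En n) (s h r A Rd : ℝ), 0 < r → 0 ≤ A → Drift S β →
      ‖y‖ ≤ Rd - 3 * r → ‖x'‖ ≤ Rd - 3 * r → ‖x' - y‖ ≤ M * r → r ^ 2 / 8 ≤ h → h ≤ r ^ 2 * T →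
      Sol ν β (closedBall 0 Rd ×ˢ Icc s (s + M * h)) v →
      (∀ X ∈ closedBall 0 Rd ×ˢ Icc s (s + M * h), 0 ≤ v X) →
      (∀ x ∈ closedBall y r, A ≤ v (x, s)) →
      ∀ x ∈ closedBall x' r, c * A ≤ v (x, s + M * h) := by
  obtain ⟨c', hc', H⟩ := Eexp' (n := n) hn hν S T
  refine ⟨c' ^ M, by positivity, fun β v y x' s h r A Rd hr hA hβ hy hx' hd hh1 hh2 hs hv h1 => ?_⟩
  have hM' : (0:ℝ) < M := by exact_mod_cast hM
  have hh0 : 0 ≤ h := le_trans (by positivity) hh1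
  set z : ℕ → En n := fun i => y + ((i:ℝ) / M) • (x' - y) with hz
  have hT0 : 0 ≤ r ^ 2 * T := hh0.trans hh2
  have key : ∀ i : ℕ, i ≤ M → ∀ x ∈ closedBall (z i) r, c' ^ i * A ≤ v (x, s + i * h) := by
    intro i
    induction i with
    | zero =>
      intro _ x hx
      simpa using h1 x (by simpa [hz] using hx)
    | succ i ih =>
      intro hi x hx
      have hiM : (i:ℝ) + 1 ≤ M := by exact_mod_cast hi
      have hi0 : (0:ℝ) ≤ i := Nat.cast_nonneg i
      have hzi : ‖z i‖ ≤ Rd - 3 * r := by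
        have hw0 : 0 ≤ (i:ℝ) / M := by positivity
        have hw1 : (i:ℝ) / M ≤ 1 := by rw [div_le_one hM']; linarith
        have e : z i = (1 - (i:ℝ) / M) • y + ((i:ℝ) / M) • x' := by
          simp only [hz]; module
        rw [e]
        refine (norm_add_le _ _).trans ?_
        rw [norm_smul, norm_smul, Real.norm_eq_abs, Real.norm_eq_abs, abs_of_nonneg hw0,
          abs_of_nonneg (by linarith : 0 ≤ 1 - (i:ℝ) / M)]
        nlinarith
      have hih1 : 0 ≤ i * h := mul_nonneg hi0 hh0
      have hih2 : (i + 1) * h ≤ M * h := mul_le_mul_of_nonneg_right hiM hh0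
      -- use time interval up to s + (i+1) h
      have hsub : closedBall (z i) (3 * r) ×ˢ Icc (s + i * h) (s + (i + 1) * h) ⊆
          closedBall 0 Rd ×ˢ Icc s (s + M * h) := by
        refine prod_mono ?_ (Icc_subset_Icc (by linarith) (by linarith))
        refine closedBall_subset_closedBall' ?_
        rw [dist_zero_right]; linarith
      have hres := H β v (z i) (s + i * h) (s + (i + 1) * h) r (c' ^ i * A) hr (by linarith) (by positivity) hβ
        (hs.mono hsub) (fun X hX => hv X (hsub hX)) (ih (by omega)) x ?_ (s + (i + 1) * h) ⟨by linarith, le_rfl⟩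
      · push_cast
        rw [pow_succ, mul_comm (_ ^ i), mul_assoc]
        exact hres
      · rw [mem_closedBall] at hx ⊢
        have e : dist (z (i + 1)) (z i) ≤ r := by
          have e1 : z (i + 1) - z i = (1 / (M:ℝ)) • (x' - y) := by
            simp only [hz]; push_cast; module
          rw [dist_eq_norm, e1, norm_smul, Real.norm_eq_abs, abs_of_pos (by positivity), one_div, inv_mul_le_iff₀ hM']
          exact hd
        linarith [dist_triangle x (z (i + 1)) (z i)]
  intro x hx
  have := key M le_rfl x (by simpa [hz, div_self hM'.ne'] using hx)
  exact this

end

section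
open Asymptotics Filter Topology

variable {ν : ℝ}

/-- propagation of positivity from a small ball with polynomial loss -/
lemma LemP (hn : 0 < n) (hν : 1 ≤ ν) (S : NNReal) {Rd η τ0 τ1 : ℝ} (hR : 0 < Rd) (hη : 0 < η) (hτ0 : 0 < τ0) :
    ∃ (c : ℝ) (γ : ℕ), 0 < c ∧
    ∀ (β : En n → ℝ≥0∞) (v : En n × ℝ → ℝ) (y x' : En n) (s t' ρ A : ℝ), 0 < ρ → ρ ≤ 1 → 0 ≤ A → Drift S β →
      ‖y‖ ≤ Rd - η → ‖x'‖ ≤ Rd - η → τ0 ≤ t' - s → t' - s ≤ τ1 →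
      Sol ν β (closedBall 0 Rd ×ˢ Icc s t') v →
      (∀ X ∈ closedBall 0 Rd ×ˢ Icc s t', 0 ≤ v X) →
      (∀ x ∈ closedBall y ρ, A ≤ v (x, s)) → c * ρ ^ γ * A ≤ v (x', t') := by
  obtain ⟨r1, hr1, hr1a, hr1b, hr1c⟩ : ∃ r1 : ℝ, 0 < r1 ∧ r1 ≤ 1 ∧ r1 ≤ η / 3 ∧ r1 ≤ τ0 / (Rd + 1) :=
    ⟨min 1 (min (η / 3) (τ0 / (Rd + 1))), by positivity, min_le_left _ _,
      (min_le_right _ _).trans (min_le_left _ _), (min_le_right _ _).trans (min_le_right _ _)⟩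
  rw [le_div_iff₀ (by positivity)] at hr1c
  obtain ⟨cd, hcd, hcd1, HD⟩ := Dbl (n := n) hn hν S
  obtain ⟨γ, hγ⟩ := exists_pow_lt_of_lt_one hcd (by norm_num : (1:ℝ) / 2 < 1)
  set M : ℕ := ⌈4 * Rd / r1⌉₊ + 1 with hM
  have hM0 : 0 < M := by omega
  have hM1 : 4 * Rd ≤ M * r1 := by
    have := Nat.le_ceil (4 * Rd / r1)
    rw [div_le_iff₀ hr1] at this
    rw [hM]; push_cast; nlinarith
  have hM2 : M * r1 ≤ 4 * Rd + 2 * r1 := by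
    have := Nat.ceil_lt_add_one (show 0 ≤ 4 * Rd / r1 by positivity)
    have h2 : (M:ℝ) ≤ 4 * Rd / r1 + 2 := by rw [hM]; push_cast; linarith
    calc M * r1 ≤ (4 * Rd / r1 + 2) * r1 := by gcongr
      _ = _ := by field_simp
  have hMp : (1:ℝ) ≤ M := by exact_mod_cast hM0
  obtain ⟨cc, hcc, HC⟩ := Chain (n := n) hn hν S M hM0 (4 * τ1 / r1 ^ 2)
  refine ⟨cc, γ, hcc, fun β v y x' s t' ρ A hρ hρ1 hA hβ hy hx' ht1 ht2 hs hv h1 => ?_⟩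
  obtain ⟨N, hN1, hN2⟩ := exists_nat_pow_near (show 1 ≤ 1 / ρ by rw [le_div_iff₀ hρ]; linarith) (one_lt_two : (1:ℝ) < 2)
  rw [le_div_iff₀ hρ] at hN1
  rw [div_lt_iff₀ hρ, pow_succ] at hN2
  set r := 2 ^ N * (r1 * ρ) with hr
  have hre : r = r1 * (2 ^ N * ρ) := by rw [hr]; ring
  have hr0 : 0 < r := by positivity
  have hrle : r ≤ r1 := by rw [hre]; nlinarith
  have hrge : r1 ≤ 2 * r := by rw [hre]; nlinarith
  have h4 : (1:ℝ) ≤ 4 ^ N := one_le_pow₀ (by norm_num)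
  have e4 : (4:ℝ) ^ N = (2 ^ N) ^ 2 := by rw [← pow_mul, mul_comm N 2, pow_mul]; norm_num
  set d := (r1 * ρ) ^ 2 * (4 ^ N - 1) / 24 with hd
  have hd0 : 0 ≤ d := by
    have : (0:ℝ) ≤ 4 ^ N - 1 := by linarith
    positivity
  have hd1 : d ≤ r ^ 2 / 24 := by
    rw [hd, hr, mul_pow (2 ^ N), ← e4]
    have : 0 ≤ (r1 * ρ) ^ 2 := by positivity
    linarith
  have hr2 : r ^ 2 ≤ r1 := by nlinarith
  have hrτ : r1 ≤ τ0 := by nlinarith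
  have hsub : closedBall y (2 * r) ×ˢ Icc s (s + d) ⊆ closedBall 0 Rd ×ˢ Icc s t' := by
    refine prod_mono (closedBall_subset_closedBall' ?_) (Icc_subset_Icc_right (by linarith))
    rw [dist_zero_right]; linarith
  have k1 := HD N β v y s (r1 * ρ) A (by positivity) hA hβ (hs.mono hsub) (fun X hX => hv X (hsub hX))
    (fun x hx => h1 x (closedBall_subset_closedBall (by nlinarith) hx))
  have hh : s + d + M * ((t' - (s + d)) / M) = t' := by
    field_simp; ring
  have hsub2 : closedBall (0 : En n) Rd ×ˢ Icc (s + d) t' ⊆ closedBall 0 Rd ×ˢ Icc s t' :=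
    prod_mono le_rfl (Icc_subset_Icc_left (by linarith))
  have k2 := HC β v y x' (s + d) ((t' - (s + d)) / M) r (cd ^ N * A) Rd hr0 (by positivity) hβ (by linarith) (by linarith)
    (by
      have := norm_sub_le x' y
      have h3 : M * r1 ≤ M * (2 * r) := by gcongr
      linarith)
    (by
      rw [le_div_iff₀ (by positivity)]
      have h3 : r ^ 2 * M ≤ r1 * r1 * M := by
        have : r ^ 2 ≤ r1 * r1 := by rw [sq]; exact mul_le_mul hrle hrle hr0.le hr1.le
        exact mul_le_mul_of_nonneg_right this (by linarith)
      have h5 : r1 * (M * r1) ≤ r1 * (4 * Rd + 2 * r1) := mul_le_mul_of_nonneg_left hM2 hr1.le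
      have h6 : r1 * r1 ≤ r1 := mul_le_of_le_one_left hr1.le hr1a
      linarith)
    (by
      have h3 : (t' - (s + d)) / M ≤ t' - (s + d) := div_le_self (by linarith) hMp
      have h5 : τ1 = r1 ^ 2 / 4 * (4 * τ1 / r1 ^ 2) := by field_simp
      have h6 : r1 ^ 2 / 4 * (4 * τ1 / r1 ^ 2) ≤ r ^ 2 * (4 * τ1 / r1 ^ 2) := by
        have : 0 ≤ τ1 := by linarith
        have h7 : r1 ^ 2 / 4 ≤ r ^ 2 := by
          have := pow_le_pow_left₀ hr1.le hrge 2
          linarith [mul_pow 2 r 2]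
        gcongr
      linarith)
    (by rw [hh]; exact hs.mono hsub2) (by rw [hh]; exact fun X hX => hv X (hsub2 hX)) k1 x' (mem_closedBall_self hr0.le)
  rw [hh] at k2
  refine le_trans ?_ k2
  rw [mul_assoc]
  gcongr
  calc ρ ^ γ ≤ ((1 / 2) ^ N) ^ γ := by
        gcongr
        rw [div_pow, one_pow, le_div_iff₀ (by positivity)]; linarith
    _ = ((1 / 2) ^ γ) ^ N := by rw [← pow_mul, ← pow_mul, mul_comm]
    _ ≤ cd ^ N := by gcongr

end

section
open Asymptotics Filter Topology

variable {ν : ℝ}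

lemma psc_vol_le (y : En n) (s : ℝ) {ρ : ℝ} (hρ : 0 < ρ) (A : Set (En n × ℝ)) :
    ENNReal.ofReal ρ ^ (n + 2) * volume (psc y s ρ ⁻¹' A) ≤ volume A := by
  rw [← measure_toMeasurable A, ← psc_vol y s hρ (measurableSet_toMeasurable _ A)]
  gcongr
  exact subset_toMeasurable _ _

lemma lsc_indicator {f : En n → ℝ≥0∞} (hf : LowerSemicontinuous f) {U : Set (En n)} (hU : IsOpen U) :
    LowerSemicontinuous (U.indicator f) := by
  intro x z hz
  by_cases hx : x ∈ U
  · rw [indicator_of_mem hx] at hz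
    filter_upwards [hf x z hz, hU.mem_nhds hx] with w hw1 hw2
    rwa [indicator_of_mem hw2]
  · rw [indicator_of_notMem hx] at hz
    exact absurd hz (by simp)

lemma Sol.congr_drift {β β' : En n → ℝ≥0∞} {Q : Set (En n × ℝ)} {v : En n × ℝ → ℝ} (h : Sol ν β Q v)
    (hb : ∀ X ∈ Q, β X.1 = β' X.1) : Sol ν β' Q v :=
  ⟨h.cont, fun X hX => by rw [← hb X hX]; exact h.pt X hX⟩

/-- choice of a ball with small drift -/
lemma good_ball (hn : 0 < n) (S : NNReal) {ε : ℝ} (hε : 0 < ε) : ∃ N : ℕ, ∀ β : En n → ℝ≥0∞, Drift S β →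
    ∃ y : En n, ‖y‖ + 8 / 2 ^ N ≤ 1 ∧ Drift (ENNReal.ofReal ε) ((ball y (8 / 2 ^ N)).indicator β) := by
  obtain ⟨K, hK⟩ := exists_nat_gt ((S:ℝ) / ε)
  rw [div_lt_iff₀ hε] at hK
  obtain ⟨N, hN⟩ := pow_unbounded_of_one_lt (8 * (2 * K + 1) : ℝ) (one_lt_two)
  refine ⟨N, fun β hβ => ?_⟩
  set ρ : ℝ := 8 / 2 ^ N with hρ
  have hρ0 : 0 < ρ := by positivity
  have hρ1 : (2 * K + 1) * ρ ≤ 1 := by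
    rw [hρ, ← mul_div_assoc, div_le_one (by positivity)]; linarith
  set e : En n := EuclideanSpace.single ⟨0, hn⟩ 1 with he
  have hen : ‖e‖ = 1 := by simp [he]
  set z : ℕ → En n := fun j => (2 * ρ * j) • e with hz
  have hdisj : Pairwise (Function.onFun Disjoint (fun j => ball (z j) ρ)) := by
    intro i j hij
    refine ball_disjoint_ball ?_
    have h1 : z i - z j = (2 * ρ * ((i:ℝ) - j)) • e := by simp only [hz]; module
    rw [dist_eq_norm, h1, norm_smul, hen, mul_one, Real.norm_eq_abs, abs_mul, abs_of_pos (by positivity)]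
    have h2 : (1:ℝ) ≤ |(i:ℝ) - j| := by
      have : (1:ℤ) ≤ |(i:ℤ) - j| := Int.one_le_abs (by omega)
      exact_mod_cast this
    nlinarith
  have hsum : ∑ j ∈ Finset.range K, ∫⁻ x in ball (z j) ρ, β x ^ n ≤ S := by
    rw [← lintegral_biUnion_finset (fun i _ j _ hij => hdisj hij) (fun i _ => measurableSet_ball)]
    exact (setLIntegral_le_lintegral _ _).trans hβ.int
  obtain ⟨j, hj, hj2⟩ : ∃ j < K, ∫⁻ x in ball (z j) ρ, β x ^ n ≤ ENNReal.ofReal ε := by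
    by_contra! hcon
    have h3 : ∑ j ∈ Finset.range K, ENNReal.ofReal ε ≤ S :=
      le_trans (Finset.sum_le_sum fun j hj => (hcon j (Finset.mem_range.1 hj)).le) hsum
    rw [Finset.sum_const, Finset.card_range, nsmul_eq_mul] at h3
    rw [show (K:ℝ≥0∞) = ENNReal.ofReal K by simp, ← ENNReal.ofReal_mul (by positivity), ENNReal.ofReal_le_coe] at h3
    linarith
  refine ⟨z j, ?_, lsc_indicator hβ.lsc isOpen_ball, ?_⟩
  · simp only [hz]
    rw [norm_smul, hen, mul_one, Real.norm_eq_abs, abs_of_nonneg (by positivity)]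
    have : (j:ℝ) ≤ K := by exact_mod_cast hj.le
    nlinarith
  · rw [← lintegral_indicator measurableSet_ball] at hj2
    convert hj2 using 3 with x
    by_cases hx : x ∈ ball (z j) ρ
    · simp [hx]
    · simp [hx, hn.ne']

lemma LemG (hn : 0 < n) (hν : 1 ≤ ν) (S : NNReal) : ∃ μ : ℝ, 0 < μ ∧ ∀ m : ℕ, ∃ κ : ℝ, 0 < κ ∧
    ∀ (β : En n → ℝ≥0∞) (v : En n × ℝ → ℝ), Drift S β →
      Sol ν β (closedBall (0 : En n) 7 ×ˢ Icc (0:ℝ) (9 + 4 * (m:ℝ))) v →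
      (∀ X ∈ closedBall 0 7 ×ˢ Icc (0:ℝ) (9 + 4 * (m:ℝ)), 0 ≤ v X) →
      volume {X | X ∈ ball (0 : En n) 1 ×ˢ Ioo (0:ℝ) 1 ∧ v X ≤ 1} ≤ ENNReal.ofReal μ →
      ∀ X ∈ closedBall (0 : En n) 3 ×ˢ Icc (2:ℝ) (8 + 4 * (m:ℝ)), κ ≤ v X := by
  obtain ⟨ε, μ0, δ, hε, hμ0, hδ, HU⟩ := U3 (n := n) hn hν
  obtain ⟨N, HN⟩ := good_ball hn S hε
  obtain ⟨cd, hcd, hcd1, HD⟩ := Dbl (n := n) hn hν S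
  set ρ : ℝ := 8 / 2 ^ N with hρ
  have hρ0 : 0 < ρ := by positivity
  refine ⟨μ0 * (ρ / 2) ^ (n + 2), by positivity, fun m => ?_⟩
  obtain ⟨ce, hce, HE⟩ := Eexp' (n := n) hn hν S ((8 + 4 * (m:ℝ)) / 4)
  refine ⟨ce * (cd ^ N * δ), by positivity, fun β v hβ hs hv hvol => ?_⟩
  obtain ⟨y, hy1, hyd⟩ := HN β hβ
  have hy0 := norm_nonneg y
  have hm0 : (0:ℝ) ≤ 4 * m := by positivity
  have step1 : ∀ y' ∈ closedBall y (ρ / 4), δ ≤ v (y', 1) := by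
    intro y' hy'
    have hball : closedBall y' (ρ / 2) ⊆ ball y ρ := by
      refine closedBall_subset_ball' ?_
      rw [mem_closedBall] at hy'; linarith
    have hball1 : ball y ρ ⊆ ball (0 : En n) 1 := by
      refine ball_subset_ball' ?_
      rw [dist_zero_right]; linarith
    have hρ2 : (ρ / 2) ^ 2 ≤ 1 := by
      rw [sq_le_one_iff_abs_le_one, abs_of_pos (by positivity)]; linarith
    have hmx : ∀ x ∈ closedBall (0 : En n) 1, y' + (ρ / 2) • x ∈ ball y ρ := by
      intro x hx
      apply hball
      rw [mem_closedBall, dist_zero_right] at hx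
      simp only [mem_closedBall, dist_self_add_left, norm_smul, Real.norm_eq_abs, abs_of_pos (half_pos hρ0)]
      nlinarith
    have hmt : MapsTo (psc y' (1 - (ρ / 2) ^ 2) (ρ / 2)) (closedBall 0 1 ×ˢ Icc 0 1)
        (closedBall (0 : En n) 7 ×ˢ Icc (0:ℝ) (9 + 4 * (m:ℝ))) := by
      rintro ⟨x, t⟩ ⟨hx, ht⟩
      refine ⟨closedBall_subset_closedBall (by norm_num) (ball_subset_closedBall (hball1 (hmx x hx))), ?_⟩
      simp only [psc, mem_Icc] at ht ⊢
      have h1 := mul_nonneg (sq_nonneg (ρ / 2)) ht.1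
      have h2 := mul_le_mul_of_nonneg_left ht.2 (sq_nonneg (ρ / 2))
      constructor <;> linarith
    have k := HU _ _ (hyd.scale y' (half_pos hρ0))
      ((hs.scale (half_pos hρ0) hmt).congr_drift fun X hX => by
        rw [indicator_of_mem (hmx X.1 hX.1)]) (fun X hX => hv _ (hmt hX)) (by
        have h5 := psc_vol_le y' (1 - (ρ / 2) ^ 2) (half_pos hρ0) {X | X ∈ ball (0 : En n) 1 ×ˢ Ioo (0:ℝ) 1 ∧ v X ≤ 1}
        have h6 : {X | X ∈ ball (0 : En n) 1 ×ˢ Ioo (0:ℝ) 1 ∧ v (psc y' (1 - (ρ / 2) ^ 2) (ρ / 2) X) ≤ 1} ⊆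
            psc y' (1 - (ρ / 2) ^ 2) (ρ / 2) ⁻¹' {X | X ∈ ball (0 : En n) 1 ×ˢ Ioo (0:ℝ) 1 ∧ v X ≤ 1} := by
          rintro ⟨x, t⟩ ⟨⟨hx, ht⟩, hle⟩
          refine ⟨⟨hball1 (hmx x (ball_subset_closedBall hx)), ?_⟩, hle⟩
          simp only [psc, mem_Ioo] at ht ⊢
          have h0 : 0 < (ρ / 2) ^ 2 := by positivity
          have h1 := mul_pos h0 ht.1
          have h2 := mul_lt_mul_of_pos_left ht.2 h0
          constructor <;> linarith
        have h7 := (mul_le_mul_right (measure_mono (μ := volume) h6) _).trans (h5.trans hvol)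
        rw [mul_comm μ0, ENNReal.ofReal_mul (by positivity), ENNReal.ofReal_pow (half_pos hρ0).le] at h7
        rwa [ENNReal.mul_le_mul_iff_right (by simp [hρ0]) (by simp)] at h7)
    simpa [psc] using k
  have e1 : 2 ^ N * (ρ / 4) = 2 := by rw [hρ]; field_simp; norm_num
  have e4 : (4:ℝ) ^ N = (2 ^ N) ^ 2 := by rw [← pow_mul, mul_comm N 2, pow_mul]; norm_num
  have h4 : (1:ℝ) ≤ 4 ^ N := one_le_pow₀ (by norm_num)
  set d := (ρ / 4) ^ 2 * (4 ^ N - 1) / 24 with hd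
  have hd0 : 0 ≤ d := by
    have : (0:ℝ) ≤ 4 ^ N - 1 := by linarith
    positivity
  have hd1 : d ≤ 1 / 6 := by
    have : (ρ / 4) ^ 2 * 4 ^ N = 4 := by rw [e4, ← mul_pow, mul_comm, e1]; norm_num
    have h5 : 0 ≤ (ρ / 4) ^ 2 := by positivity
    rw [hd]; linarith
  have hsub : closedBall y (2 * (2 ^ N * (ρ / 4))) ×ˢ Icc 1 (1 + d) ⊆ closedBall (0 : En n) 7 ×ˢ Icc (0:ℝ) (9 + 4 * (m:ℝ)) := by
    refine prod_mono (closedBall_subset_closedBall' ?_) (Icc_subset_Icc (by linarith) (by linarith))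
    rw [dist_zero_right, e1]; linarith
  have k1 := HD N β v y 1 (ρ / 4) δ (by positivity) hδ.le hβ (hs.mono hsub) (fun X hX => hv X (hsub hX)) step1
  rw [e1] at k1
  have hsub2 : closedBall y (3 * 2) ×ˢ Icc (1 + d) (8 + 4 * (m:ℝ)) ⊆ closedBall (0 : En n) 7 ×ˢ Icc (0:ℝ) (9 + 4 * (m:ℝ)) := by
    refine prod_mono (closedBall_subset_closedBall' ?_) (Icc_subset_Icc (by linarith) (by linarith))
    rw [dist_zero_right]; linarith
  have k2 := HE β v y (1 + d) (8 + 4 * (m:ℝ)) 2 (cd ^ N * δ) two_pos (by linarith) (by positivity) hβ (hs.mono hsub2)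
    (fun X hX => hv X (hsub2 hX)) k1
  rintro ⟨x, t⟩ ⟨hx, ht⟩
  refine k2 x ?_ t ⟨by linarith [ht.1], ht.2⟩
  refine closedBall_subset_closedBall' ?_ hx
  rw [dist_zero_left]; linarith

end

section
open Asymptotics Filter Topology

lemma oneD {ι : Type*} (s h : ι → ℝ) (hh : ∀ a, 0 < h a) (m : ℕ) (hm : 0 < m) {A B : ℝ}
    (hb : ∀ a, A ≤ s a + h a ∧ s a + (m + 1) * h a ≤ B) :
    volume (⋃ a, Ioo (s a - h a) (s a)) ≤ ENNReal.ofReal (1 + 2 / m) *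
      volume (⋃ a, Ioo (s a + h a) (s a + (m + 1) * h a)) := by
  have hm' : (0:ℝ) < m := by exact_mod_cast hm
  set U : Set ℝ := ⋃ a, Ioo (s a + h a) (s a + (m + 1) * h a) with hU
  have hUo : IsOpen U := isOpen_iUnion fun a => isOpen_Ioo
  have hUb : U ⊆ Icc A B := by
    refine iUnion_subset fun a x hx => ⟨(hb a).1.trans hx.1.le, hx.2.le.trans (hb a).2⟩
  set T : Set (Set ℝ) := {C | ∃ q : ℚ, (q:ℝ) ∈ U ∧ C = connectedComponentIn U q} with hT
  have hTc : T.Countable := by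
    refine (countable_range (fun q : ℚ => connectedComponentIn U (q:ℝ))).mono ?_
    rintro C ⟨q, _, rfl⟩; exact ⟨q, rfl⟩
  have hTd : T.PairwiseDisjoint id := by
    rintro C ⟨q, hq, rfl⟩ C' ⟨q', hq', rfl⟩ hne
    simp only [Function.onFun, id]
    by_contra hcon
    rw [Set.not_disjoint_iff] at hcon
    obtain ⟨x, hx1, hx2⟩ := hcon
    exact hne ((connectedComponentIn_eq hx1).trans (connectedComponentIn_eq hx2).symm)
  have hTo : ∀ C ∈ T, IsOpen C := by
    rintro C ⟨q, _, rfl⟩; exact hUo.connectedComponentIn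
  have hTU : ∀ C ∈ T, C ⊆ U := by
    rintro C ⟨q, _, rfl⟩; exact connectedComponentIn_subset _ _
  have hTp : ∀ C ∈ T, IsPreconnected C := by
    rintro C ⟨q, _, rfl⟩; exact isPreconnected_connectedComponentIn
  have hTne : ∀ C ∈ T, C.Nonempty := by
    rintro C ⟨q, hq, rfl⟩; exact ⟨q, mem_connectedComponentIn hq⟩
  set J : Set ℝ → Set ℝ := fun C => Ioo (sInf C - 2 / m * (sSup C - sInf C)) (sSup C) with hJ
  have hcov : (⋃ a, Ioo (s a - h a) (s a)) ⊆ ⋃ C ∈ T, J C := by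
    refine iUnion_subset fun a x hx => ?_
    have hlt : s a + h a < s a + (m + 1) * h a := by nlinarith [hh a, mul_pos hm' (hh a)]
    obtain ⟨q, hq⟩ := exists_rat_btwn hlt
    have hsub : Ioo (s a + h a) (s a + (m + 1) * h a) ⊆ U := subset_iUnion (fun a => Ioo (s a + h a) (s a + (m + 1) * h a)) a
    have hqU : (q:ℝ) ∈ U := hsub hq
    have hC : connectedComponentIn U (q:ℝ) ∈ T := ⟨q, hqU, rfl⟩
    refine mem_biUnion hC ?_
    set C := connectedComponentIn U (q:ℝ)
    have hsubC : Ioo (s a + h a) (s a + (m + 1) * h a) ⊆ C :=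
      isPreconnected_Ioo.subset_connectedComponentIn hq hsub
    have hbb : BddBelow C := bddBelow_Icc.mono ((hTU C hC).trans hUb)
    have hba : BddAbove C := bddAbove_Icc.mono ((hTU C hC).trans hUb)
    have h1 : sInf C ≤ s a + h a := by
      rw [← csInf_Ioo hlt]; exact csInf_le_csInf hbb ⟨q, hq⟩ hsubC
    have h2 : s a + (m + 1) * h a ≤ sSup C := by
      rw [← csSup_Ioo hlt]; exact csSup_le_csSup hba ⟨q, hq⟩ hsubC
    have h3 : h a ≤ 1 / m * (sSup C - sInf C) := by
      rw [one_div, le_inv_mul_iff₀ hm']; linarith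
    have h4 : 2 / (m:ℝ) * (sSup C - sInf C) = 2 * (1 / m * (sSup C - sInf C)) := by ring
    refine ⟨?_, ?_⟩
    · have := hx.1; linarith
    · have := hx.2
      have := mul_pos hm' (hh a)
      linarith [hh a]
  have hvJ : ∀ C ∈ T, volume (J C) ≤ ENNReal.ofReal (1 + 2 / m) * volume C := by
    intro C hC
    have hbb : BddBelow C := bddBelow_Icc.mono ((hTU C hC).trans hUb)
    have hba : BddAbove C := bddAbove_Icc.mono ((hTU C hC).trans hUb)
    have h1 : ENNReal.ofReal (sSup C - sInf C) ≤ volume C := by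
      rw [← Real.volume_Ioo]; exact measure_mono ((show IsConnected C from ⟨hTne C hC, hTp C hC⟩).Ioo_csInf_csSup_subset hbb hba)
    rw [hJ]; simp only [Real.volume_Ioo]
    refine le_trans (le_of_eq ?_) (mul_le_mul_right h1 _)
    rw [← ENNReal.ofReal_mul (by positivity)]
    congr 1; ring
  calc volume (⋃ a, Ioo (s a - h a) (s a)) ≤ volume (⋃ C ∈ T, J C) := measure_mono hcov
    _ ≤ ∑' C : T, volume (J C) := measure_biUnion_le _ hTc _
    _ ≤ ∑' C : T, ENNReal.ofReal (1 + 2 / m) * volume (C : Set ℝ) := ENNReal.tsum_le_tsum fun C => hvJ C C.2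
    _ = ENNReal.ofReal (1 + 2 / m) * volume (⋃ C ∈ T, id C) := by
      rw [ENNReal.tsum_mul_left, measure_biUnion hTc hTd (fun C hC => (hTo C hC).measurableSet)]; rfl
    _ ≤ _ := by
      refine mul_le_mul_right (measure_mono (iUnion₂_subset hTU)) _

/-- cylinder and its later companion -/
def cylP (p : En n × ℝ × ℝ) : Set (En n × ℝ) := ball p.1 p.2.2 ×ˢ Ioo p.2.1 (p.2.1 + p.2.2 ^ 2)
def hatP (m : ℕ) (p : En n × ℝ × ℝ) : Set (En n × ℝ) :=
  ball p.1 p.2.2 ×ˢ Ioo (p.2.1 + 2 * p.2.2 ^ 2) (p.2.1 + (m + 2) * p.2.2 ^ 2)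

lemma hat_vol (P : Set (En n × ℝ × ℝ)) (m : ℕ) (hm : 0 < m) {A B : ℝ}
    (hP : ∀ p ∈ P, 0 < p.2.2 ∧ A ≤ p.2.1 + 2 * p.2.2 ^ 2 ∧ p.2.1 + (m + 2) * p.2.2 ^ 2 ≤ B) :
    volume (⋃ p ∈ P, cylP p) ≤ ENNReal.ofReal (1 + 2 / m) * volume (⋃ p ∈ P, hatP m p) := by
  have ho1 : IsOpen (⋃ p ∈ P, cylP p) := isOpen_biUnion fun p _ => isOpen_ball.prod isOpen_Ioo
  have ho2 : IsOpen (⋃ p ∈ P, hatP m p) := isOpen_biUnion fun p _ => isOpen_ball.prod isOpen_Ioo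
  rw [Measure.volume_eq_prod, Measure.prod_apply ho1.measurableSet, Measure.prod_apply ho2.measurableSet,
    ← lintegral_const_mul _ (measurable_measure_prodMk_left ho2.measurableSet)]
  refine lintegral_mono fun x => ?_
  set ι := {p : En n × ℝ × ℝ // p ∈ P ∧ x ∈ ball p.1 p.2.2}
  have e1 : Prod.mk x ⁻¹' (⋃ p ∈ P, cylP p) =
      ⋃ a : ι, Ioo ((a.1.2.1 + a.1.2.2 ^ 2) - a.1.2.2 ^ 2) (a.1.2.1 + a.1.2.2 ^ 2) := by
    ext t
    simp only [mem_preimage, mem_iUnion, cylP, mem_prod, ι, Subtype.exists, add_sub_cancel_right]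
    constructor
    · rintro ⟨p, hp, hx, ht⟩; exact ⟨p, ⟨hp, hx⟩, ht⟩
    · rintro ⟨p, ⟨hp, hx⟩, ht⟩; exact ⟨p, hp, hx, ht⟩
  have e2 : Prod.mk x ⁻¹' (⋃ p ∈ P, hatP m p) =
      ⋃ a : ι, Ioo ((a.1.2.1 + a.1.2.2 ^ 2) + a.1.2.2 ^ 2) ((a.1.2.1 + a.1.2.2 ^ 2) + (m + 1) * a.1.2.2 ^ 2) := by
    ext t
    have hc : ∀ p : En n × ℝ × ℝ, Ioo (p.2.1 + 2 * p.2.2 ^ 2) (p.2.1 + (m + 2) * p.2.2 ^ 2) =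
      Ioo ((p.2.1 + p.2.2 ^ 2) + p.2.2 ^ 2) ((p.2.1 + p.2.2 ^ 2) + (m + 1) * p.2.2 ^ 2) := fun p => by
        congr 1 <;> ring
    simp only [mem_preimage, mem_iUnion, hatP, mem_prod, ι, Subtype.exists, hc]
    constructor
    · rintro ⟨p, hp, hx, ht⟩; exact ⟨p, ⟨hp, hx⟩, ht⟩
    · rintro ⟨p, ⟨hp, hx⟩, ht⟩; exact ⟨p, hp, hx, ht⟩
  rw [e1, e2]
  refine oneD (fun a : ι => a.1.2.1 + a.1.2.2 ^ 2) (fun a => a.1.2.2 ^ 2) (fun a => ?_) m hm (A := A) (B := B) fun a => ?_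
  · have := (hP a.1 a.2.1).1; positivity
  · have := hP a.1 a.2.1
    constructor <;> linarith [this.2.1, this.2.2]

lemma vol_box (y : En n) {r : ℝ} (hr : 0 < r) (a b : ℝ) :
    volume (ball y r ×ˢ Ioo a b) = ENNReal.ofReal (r ^ n * (b - a)) * volume (ball (0 : En n) 1) := by
  rw [Measure.volume_eq_prod, Measure.prod_prod, Real.volume_Ioo, Measure.addHaar_ball_of_pos _ _ hr,
    ENNReal.ofReal_mul (by positivity)]
  simp only [finrank_euclideanSpace, Fintype.card_fin]
  ring

/-- covering lemma -/
lemma cover_vol {μ : ℝ} (hμ : 0 < μ) : ∃ c0 : ℝ, 0 < c0 ∧ c0 ≤ 1 ∧ ∀ (P : Set (En n × ℝ × ℝ)) (Γ : Set (En n × ℝ)),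
    MeasurableSet Γ → (∀ p ∈ P, 0 < p.2.2 ∧ p.2.2 ≤ 1 ∧ ENNReal.ofReal (μ * p.2.2 ^ (n + 2)) ≤ volume (cylP p \ Γ)) →
    ENNReal.ofReal c0 * volume (⋃ p ∈ P, cylP p) ≤ volume ((⋃ p ∈ P, cylP p) \ Γ) := by
  have hB0 : volume (ball (0 : En n) 1) ≠ 0 := (measure_ball_pos _ _ one_pos).ne'
  have hBt : volume (ball (0 : En n) 1) ≠ ⊤ := measure_ball_lt_top.ne
  set b := (volume (ball (0 : En n) 1)).toReal with hb
  have hb0 : 0 < b := ENNReal.toReal_pos hB0 hBt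
  have hbe : volume (ball (0 : En n) 1) = ENNReal.ofReal b := (ENNReal.ofReal_toReal hBt).symm
  refine ⟨min 1 (μ / (5 ^ n * 9 * b)), by positivity, min_le_left _ _, fun P Γ hΓ hP => ?_⟩
  obtain ⟨u, huP, hud, hucov⟩ := Vitali.exists_disjoint_subfamily_covering_enlargement cylP P (fun p => p.2.2) 2
    one_lt_two (fun p hp => (hP p hp).1.le) 1 (fun p hp => (hP p hp).2.1) (fun p hp => by
      have := (hP p hp).1
      exact (nonempty_ball.2 this).prod (nonempty_Ioo.2 (by nlinarith)))
  have huc : u.Countable := hud.countable_of_isOpen (fun p _ => isOpen_ball.prod isOpen_Ioo) (fun p hp => by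
      have := (hP p (huP hp)).1
      exact (nonempty_ball.2 this).prod (nonempty_Ioo.2 (by nlinarith)))
  set En' : En n × ℝ × ℝ → Set (En n × ℝ) := fun p =>
    ball p.1 (5 * p.2.2) ×ˢ Ioo (p.2.1 - 4 * p.2.2 ^ 2) (p.2.1 + 5 * p.2.2 ^ 2) with hE
  have hcov : (⋃ p ∈ P, cylP p) ⊆ ⋃ p ∈ u, En' p := by
    refine iUnion₂_subset fun p hp => ?_
    obtain ⟨q, hq, ⟨⟨x0, t0⟩, h0p, h0q⟩, hle⟩ := hucov p hp
    rintro ⟨x, t⟩ ⟨hx, ht⟩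
    refine mem_biUnion hq ?_
    have hp0 := (hP p hp).1
    have hq0 := (hP q (huP hq)).1
    have hsq : p.2.2 ^ 2 ≤ 4 * q.2.2 ^ 2 := by nlinarith
    simp only [cylP, mem_prod, mem_ball, mem_Ioo] at h0p h0q hx ht
    simp only [hE, mem_prod, mem_ball, mem_Ioo]
    refine ⟨?_, by linarith [h0p.2.2, h0q.2.1, ht.1], by linarith [h0p.2.1, h0q.2.2, ht.2]⟩
    have h1 := dist_triangle x p.1 q.1
    have h2 := dist_triangle p.1 x0 q.1
    rw [dist_comm p.1 x0] at h2
    linarith [h0p.1, h0q.1]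
  have hEv : ∀ p ∈ u, ENNReal.ofReal (min 1 (μ / (5 ^ n * 9 * b))) * volume (En' p) ≤ volume (cylP p \ Γ) := by
    intro p hp
    have hp0 := (hP p (huP hp)).1
    refine le_trans ?_ (hP p (huP hp)).2.2
    rw [hE]; simp only
    rw [vol_box _ (by positivity), hbe, ← ENNReal.ofReal_mul' (by positivity), ← ENNReal.ofReal_mul (by positivity)]
    refine ENNReal.ofReal_le_ofReal ?_
    calc _ ≤ μ / (5 ^ n * 9 * b) * ((5 * p.2.2) ^ n * (p.2.1 + 5 * p.2.2 ^ 2 - (p.2.1 - 4 * p.2.2 ^ 2)) * b) := by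
          have h1 : 0 ≤ p.2.1 + 5 * p.2.2 ^ 2 - (p.2.1 - 4 * p.2.2 ^ 2) := by nlinarith
          exact mul_le_mul_of_nonneg_right (min_le_right _ _) (by positivity)
      _ = _ := by
          rw [show p.2.1 + 5 * p.2.2 ^ 2 - (p.2.1 - 4 * p.2.2 ^ 2) = 9 * p.2.2 ^ 2 by ring, mul_pow, pow_add]
          field_simp
  calc _ ≤ ENNReal.ofReal (min 1 (μ / (5 ^ n * 9 * b))) * volume (⋃ p ∈ u, En' p) := by
        exact mul_le_mul_right (measure_mono hcov) _
    _ ≤ ENNReal.ofReal (min 1 (μ / (5 ^ n * 9 * b))) * ∑' p : u, volume (En' p) :=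
        mul_le_mul_right (measure_biUnion_le _ huc _) _
    _ ≤ ∑' p : u, volume (cylP (p : En n × ℝ × ℝ) \ Γ) := by
        rw [← ENNReal.tsum_mul_left]; exact ENNReal.tsum_le_tsum fun p => hEv p p.2
    _ = volume (⋃ p ∈ u, cylP p \ Γ) := by
        rw [measure_biUnion huc (fun p hp q hq hpq => (hud hp hq hpq).mono sdiff_subset sdiff_subset)
          (fun p _ => (isOpen_ball.prod isOpen_Ioo).measurableSet.diff hΓ)]
    _ ≤ _ := by
        refine measure_mono (iUnion₂_subset fun p hp => ?_)
        exact sdiff_subset_sdiff_left (subset_biUnion_of_mem (huP hp))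

/-- unit cylinder -/
def Q01 (n : ℕ) : Set (En n × ℝ) := ball 0 1 ×ˢ Ioo 0 1

lemma Q01_open : IsOpen (Q01 n) := isOpen_ball.prod isOpen_Ioo

lemma Q01_vol : volume (Q01 n) = volume (ball (0 : En n) 1) := by
  rw [Q01, vol_box _ one_pos]; simp

lemma Q01_fin : volume (Q01 n) ≠ ⊤ := by rw [Q01_vol]; exact measure_ball_lt_top.ne

lemma Q01_pos : 0 < volume.real (Q01 n) := by
  rw [Measure.real, Q01_vol]; exact ENNReal.toReal_pos (measure_ball_pos _ _ one_pos).ne' measure_ball_lt_top.ne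

/-- growth of the density set -/
lemma Grow {μ : ℝ} (hμ : 0 < μ) : ∃ (c1 r0 : ℝ) (m : ℕ), 0 < c1 ∧ 0 < r0 ∧ r0 ≤ 1 ∧ 0 < m ∧
    ∀ (P : Set (En n × ℝ × ℝ)) (Γ : Set (En n × ℝ)), MeasurableSet Γ →
    volume.real (Q01 n) / 2 ≤ volume.real Γ → Γ ⊆ ⋃ p ∈ P, cylP p →
    (∀ p ∈ P, 0 < p.2.2 ∧ p.2.2 ≤ r0 ∧ cylP p ⊆ Q01 n ∧ 0 ≤ p.2.1 ∧ p.2.1 + p.2.2 ^ 2 ≤ 1 ∧ 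
      ENNReal.ofReal (μ * p.2.2 ^ (n + 2)) ≤ volume (cylP p \ Γ)) →
    volume.real Γ + c1 ≤ volume.real ((⋃ p ∈ P, hatP m p) ∩ Q01 n) := by
  obtain ⟨c0, hc0, hc01, H0⟩ := cover_vol (n := n) hμ
  obtain ⟨m, hm⟩ := exists_nat_gt (6 / c0)
  rw [div_lt_iff₀ hc0] at hm
  have hm0 : (0:ℝ) < m := by
    by_contra hcon
    have : (m:ℝ) * c0 ≤ 0 := mul_nonpos_of_nonpos_of_nonneg (by linarith) hc0.le
    linarith
  have hmN : 0 < m := by exact_mod_cast hm0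
  set q := volume.real (Q01 n) with hq
  have hq0 : 0 < q := Q01_pos
  obtain ⟨r0, hr0, hr01, hr02⟩ : ∃ r0 : ℝ, 0 < r0 ∧ r0 ≤ 1 ∧ (m + 1) * r0 ^ 2 ≤ c0 / 12 := by
    refine ⟨min 1 (c0 / (12 * (m + 1))), by positivity, min_le_left _ _, ?_⟩
    set z := min 1 (c0 / (12 * ((m:ℝ) + 1))) with hz
    have hz0 : 0 < z := by positivity
    have h1 : z ≤ 1 := min_le_left _ _
    have h2 : z ≤ c0 / (12 * ((m:ℝ) + 1)) := min_le_right _ _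
    rw [le_div_iff₀ (by positivity)] at h2
    have h3 : z ^ 2 ≤ z := by nlinarith
    have h4 : ((m:ℝ) + 1) * z ^ 2 ≤ (m + 1) * z := by gcongr
    linarith
  refine ⟨c0 * q / 12, r0, m, by positivity, hr0, hr01, hmN, fun P Γ hΓ hΓ2 hcov hP => ?_⟩
  set F := ⋃ p ∈ P, cylP p with hF
  set Fh := ⋃ p ∈ P, hatP m p with hFh
  have hFQ : F ⊆ Q01 n := iUnion₂_subset fun p hp => (hP p hp).2.2.1
  have hFfin : volume F ≠ ⊤ := ((measure_mono hFQ).trans_lt Q01_fin.lt_top).ne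
  have k1 := H0 P Γ hΓ (fun p hp => ⟨(hP p hp).1, (hP p hp).2.1.trans hr01, (hP p hp).2.2.2.2.2⟩)
  have k1' : c0 * volume.real F ≤ volume.real (F \ Γ) := by
    have := ENNReal.toReal_mono ((measure_mono sdiff_subset).trans_lt hFfin.lt_top).ne k1
    rwa [ENNReal.toReal_mul, ENNReal.toReal_ofReal hc0.le] at this
  have k2 : volume.real Γ + volume.real (F \ Γ) = volume.real F := by
    rw [add_comm, measureReal_sdiff_add_inter hΓ hFfin |>.symm, inter_eq_self_of_subset_right hcov]
  have hhat : Fh ⊆ Q01 n ∪ ball 0 1 ×ˢ Ico (1:ℝ) (1 + (m + 1) * r0 ^ 2) := by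
    refine iUnion₂_subset fun p hp => ?_
    obtain ⟨h1, h2, h3, h4, h5, _⟩ := hP p hp
    rintro ⟨x, t⟩ ⟨hx, ht⟩
    have hxb : x ∈ ball (0 : En n) 1 := by
      have : (x, p.2.1 + p.2.2 ^ 2 / 2) ∈ cylP p := ⟨hx, by constructor <;> nlinarith⟩
      exact (h3 this).1
    have h6 : p.2.2 ^ 2 ≤ r0 ^ 2 := by gcongr
    have h7 : ((m:ℝ) + 1) * p.2.2 ^ 2 ≤ (m + 1) * r0 ^ 2 := by gcongr
    have h8 : 0 ≤ p.2.2 ^ 2 := sq_nonneg _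
    simp only [mem_Ioo] at ht
    rcases lt_or_ge t 1 with h | h
    · left; exact ⟨hxb, by simp only; nlinarith, h⟩
    · right; exact ⟨hxb, h, by simp only; linarith⟩
  have hlv : volume (ball (0 : En n) 1 ×ˢ Ico (1:ℝ) (1 + (m + 1) * r0 ^ 2)) =
      ENNReal.ofReal ((m + 1) * r0 ^ 2) * volume (ball (0 : En n) 1) := by
    rw [Measure.volume_eq_prod, Measure.prod_prod, Real.volume_Ico, mul_comm]; congr 2; ring
  have hlvr : volume.real (ball (0 : En n) 1 ×ˢ Ico (1:ℝ) (1 + (m + 1) * r0 ^ 2)) = (m + 1) * r0 ^ 2 * q := by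
    rw [Measure.real, hlv, ENNReal.toReal_mul, ENNReal.toReal_ofReal (by positivity), hq, Measure.real, Q01_vol]
  have hlf : volume (ball (0 : En n) 1 ×ˢ Ico (1:ℝ) (1 + (m + 1) * r0 ^ 2)) ≠ ⊤ := by
    rw [hlv]; exact ENNReal.mul_ne_top (by simp) measure_ball_lt_top.ne
  have hIf : volume (Fh ∩ Q01 n) ≠ ⊤ := ((measure_mono inter_subset_right).trans_lt Q01_fin.lt_top).ne
  have hsplit : Fh ⊆ (Fh ∩ Q01 n) ∪ ball 0 1 ×ˢ Ico (1:ℝ) (1 + (m + 1) * r0 ^ 2) := by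
    intro X hX
    rcases hhat hX with h | h
    · exact Or.inl ⟨hX, h⟩
    · exact Or.inr h
  have k3 : volume.real Fh ≤ volume.real (Fh ∩ Q01 n) + (m + 1) * r0 ^ 2 * q := by
    rw [← hlvr]
    exact (measureReal_mono hsplit (measure_union_lt_top hIf.lt_top hlf.lt_top).ne).trans (measureReal_union_le _ _)
  have hFhf : volume Fh ≠ ⊤ :=
    ((measure_mono hsplit).trans_lt (measure_union_lt_top hIf.lt_top hlf.lt_top)).ne
  have k4 := hat_vol P m hmN (A := 0) (B := 1 + (m + 1)) (fun p hp => by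
    obtain ⟨h1, h2, h3, h4, h5, _⟩ := hP p hp
    have h6 : p.2.2 ^ 2 ≤ 1 := by nlinarith
    have h7 : ((m:ℝ) + 1) * p.2.2 ^ 2 ≤ (m + 1) * 1 := by gcongr
    exact ⟨h1, by positivity, by linarith⟩)
  have k4' : volume.real F ≤ (1 + 2 / m) * volume.real Fh := by
    have := ENNReal.toReal_mono (ENNReal.mul_ne_top (by simp) hFhf) k4
    rwa [ENNReal.toReal_mul, ENNReal.toReal_ofReal (by positivity)] at this
  have hFg : volume.real Γ ≤ volume.real F := measureReal_mono hcov hFfin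
  set g := volume.real Γ
  set f := volume.real F
  set fh := volume.real Fh
  have k5 : (1 + c0) * g ≤ (1 + c0 / 3) * fh := by
    have h1 : (1 + c0) * g ≤ f := by nlinarith
    have h2 : 2 / (m:ℝ) ≤ c0 / 3 := by rw [div_le_iff₀ hm0]; linarith
    have h3 : 0 ≤ fh := measureReal_nonneg
    have h4 : 2 / (m:ℝ) * fh ≤ c0 / 3 * fh := by gcongr
    linarith
  have hg0 : 0 ≤ g := measureReal_nonneg
  have k6 : (1 + c0 / 3) * g ≤ fh := by
    have : (1 + c0 / 3) * ((1 + c0 / 3) * g) ≤ (1 + c0 / 3) * fh := by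
      refine le_trans ?_ k5
      rw [← mul_assoc]
      gcongr
      nlinarith
    exact le_of_mul_le_mul_left this (by positivity)
  have k7 : (m + 1) * r0 ^ 2 * q ≤ c0 / 12 * q := by gcongr
  have k8 : c0 / 3 * (q / 2) ≤ c0 / 3 * g := by gcongr
  linarith

end

section
open Asymptotics Filter Topology

variable {ν : ℝ}

/-- superlevel set in the unit cylinder -/
def Gam (v : En n × ℝ → ℝ) (A : ℝ) : Set (En n × ℝ) := {X | X ∈ Q01 n ∧ A < v X}

lemma Gam_open {v : En n × ℝ → ℝ} (A : ℝ) (hv : ContinuousOn v (Q01 n)) : IsOpen (Gam v A) :=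
  hv.isOpen_inter_preimage Q01_open isOpen_Ioi

/-- small cylinders around a point -/
def pk (X : En n × ℝ) (l : ℝ) : En n × ℝ × ℝ := ((1 - l) • X.1, (1 - l ^ 2) * X.2, l)

lemma pk_sub {X : En n × ℝ} (hX : X ∈ Q01 n) {l : ℝ} (hl : 0 < l) (hl1 : l ≤ 1) : cylP (pk X l) ⊆ Q01 n := by
  obtain ⟨hx, ht⟩ := hX
  simp only [mem_ball, dist_zero_right, mem_Ioo] at hx ht
  have hl2 : l ^ 2 ≤ 1 := by nlinarith
  rintro ⟨z, τ⟩ ⟨hz, hτ⟩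
  simp only [pk, mem_ball, mem_Ioo] at hz hτ
  refine ⟨?_, ?_, ?_⟩
  · simp only [mem_ball, dist_zero_right]
    have h1 : ‖z‖ ≤ dist z ((1 - l) • X.1) + ‖(1 - l) • X.1‖ := by
      rw [dist_eq_norm]; simpa using norm_add_le (z - (1 - l) • X.1) ((1 - l) • X.1)
    rw [norm_smul, Real.norm_eq_abs, abs_of_nonneg (by linarith)] at h1
    nlinarith
  · simp only
    have : 0 ≤ (1 - l ^ 2) * X.2 := mul_nonneg (by linarith) ht.1.le
    linarith
  · simp only
    have : (1 - l ^ 2) * X.2 ≤ (1 - l ^ 2) * 1 := mul_le_mul_of_nonneg_left ht.2.le (by linarith)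
    linarith

lemma pk_mem {X : En n × ℝ} (hX : X ∈ Q01 n) {l : ℝ} (hl : 0 < l) : X ∈ cylP (pk X l) := by
  obtain ⟨hx, ht⟩ := hX
  simp only [mem_ball, dist_zero_right, mem_Ioo] at hx ht
  have hl2 : 0 < l ^ 2 := by positivity
  refine ⟨?_, ?_, ?_⟩
  · simp only [pk, mem_ball, dist_eq_norm]
    rw [show X.1 - (1 - l) • X.1 = l • X.1 by module, norm_smul, Real.norm_eq_abs, abs_of_pos hl]
    nlinarith
  · simp only [pk]; nlinarith
  · simp only [pk]; nlinarith

/-- scaled version of `LemG` -/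
lemma LemG' (hn : 0 < n) (hν : 1 ≤ ν) (S : NNReal) : ∃ μ : ℝ, 0 < μ ∧ ∀ m : ℕ, ∃ κ : ℝ, 0 < κ ∧
    ∀ (β : En n → ℝ≥0∞) (v : En n × ℝ → ℝ), Drift S β →
      Sol ν β (closedBall (0 : En n) 7 ×ˢ Icc (0:ℝ) (9 + 4 * (m:ℝ))) v →
      (∀ X ∈ closedBall (0 : En n) 7 ×ˢ Icc (0:ℝ) (9 + 4 * (m:ℝ)), 0 ≤ v X) →
      ∀ X ∈ Q01 n, ∀ l : ℝ, 0 < l → l ≤ 1 →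
      volume (cylP (pk X l) \ Gam v 1) ≤ ENNReal.ofReal (μ * l ^ (n + 2)) →
      ∀ Z ∈ closedBall ((1 - l) • X.1) (3 * l) ×ˢ Icc ((1 - l ^ 2) * X.2 + 2 * l ^ 2) ((1 - l ^ 2) * X.2 + (8 + 4 * (m:ℝ)) * l ^ 2),
        κ ≤ v Z := by
  obtain ⟨μ, hμ, H⟩ := LemG (n := n) hn hν S
  refine ⟨μ, hμ, fun m => ?_⟩
  obtain ⟨κ, hκ, H⟩ := H m
  refine ⟨κ, hκ, fun β v hβ hs hv X hX l hl hl1 hvol => ?_⟩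
  have hX' := hX
  obtain ⟨hx, ht⟩ := hX'
  simp only [mem_ball, dist_zero_right, mem_Ioo] at hx ht
  have hl2 : 0 < l ^ 2 := by positivity
  have hl21 : l ^ 2 ≤ 1 := by nlinarith
  have hm0 : (0:ℝ) ≤ 4 * m := by positivity
  set y := (1 - l) • X.1 with hy
  set s := (1 - l ^ 2) * X.2 with hs'
  have hyn : ‖y‖ ≤ 1 - l := by
    rw [hy, norm_smul, Real.norm_eq_abs, abs_of_nonneg (by linarith)]; nlinarith
  have hs0 : 0 ≤ s := mul_nonneg (by linarith) ht.1.le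
  have hs1 : s ≤ 1 - l ^ 2 := by
    have : (1 - l ^ 2) * X.2 ≤ (1 - l ^ 2) * 1 := mul_le_mul_of_nonneg_left ht.2.le (by linarith)
    linarith
  have hmt : MapsTo (psc y s l) (closedBall (0 : En n) 7 ×ˢ Icc (0:ℝ) (9 + 4 * (m:ℝ)))
      (closedBall (0 : En n) 7 ×ˢ Icc (0:ℝ) (9 + 4 * (m:ℝ))) := by
    rintro ⟨x, t⟩ ⟨hx, ht⟩
    simp only [mem_closedBall, dist_zero_right, mem_Icc] at hx ht
    refine ⟨?_, ?_⟩
    · simp only [psc, mem_closedBall, dist_zero_right]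
      refine (norm_add_le _ _).trans ?_
      rw [norm_smul l x, Real.norm_eq_abs, abs_of_pos hl]
      nlinarith
    · simp only [psc, mem_Icc]
      have h1 := mul_nonneg hl2.le ht.1
      have h2 := mul_le_mul_of_nonneg_left ht.2 hl2.le
      have h3 : l ^ 2 * (8 + 4 * (m:ℝ)) ≤ 1 * (8 + 4 * m) := by gcongr
      constructor <;> linarith
  have k := H _ _ (hβ.scale y hl) (hs.scale hl hmt) (fun Z hZ => hv _ (hmt hZ)) (by
    have h5 := psc_vol_le y s hl (cylP (pk X l) \ Gam v 1)
    have h6 : {Z | Z ∈ ball (0 : En n) 1 ×ˢ Ioo (0:ℝ) 1 ∧ v (psc y s l Z) ≤ 1} ⊆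
        psc y s l ⁻¹' (cylP (pk X l) \ Gam v 1) := by
      rintro ⟨x, t⟩ ⟨⟨hx, ht⟩, hle⟩
      refine ⟨⟨?_, ?_⟩, fun h => absurd h.2 (by linarith)⟩
      · simp only [mem_ball, dist_zero_right] at hx
        simp only [pk, psc, mem_ball, ← hy, dist_self_add_left, norm_smul, Real.norm_eq_abs, abs_of_pos hl]
        nlinarith
      · simp only [psc, pk, mem_Ioo, ← hs'] at ht ⊢
        have h1 := mul_pos hl2 ht.1
        have h2 := mul_lt_mul_of_pos_left ht.2 hl2
        constructor <;> linarith
    have h7 := (mul_le_mul_right (measure_mono (μ := volume) h6) _).trans (h5.trans hvol)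
    rw [mul_comm μ, ENNReal.ofReal_mul (by positivity), ENNReal.ofReal_pow hl.le] at h7
    rwa [ENNReal.mul_le_mul_iff_right (by simp [hl]) (by simp)] at h7)
  rintro ⟨z, τ⟩ ⟨hz, hτ⟩
  have k2 := k (l⁻¹ • (z - y), (τ - s) / l ^ 2) ⟨by
      rw [mem_closedBall, dist_eq_norm] at hz
      simp only [mem_closedBall, dist_zero_right, norm_smul, norm_inv, Real.norm_eq_abs, abs_of_pos hl]
      rw [inv_mul_le_iff₀ hl]; linarith, by
      simp only [mem_Icc] at hτ ⊢
      rw [le_div_iff₀ hl2, div_le_iff₀ hl2]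
      constructor <;> linarith⟩
  simpa only [psc, smul_inv_smul₀ hl.ne', add_sub_cancel, mul_div_cancel₀ _ hl2.ne'] using k2

lemma WStep (hn : 0 < n) (hν : 1 ≤ ν) (S : NNReal) : ∃ c1 κ cW TW : ℝ, 0 < c1 ∧ 0 < κ ∧ 0 < cW ∧ 9 ≤ TW ∧
    ∀ (β : En n → ℝ≥0∞) (v : En n × ℝ → ℝ), Drift S β →
      Sol ν β (closedBall (0 : En n) 7 ×ˢ Icc (0:ℝ) TW) v →
      (∀ X ∈ closedBall (0 : En n) 7 ×ˢ Icc (0:ℝ) TW, 0 ≤ v X) →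
      volume.real (Q01 n) / 2 ≤ volume.real (Gam v 1) →
      (∀ X ∈ closedBall (0 : En n) 1 ×ˢ Icc (2:ℝ) 3, cW ≤ v X) ∨
        volume.real (Gam v 1) + c1 ≤ volume.real (Gam v κ) := by
  obtain ⟨μ, hμ, HG⟩ := LemG' (n := n) hn hν S
  obtain ⟨c1, r0, m, hc1, hr0, hr01, hm, HW⟩ := Grow (n := n) hμ
  obtain ⟨κ, hκ, HG⟩ := HG m
  obtain ⟨cP, γ, hcP, HP⟩ := LemP (n := n) hn hν S (Rd := 7) (η := 6) (τ0 := 1 / 2) (τ1 := 3)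
    (by norm_num) (by norm_num) (by norm_num)
  have hm0 : (0:ℝ) ≤ 4 * m := by positivity
  refine ⟨c1, κ / 2, min κ (cP * (r0 / 2) ^ γ * κ), 9 + 4 * m, hc1, by positivity, by positivity, by linarith,
    fun β v hβ hs hv hden => ?_⟩
  have hQsub : Q01 n ⊆ closedBall (0 : En n) 7 ×ˢ Icc (0:ℝ) (9 + 4 * (m:ℝ)) :=
    prod_mono (ball_subset_closedBall.trans (closedBall_subset_closedBall (by norm_num)))
      (Ioo_subset_Icc_self.trans (Icc_subset_Icc_right (by linarith)))
  have hGo : ∀ A, IsOpen (Gam v A) := fun A => Gam_open A (hs.cont.mono hQsub)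
  have hl : ∀ k : ℕ, (0:ℝ) < (1 / 2) ^ k := fun k => by positivity
  have hl1 : ∀ k : ℕ, ((1:ℝ) / 2) ^ k ≤ 1 := fun k => pow_le_one₀ (by norm_num) (by norm_num)
  by_cases hA : ∃ X ∈ Gam v 1, ∃ k : ℕ, r0 / 2 ≤ (1 / 2) ^ k ∧
    volume (cylP (pk X ((1 / 2) ^ k)) \ Gam v 1) ≤ ENNReal.ofReal (μ * ((1 / 2) ^ k) ^ (n + 2))
  · left
    obtain ⟨X, hX, k, hk, hvol⟩ := hA
    have key := HG β v hβ hs hv X hX.1 _ (hl k) (hl1 k) hvol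
    rintro ⟨x', t'⟩ ⟨hx', ht'⟩
    rcases Nat.eq_zero_or_pos k with rfl | hk0
    · refine (min_le_left _ _).trans (key _ ⟨?_, ?_⟩)
      · simp only [pow_zero, sub_self, zero_smul, mul_one]
        exact closedBall_subset_closedBall (by norm_num) hx'
      · simp only [pow_zero, one_pow, sub_self, zero_mul, mul_one, zero_add, mem_Icc] at ht' ⊢
        constructor <;> linarith
    · refine (min_le_right _ _).trans ?_
      set l : ℝ := (1 / 2) ^ k with hlk
      have hl0 : 0 < l := hl k
      have hlh : l ≤ 1 / 2 := by
        have h1 : l ≤ (1 / 2) ^ 1 := pow_le_pow_of_le_one (by norm_num : (0:ℝ) ≤ 1 / 2) (by norm_num) hk0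
        rwa [pow_one] at h1
      have hl2 : l ^ 2 ≤ 1 / 4 := by nlinarith
      have hl20 : 0 < l ^ 2 := by positivity
      obtain ⟨hx, ht⟩ := hX.1
      simp only [mem_ball, dist_zero_right, mem_Ioo] at hx ht
      have hs0 : 0 ≤ (1 - l ^ 2) * X.2 := mul_nonneg (by linarith) ht.1.le
      have hs1 : (1 - l ^ 2) * X.2 ≤ 1 - l ^ 2 := by
        have : (1 - l ^ 2) * X.2 ≤ (1 - l ^ 2) * 1 := mul_le_mul_of_nonneg_left ht.2.le (by linarith)
        linarith
      simp only [mem_closedBall, dist_zero_right, mem_Icc] at hx' ht'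
      have hsub : closedBall (0 : En n) 7 ×ˢ Icc ((1 - l ^ 2) * X.2 + 2 * l ^ 2) t' ⊆
          closedBall (0 : En n) 7 ×ˢ Icc (0:ℝ) (9 + 4 * (m:ℝ)) :=
        prod_mono le_rfl (Icc_subset_Icc (by linarith) (by linarith))
      have k2 := HP β v ((1 - l) • X.1) x' ((1 - l ^ 2) * X.2 + 2 * l ^ 2) t' l κ hl0 (hl1 k) hκ.le hβ
        (by rw [norm_smul, Real.norm_eq_abs, abs_of_nonneg (by linarith)]; nlinarith) (by linarith)
        (by linarith) (by linarith) (hs.mono hsub) (fun Z hZ => hv Z (hsub hZ))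
        (fun x hx => key _ ⟨closedBall_subset_closedBall (by linarith) hx, le_rfl, by simp only; nlinarith⟩)
      refine le_trans ?_ k2
      gcongr
  · right
    push Not at hA
    set P : Set (En n × ℝ × ℝ) := {p | ∃ X ∈ Gam v 1, ∃ k : ℕ, p = pk X ((1 / 2) ^ k) ∧ (1 / 2) ^ k ≤ r0 ∧
      ENNReal.ofReal (μ * ((1 / 2) ^ k) ^ (n + 2)) < volume (cylP (pk X ((1 / 2) ^ k)) \ Gam v 1) ∧
      volume (cylP (pk X ((1 / 2) ^ (k + 1))) \ Gam v 1) ≤ ENNReal.ofReal (μ * ((1 / 2) ^ (k + 1)) ^ (n + 2))} with hP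
    have hcov : Gam v 1 ⊆ ⋃ p ∈ P, cylP p := by
      intro X hX
      have hex : ∃ k : ℕ, volume (cylP (pk X ((1 / 2) ^ k)) \ Gam v 1) ≤ ENNReal.ofReal (μ * ((1 / 2) ^ k) ^ (n + 2)) := by
        have hc : Tendsto (fun k : ℕ => ((1:ℝ) / 2) ^ k) atTop (𝓝 0) :=
          tendsto_pow_atTop_nhds_zero_of_lt_one (by norm_num) (by norm_num)
        obtain ⟨ε, hε, hball⟩ := Metric.isOpen_iff.1 (hGo 1) X hX
        obtain ⟨k, hk⟩ := (hc.eventually_lt_const (show (0:ℝ) < ε / 2 by positivity)).exists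
        refine ⟨k, ?_⟩
        have hk : ((1:ℝ) / 2) ^ k < ε / 2 := hk
        have : cylP (pk X ((1 / 2) ^ k)) ⊆ Gam v 1 := by
          rintro ⟨z, τ⟩ hZ
          apply hball
          have h0 := pk_mem hX.1 (hl k)
          simp only [cylP, mem_prod, mem_ball, mem_Ioo, pk] at h0 hZ
          set l : ℝ := (1 / 2) ^ k
          have hl20 : l ^ 2 ≤ l := by
            have h1 : l ≤ 1 := hl1 k
            have h2 : 0 < l := hl k
            nlinarith
          rw [mem_ball, Prod.dist_eq, max_lt_iff]
          constructor
          · have h1 := dist_triangle_right z X.1 ((1 - l) • X.1)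
            simp only; linarith [hZ.1, h0.1]
          · simp only [Real.dist_eq]; rw [abs_lt]
            constructor <;> linarith [hZ.2.1, hZ.2.2, h0.2.1, h0.2.2]
        rw [diff_eq_empty.2 this]; simp
      classical
      have h1 := Nat.find_spec hex
      set k := Nat.find hex with hk
      have hlt : ((1:ℝ) / 2) ^ k < r0 / 2 := by
        by_contra hcon
        exact absurd h1 (not_le.2 (hA X hX k (not_lt.1 hcon)))
      obtain ⟨j, hj⟩ : ∃ j, k = j + 1 := by
        refine Nat.exists_eq_succ_of_ne_zero fun h0 => ?_
        rw [h0] at hlt; norm_num at hlt; linarith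
      have h2 : ¬ volume (cylP (pk X ((1 / 2) ^ j)) \ Gam v 1) ≤ ENNReal.ofReal (μ * ((1 / 2) ^ j) ^ (n + 2)) :=
        Nat.find_min hex (by omega)
      rw [hj] at h1 hlt
      refine mem_biUnion (x := pk X ((1 / 2) ^ j)) ⟨X, hX, j, rfl, ?_, not_le.1 h2, h1⟩ (pk_mem hX.1 (hl j))
      rw [pow_succ] at hlt; linarith
    have hg := HW P (Gam v 1) (hGo 1).measurableSet hden hcov (by
      rintro p ⟨X, hX, k, rfl, hk, h2, h3⟩
      obtain ⟨hx, ht⟩ := hX.1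
      simp only [mem_ball, dist_zero_right, mem_Ioo] at hx ht
      refine ⟨hl k, hk, pk_sub hX.1 (hl k) (hl1 k), ?_, ?_, h2.le⟩
      · have : (((1:ℝ) / 2) ^ k) ^ 2 ≤ 1 := pow_le_one₀ (hl k).le (hl1 k)
        exact mul_nonneg (by linarith) ht.1.le
      · have : (((1:ℝ) / 2) ^ k) ^ 2 ≤ 1 := pow_le_one₀ (hl k).le (hl1 k)
        simp only [pk]
        nlinarith)
    refine hg.trans (measureReal_mono ?_ ((measure_mono (fun X hX => hX.1)).trans_lt Q01_fin.lt_top).ne)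
    rintro ⟨z, τ⟩ ⟨hZ, hZQ⟩
    refine ⟨hZQ, lt_of_lt_of_le (half_lt_self hκ) ?_⟩
    simp only [mem_iUnion] at hZ
    obtain ⟨p, ⟨X, hX, k, rfl, hk, h2, h3⟩, hz, hτ⟩ := hZ
    have key := HG β v hβ hs hv X hX.1 _ (hl (k + 1)) (hl1 (k + 1)) h3
    obtain ⟨hx, ht⟩ := hX.1
    simp only [mem_ball, dist_zero_right, mem_Ioo] at hx ht
    set l : ℝ := (1 / 2) ^ (k + 1) with hlk
    have hll : ((1:ℝ) / 2) ^ k = 2 * l := by rw [hlk, pow_succ]; ring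
    have hl0 : 0 < l := hl (k + 1)
    simp only [pk, hll, mem_ball, mem_Ioo] at hz hτ
    apply key
    refine ⟨?_, ?_, ?_⟩
    · rw [mem_closedBall]
      have h1 := dist_triangle z ((1 - 2 * l) • X.1) ((1 - l) • X.1)
      have h4 : dist ((1 - 2 * l) • X.1) ((1 - l) • X.1) = l * ‖X.1‖ := by
        rw [dist_eq_norm, show (1 - 2 * l) • X.1 - (1 - l) • X.1 = (-l) • X.1 by module, norm_smul, norm_neg,
          Real.norm_eq_abs, abs_of_pos hl0]
      simp only
      nlinarith
    · simp only
      nlinarith [mul_pos hl0 hl0, mul_lt_mul_of_pos_left ht.2 (mul_pos hl0 hl0)]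
    · simp only
      nlinarith [mul_pos hl0 hl0, mul_pos (mul_pos hl0 hl0) ht.1]

/-- weak Harnack type inequality -/
lemma LemW (hn : 0 < n) (hν : 1 ≤ ν) (S : NNReal) : ∃ c TW : ℝ, 0 < c ∧ 9 ≤ TW ∧
    ∀ (β : En n → ℝ≥0∞) (v : En n × ℝ → ℝ), Drift S β →
      Sol ν β (closedBall (0 : En n) 7 ×ˢ Icc (0:ℝ) TW) v →
      (∀ X ∈ closedBall (0 : En n) 7 ×ˢ Icc (0:ℝ) TW, 0 ≤ v X) →
      volume.real (Q01 n) / 2 ≤ volume.real (Gam v 1) →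
      ∀ X ∈ closedBall (0 : En n) 1 ×ˢ Icc (2:ℝ) 3, c ≤ v X := by
  obtain ⟨c1, κ, cW, TW, hc1, hκ, hcW, hTW, H⟩ := WStep (n := n) hn hν S
  have key : ∀ j : ℕ, ∃ c : ℝ, 0 < c ∧ ∀ (β : En n → ℝ≥0∞) (v : En n × ℝ → ℝ), Drift S β →
      Sol ν β (closedBall (0 : En n) 7 ×ˢ Icc (0:ℝ) TW) v →
      (∀ X ∈ closedBall (0 : En n) 7 ×ˢ Icc (0:ℝ) TW, 0 ≤ v X) →
      volume.real (Q01 n) / 2 ≤ volume.real (Gam v 1) →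
      (∀ X ∈ closedBall (0 : En n) 1 ×ˢ Icc (2:ℝ) 3, c ≤ v X) ∨
        volume.real (Q01 n) / 2 + j * c1 ≤ volume.real (Gam v (κ ^ j)) := by
    intro j
    induction j with
    | zero => exact ⟨1, one_pos, fun β v _ _ _ h => Or.inr (by simpa using h)⟩
    | succ j ih =>
      obtain ⟨c, hc, ih⟩ := ih
      refine ⟨min c (κ ^ j * cW), by positivity, fun β v hβ hs hv hd => ?_⟩
      rcases ih β v hβ hs hv hd with h | h
      · exact Or.inl fun X hX => (min_le_left _ _).trans (h X hX)
      · have hkj : 0 < κ ^ j := by positivity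
        have e : ∀ A, Gam (fun X => (κ ^ j)⁻¹ * v X + 0) A = Gam v (κ ^ j * A) := fun A => by
          ext X
          simp only [Gam, add_zero, Set.mem_ofPred_eq]
          rw [lt_inv_mul_iff₀ hkj]
        have := H β (fun X => (κ ^ j)⁻¹ * v X + 0) hβ (hs.affine _ 0) (fun X hX => by
          have := hv X hX
          positivity) (by
          rw [e, mul_one]
          have : 0 ≤ j * c1 := by positivity
          linarith)
        rcases this with h2 | h2
        · left
          intro X hX
          have := h2 X hX
          rw [add_zero, le_inv_mul_iff₀ hkj] at this
          exact (min_le_right _ _).trans this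
        · right
          rw [e, e, mul_one, ← pow_succ] at h2
          push_cast
          linarith
  obtain ⟨j, hj⟩ := exists_nat_gt (volume.real (Q01 n) / c1)
  rw [div_lt_iff₀ hc1] at hj
  obtain ⟨c, hc, hk⟩ := key j
  refine ⟨c, TW, hc, hTW, fun β v hβ hs hv hd => ?_⟩
  rcases hk β v hβ hs hv hd with h | h
  · exact h
  · exfalso
    have : volume.real (Gam v (κ ^ j)) ≤ volume.real (Q01 n) :=
      measureReal_mono (fun X hX => hX.1) Q01_fin
    have := Q01_pos (n := n)
    linarith

end

section
open Asymptotics Filter Topology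

variable {ν : ℝ}

/-- distance-like weight -/
def dwt (X : En n × ℝ) : ℝ := min (3 / 2 - ‖X.1‖) (min (X.2 + 7 / 2) (-3 / 2 - X.2))

lemma dwt_cont : Continuous (dwt (n := n)) := by unfold dwt; fun_prop

lemma le_dwt {X : En n × ℝ} {d : ℝ} : d ≤ dwt X ↔ ‖X.1‖ ≤ 3 / 2 - d ∧ d - 7 / 2 ≤ X.2 ∧ X.2 ≤ -3 / 2 - d := by
  unfold dwt
  rw [le_min_iff, le_min_iff]
  constructor
  · rintro ⟨h1, h2, h3⟩; exact ⟨by linarith, by linarith, by linarith⟩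
  · rintro ⟨h1, h2, h3⟩; exact ⟨by linarith, by linarith, by linarith⟩

/-- Harnack inequality on the unit scale -/
lemma Harnack1 (hn : 0 < n) (hν : 1 ≤ ν) (S : NNReal) : ∃ N : ℝ, 0 < N ∧
    ∀ (β : En n → ℝ≥0∞) (u : En n × ℝ → ℝ), Drift S β →
      Sol ν β (ball (0 : En n) 2 ×ˢ Ioo (-4:ℝ) 0) u →
      (∀ X ∈ ball (0 : En n) 2 ×ˢ Ioo (-4:ℝ) 0, 0 ≤ u X) →
      ∀ X ∈ ball (0 : En n) 1 ×ˢ Ioo (-3:ℝ) (-2), ∀ X' ∈ ball (0 : En n) 1 ×ˢ Ioo (-1:ℝ) 0, u X ≤ N * u X' := by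
  obtain ⟨c, TW, hc, hTW, HW⟩ := LemW (n := n) hn hν S
  obtain ⟨cP, γ, hcP, HP⟩ := LemP (n := n) hn hν S (Rd := 7 / 4) (η := 1 / 4) (τ0 := 1 / 2) (τ1 := 7 / 2)
    (by norm_num) (by norm_num) (by norm_num)
  set g : ℕ := γ + 1 with hg
  set κ : ℝ := c / 4 with hκd
  have hκ : 0 < κ := by positivity
  set θ : ℝ := κ / ((g + 1) * (1 + κ)) with hθd
  have hθ : 0 < θ := by positivity
  have hgθ : (g + 1) * θ * (1 + κ) = κ := by rw [hθd]; field_simp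
  have hg0 : (0:ℝ) ≤ g := Nat.cast_nonneg g
  have hθ1 : θ < 1 := by
    have h1 : 0 ≤ g * θ * (1 + κ) := by positivity
    by_contra hcon
    push Not at hcon
    have : 1 * (1 + κ) ≤ θ * (1 + κ) := mul_le_mul_of_nonneg_right hcon (by positivity)
    linarith
  have hB : 1 ≤ (1 + κ) * (1 - θ) ^ g := by
    have h1 := one_add_mul_le_pow (show (-2:ℝ) ≤ -θ by linarith) g
    rw [← sub_eq_add_neg 1 θ] at h1
    have h2 : (1 + κ) * (1 + g * -θ) ≤ (1 + κ) * (1 - θ) ^ g := mul_le_mul_of_nonneg_left h1 (by positivity)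
    have h3 : 0 ≤ θ * (1 + κ) := by positivity
    linarith
  set ε : ℝ := θ / TW with hεd
  have hTW0 : 0 < TW := by linarith
  have hε : 0 < ε := by positivity
  have hεT : TW * ε = θ := by rw [hεd]; field_simp
  have hε9 : 9 * ε ≤ θ := by rw [← hεT]; gcongr
  set N : ℝ := 2 ^ g * (2 / (cP * ε ^ g * c)) with hN
  have hNp : 0 < N := by positivity
  refine ⟨N, hNp, fun β u hβ hs hu X hX X' hX' => ?_⟩
  have hX'u : 0 ≤ u X' := by
    refine hu X' ?_
    exact ⟨ball_subset_ball (by norm_num) hX'.1, Ioo_subset_Ioo (by norm_num) le_rfl hX'.2⟩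
  set D : Set (En n × ℝ) := closedBall (0 : En n) (3 / 2) ×ˢ Icc (-7 / 2 : ℝ) (-3 / 2) with hD
  have hDmem : ∀ Z : En n × ℝ, 0 ≤ dwt Z → Z ∈ D := by
    intro Z hZ
    rw [le_dwt] at hZ
    simp only [hD, mem_prod, mem_closedBall, dist_zero_right, mem_Icc]
    exact ⟨by linarith [hZ.1], by linarith [hZ.2.1], by linarith [hZ.2.2]⟩
  have hDsub : D ⊆ ball (0 : En n) 2 ×ˢ Ioo (-4:ℝ) 0 := by
    rintro Z hZ
    simp only [hD, mem_prod, mem_closedBall, dist_zero_right, mem_Icc] at hZ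
    simp only [mem_prod, mem_ball, dist_zero_right, mem_Ioo]
    exact ⟨by linarith [hZ.1], by linarith [hZ.2.1], by linarith [hZ.2.2]⟩
  have hdX : 1 / 2 ≤ dwt X := by
    obtain ⟨hx, ht⟩ := hX
    simp only [mem_ball, dist_zero_right, mem_Ioo] at hx ht
    rw [le_dwt]
    exact ⟨by linarith, by linarith [ht.1], by linarith [ht.2]⟩
  have hXD : X ∈ D := hDmem X (by linarith)
  have hDc : IsCompact D := (isCompact_closedBall _ _).prod isCompact_Icc
  obtain ⟨X0, hX0, hmax⟩ := hDc.exists_isMaxOn ⟨X, hXD⟩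
    ((hs.cont.mono hDsub).mul ((dwt_cont (n := n)).pow g).continuousOn)
  have hmax : ∀ Z ∈ D, u Z * dwt Z ^ g ≤ u X0 * dwt X0 ^ g := fun Z hZ => hmax hZ
  have hXΦ : u X ≤ 2 ^ g * (u X0 * dwt X0 ^ g) := by
    have h1 := hmax X hXD
    have h2 : (1 / 2 : ℝ) ^ g ≤ dwt X ^ g := by gcongr
    have h3 : u X * (1 / 2) ^ g ≤ u X * dwt X ^ g := mul_le_mul_of_nonneg_left h2 (hu X (hDsub hXD))
    have h4 : u X = 2 ^ g * (u X * (1 / 2) ^ g) := by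
      rw [mul_comm (u X), ← mul_assoc, ← mul_pow]; norm_num
    rw [h4]
    exact mul_le_mul_of_nonneg_left (h3.trans h1) (by positivity)
  set M := u X0 with hM
  set d := dwt X0 with hd
  by_cases hΦ : M * d ^ g ≤ 0
  · have : 2 ^ g * (M * d ^ g) ≤ 0 := mul_nonpos_of_nonneg_of_nonpos (by positivity) hΦ
    have h2 : 0 ≤ N * u X' := by positivity
    linarith
  push Not at hΦ
  have hM0 : 0 < M := by
    refine lt_of_le_of_ne (hu X0 (hDsub hX0)) fun h => ?_
    rw [← h] at hΦ; simp at hΦ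
  have hd00 : 0 ≤ d := by
    simp only [hD, mem_prod, mem_closedBall, dist_zero_right, mem_Icc] at hX0
    rw [hd, le_dwt]
    exact ⟨by linarith [hX0.1], by linarith [hX0.2.1], by linarith [hX0.2.2]⟩
  have hd0 : 0 < d := by
    refine lt_of_le_of_ne hd00 fun h => ?_
    rw [← h] at hΦ; simp [hg] at hΦ
  have hdd := le_dwt.1 (le_refl (dwt X0))
  rw [← hd] at hdd
  have hd1 : d ≤ 1 := by linarith [hdd.2.1, hdd.2.2]
  set ρ := ε * d with hρd
  have hρ : 0 < ρ := by positivity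
  have hρθ : 9 * ρ ≤ θ * d := by
    rw [hρd, ← mul_assoc]; gcongr
  have hρT : TW * ρ = θ * d := by rw [hρd, ← mul_assoc, hεT]
  have hθd1 : θ * d ≤ 1 := by
    have : θ * d ≤ 1 * 1 := mul_le_mul hθ1.le hd1 hd0.le (by norm_num)
    linarith
  have hρ1 : ρ ≤ 1 := by linarith
  have hρ2 : ρ ^ 2 ≤ ρ := by
    have : ρ * ρ ≤ ρ * 1 := mul_le_mul_of_nonneg_left hρ1 hρ.le
    rw [sq]; linarith
  -- near the maximum point
  have hnear : ∀ Z : En n × ℝ, ‖Z.1 - X0.1‖ ≤ θ * d → |Z.2 - X0.2| ≤ θ * d → Z ∈ D ∧ u Z ≤ (1 + κ) * M := by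
    intro Z hZ1 hZ2
    have hdZ : (1 - θ) * d ≤ dwt Z := by
      rw [abs_le] at hZ2
      have h1 : ‖Z.1‖ ≤ ‖X0.1‖ + ‖Z.1 - X0.1‖ := by
        simpa using norm_add_le X0.1 (Z.1 - X0.1)
      rw [le_dwt]
      exact ⟨by linarith [hdd.1], by linarith [hdd.2.1, hZ2.1], by linarith [hdd.2.2, hZ2.2]⟩
    have h0 : 0 ≤ (1 - θ) * d := mul_nonneg (by linarith) hd0.le
    have hZD := hDmem Z (h0.trans hdZ)
    refine ⟨hZD, ?_⟩
    have h1 := hmax Z hZD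
    have h2 : ((1 - θ) * d) ^ g ≤ dwt Z ^ g := pow_le_pow_left₀ h0 hdZ g
    have h3 : u Z * ((1 - θ) * d) ^ g ≤ M * d ^ g := (mul_le_mul_of_nonneg_left h2 (hu Z (hDsub hZD))).trans h1
    rw [mul_pow, ← mul_assoc] at h3
    have h4 : u Z * (1 - θ) ^ g ≤ M := le_of_mul_le_mul_right h3 (by positivity)
    have h5 : u Z * 1 ≤ u Z * ((1 + κ) * (1 - θ) ^ g) := mul_le_mul_of_nonneg_left hB (hu Z (hDsub hZD))
    have h6 : (1 + κ) * (u Z * (1 - θ) ^ g) ≤ (1 + κ) * M := mul_le_mul_of_nonneg_left h4 (by positivity)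
    linarith
  set s := X0.2 - ρ ^ 2 * (5 / 2) with hsd
  have hps : ∀ Z ∈ closedBall (0 : En n) 7 ×ˢ Icc (0:ℝ) TW,
      psc X0.1 s ρ Z ∈ D ∧ u (psc X0.1 s ρ Z) ≤ (1 + κ) * M := by
    intro Z hZ
    simp only [mem_prod, mem_closedBall, dist_zero_right, mem_Icc] at hZ
    apply hnear
    · simp only [psc, add_sub_cancel_left, norm_smul, Real.norm_eq_abs, abs_of_pos hρ]
      have : ρ * ‖Z.1‖ ≤ ρ * 7 := mul_le_mul_of_nonneg_left hZ.1 hρ.le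
      linarith
    · simp only [psc, hsd]
      have h1 : ρ ^ 2 * Z.2 ≤ ρ ^ 2 * TW := mul_le_mul_of_nonneg_left hZ.2.2 (by positivity)
      have h2 : 0 ≤ ρ ^ 2 * Z.2 := mul_nonneg (by positivity) hZ.2.1
      have h3 : ρ ^ 2 * TW ≤ ρ * TW := mul_le_mul_of_nonneg_right hρ2 hTW0.le
      have h4 : 0 ≤ ρ ^ 2 := by positivity
      rw [abs_le]; constructor <;> linarith
  have hS1 := hs.scale (y := X0.1) (s := s) hρ (Q' := closedBall (0 : En n) 7 ×ˢ Icc (0:ℝ) TW)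
    (fun Z hZ => hDsub (hps Z hZ).1)
  have hβ1 := hβ.scale X0.1 hρ
  have hcen : psc X0.1 s ρ ((0 : En n), (5 / 2 : ℝ)) = X0 := by
    simp only [psc, hsd, smul_zero, add_zero, sub_add_cancel]
  by_cases hdens : volume.real (Q01 n) / 2 ≤ volume.real (Gam (fun Z => (2 / M) * u (psc X0.1 s ρ Z) + 0) 1)
  · have hW := HW _ _ hβ1 (hS1.affine (2 / M) 0) (fun Z hZ => by
      have := hu _ (hDsub (hps Z hZ).1)
      positivity) hdens
    have hlow : ∀ x ∈ closedBall X0.1 ρ, c * M / 2 ≤ u (x, X0.2) := by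
      intro x hx
      rw [mem_closedBall, dist_eq_norm] at hx
      have h1 := hW (ρ⁻¹ • (x - X0.1), 5 / 2) ⟨by
        rw [mem_closedBall, dist_zero_right, norm_smul, norm_inv, Real.norm_eq_abs, abs_of_pos hρ,
          inv_mul_le_iff₀ hρ]; linarith, by norm_num, by norm_num⟩
      have h2 : psc X0.1 s ρ (ρ⁻¹ • (x - X0.1), (5 / 2 : ℝ)) = (x, X0.2) := by
        simp only [psc, hsd, sub_add_cancel, smul_smul, mul_inv_cancel₀ hρ.ne', one_smul, add_sub_cancel]
      rw [h2, add_zero, div_mul_eq_mul_div, le_div_iff₀ hM0] at h1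
      linarith
    obtain ⟨hx', ht'⟩ := hX'
    simp only [mem_ball, dist_zero_right, mem_Ioo] at hx' ht'
    have hsub : closedBall (0 : En n) (7 / 4) ×ˢ Icc X0.2 X'.2 ⊆ ball (0 : En n) 2 ×ˢ Ioo (-4:ℝ) 0 :=
      prod_mono (closedBall_subset_ball (by norm_num)) (Icc_subset_Ioo (by linarith [hdd.2.1]) ht'.2)
    have hP := HP β u X0.1 X'.1 X0.2 X'.2 ρ (c * M / 2) hρ hρ1 (by positivity) hβ (by linarith [hdd.1])
      (by linarith) (by linarith [hdd.2.2]) (by linarith [hdd.2.1]) (hs.mono hsub) (fun Z hZ => hu Z (hsub hZ)) hlow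
    have hP : cP * ρ ^ γ * (c * M / 2) ≤ u X' := hP
    have hpg : ρ ^ g ≤ ρ ^ γ := pow_le_pow_of_le_one hρ.le hρ1 (by omega)
    have h1 : cP * ρ ^ g * (c * M / 2) ≤ u X' := le_trans (by gcongr) hP
    have h2 : M * d ^ g = (2 / (cP * ε ^ g * c)) * (cP * ρ ^ g * (c * M / 2)) := by
      rw [hρd, mul_pow]; field_simp
    calc u X ≤ 2 ^ g * (M * d ^ g) := hXΦ
      _ = N * (cP * ρ ^ g * (c * M / 2)) := by rw [h2, hN]; ring
      _ ≤ N * u X' := by gcongr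
  · exfalso
    have hW := HW _ _ hβ1 (hS1.affine (-(2 / M)) (2 * (1 + κ))) (fun Z hZ => by
      have h1 := (hps Z hZ).2
      have h2 : (2 / M) * u (psc X0.1 s ρ Z) ≤ (2 / M) * ((1 + κ) * M) := by gcongr
      have h3 : (2 / M) * ((1 + κ) * M) = 2 * (1 + κ) := by field_simp
      linarith) (by
      have hcov : Q01 n ⊆ Gam (fun Z => (2 / M) * u (psc X0.1 s ρ Z) + 0) 1 ∪
          Gam (fun Z => (-(2 / M)) * u (psc X0.1 s ρ Z) + 2 * (1 + κ)) 1 := by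
        intro Z hZ
        by_cases h : 1 < (2 / M) * u (psc X0.1 s ρ Z) + 0
        · exact Or.inl ⟨hZ, h⟩
        · exact Or.inr ⟨hZ, by linarith⟩
      have hfin : ∀ v : En n × ℝ → ℝ, volume (Gam v 1) ≠ ⊤ := fun v =>
        ((measure_mono (fun X hX => hX.1)).trans_lt Q01_fin.lt_top).ne
      have h1 := measureReal_mono hcov (measure_union_lt_top (hfin _).lt_top (hfin _).lt_top).ne
      have h2 := measureReal_union_le (μ := volume) (Gam (fun Z => (2 / M) * u (psc X0.1 s ρ Z) + 0) 1)
          (Gam (fun Z => (-(2 / M)) * u (psc X0.1 s ρ Z) + 2 * (1 + κ)) 1)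
      linarith) ((0 : En n), (5 / 2 : ℝ)) ⟨by simp, by norm_num, by norm_num⟩
    rw [hcen, ← hM] at hW
    have : 2 / M * M = 2 := by field_simp
    linarith

end

section
open Asymptotics Filter Topology

variable {ν : ℝ}

/-- second order Peano expansion -/
lemma peano2 {E : Type*} [NormedAddCommGroup E] [NormedSpace ℝ E] {f : E → ℝ} {f' : E → E →L[ℝ] ℝ}
    {f'' : E →L[ℝ] E →L[ℝ] ℝ} {x : E} (hf : ∀ᶠ z in 𝓝 x, HasFDerivAt f (f' z) z) (hx : HasFDerivAt f' f'' x) :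
    (∀ v w, f'' v w = f'' w v) ∧
    (fun h : E => f (x + h) - f x - f' x h - f'' h h / 2) =o[𝓝 0] (fun h => ‖h‖ ^ 2) := by
  have hsym : ∀ v w, f'' v w = f'' w v := second_derivative_symmetric_of_eventually hf hx
  refine ⟨hsym, ?_⟩
  rw [isLittleO_iff]
  intro ε hε
  have h1 := (hasFDerivAt_iff_isLittleO_nhds_zero.1 hx)
  rw [isLittleO_iff] at h1
  have h1 := h1 hε
  have h2 : ∀ᶠ h in 𝓝 (0:E), HasFDerivAt f (f' (x + h)) (x + h) := by
    have : Tendsto (fun h : E => x + h) (𝓝 0) (𝓝 x) := by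
      have : Continuous (fun h : E => x + h) := by fun_prop
      simpa using this.tendsto 0
    exact this.eventually hf
  obtain ⟨δ, hδ, hb⟩ := Metric.eventually_nhds_iff_ball.1 (h1.and h2)
  filter_upwards [ball_mem_nhds (0:E) hδ] with h hh
  rw [mem_ball, dist_zero_right] at hh
  set g : E → ℝ := fun h => f (x + h) - f x - f' x h - f'' h h / 2 with hgd
  have hg : ∀ k ∈ closedBall (0:E) ‖h‖, HasFDerivWithinAt g (f' (x + k) - f' x - f'' k) (closedBall (0:E) ‖h‖) k := by
    intro k hk
    rw [mem_closedBall, dist_zero_right] at hk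
    have hk2 := (hb k (by rw [mem_ball, dist_zero_right]; linarith)).2
    have e1 : HasFDerivAt (fun k => f (x + k)) (f' (x + k)) k := by
      have h0 : HasFDerivAt (fun k : E => x + k) (ContinuousLinearMap.id ℝ E) k := (hasFDerivAt_id k).const_add x
      exact HasFDerivAt.congr_fderiv (hk2.comp k h0) (by ext z; simp)
    have e2 : HasFDerivAt (fun k => f'' k k) (f'' k + f''.flip k) k := by
      exact HasFDerivAt.congr_fderiv (f''.hasFDerivAt (x := k) |>.clm_apply (hasFDerivAt_id k)) (by ext z; simp)
    have e3 : HasFDerivAt g (f' (x + k) - f' x - (2:ℝ)⁻¹ • (f'' k + f''.flip k)) k := by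
      have e5 := ((e1.sub_const (f x)).sub (f' x).hasFDerivAt).sub (e2.const_smul (2:ℝ)⁻¹)
      refine e5.congr_of_eventuallyEq (Eventually.of_forall fun z => ?_)
      simp [hgd]; ring
    have e4 : (2:ℝ)⁻¹ • (f'' k + f''.flip k) = f'' k := by
      ext z
      simp only [smul_apply, add_apply, ContinuousLinearMap.flip_apply,
        hsym z k, smul_eq_mul]
      ring
    rw [e4] at e3
    exact e3.hasFDerivWithinAt
  have hbd : ∀ k ∈ closedBall (0:E) ‖h‖, ‖f' (x + k) - f' x - f'' k‖ ≤ ε * ‖h‖ := by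
    intro k hk
    rw [mem_closedBall, dist_zero_right] at hk
    have hk2 := (hb k (by rw [mem_ball, dist_zero_right]; linarith)).1
    exact hk2.trans (by gcongr)
  have := (convex_closedBall (0:E) ‖h‖).norm_image_sub_le_of_norm_hasFDerivWithin_le hg hbd
    (mem_closedBall_self (norm_nonneg h)) (show h ∈ closedBall (0:E) ‖h‖ by simp)
  have g0 : g 0 = 0 := by simp [hgd]
  rw [g0, sub_zero, sub_zero] at this
  rw [norm_pow, norm_norm]
  calc _ ≤ _ := this
    _ = _ := by ring

lemma Lrep (L : En n →L[ℝ] ℝ) (h : En n) : L h = ∑ i, L (EuclideanSpace.single i 1) * h i := by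
  have : h = ∑ i, h i • EuclideanSpace.single i (1:ℝ) := by
    ext j
    simp [Finset.sum_apply, Pi.single_apply]
  conv_lhs => rw [this]
  simp [mul_comm]

/-- gradient and Hessian -/
def gradu (u : En n × ℝ → ℝ) (X : En n × ℝ) : En n := WithLp.toLp 2 (fun i => Dx u i X)

def hessu (u : En n × ℝ → ℝ) (X : En n × ℝ) : Matrix (Fin n) (Fin n) ℝ := fun i j => Dxx u i j X

lemma C21_expand {u : En n × ℝ → ℝ} {Q : Set (En n × ℝ)} (hQ : IsOpen Q) (hu : IsC21 u Q) {X : En n × ℝ} (hX : X ∈ Q) :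
    (hessu u X).IsSymm ∧ (fun h : En n => u (X.1 + h, X.2) - u (X.1, X.2) - ⟪gradu u X, h⟫ - qf (hessu u X) h / 2)
      =o[𝓝 0] (fun h => ‖h‖ ^ 2) := by
  obtain ⟨x, t⟩ := X
  set f' : En n → En n →L[ℝ] ℝ := fun z => ∑ j, Dx u j (z, t) • EuclideanSpace.proj (𝕜 := ℝ) j with hf'
  set f'' : En n →L[ℝ] En n →L[ℝ] ℝ := ∑ j, (fderiv ℝ (fun z => Dx u j (z, t)) x).smulRight
    (EuclideanSpace.proj (𝕜 := ℝ) j) with hf''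
  have hf'a : ∀ z k, f' z k = ∑ j, Dx u j (z, t) * k j := by
    intro z k; simp [hf']
  have hf''a : ∀ h k, f'' h k = ∑ i, ∑ j, Dxx u i j (x, t) * h i * k j := by
    intro h k
    simp only [hf'', sum_apply, ContinuousLinearMap.smulRight_apply,
      smul_apply, smul_eq_mul]
    rw [Finset.sum_comm]
    refine Finset.sum_congr rfl fun j _ => ?_
    rw [Lrep, Finset.sum_mul]
    rfl
  have h1 : ∀ᶠ z in 𝓝 x, HasFDerivAt (fun z => u (z, t)) (f' z) z := by
    have : ∀ᶠ z in 𝓝 x, (z, t) ∈ Q :=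
      (Continuous.prodMk continuous_id continuous_const).continuousAt.eventually_mem (hQ.mem_nhds hX)
    filter_upwards [this] with z hz
    have h := (hu.diff_x (z, t) hz).hasFDerivAt
    refine h.congr_fderiv ?_
    ext k
    rw [hf'a, Lrep]
    rfl
  have h2 : HasFDerivAt f' f'' x := by
    refine HasFDerivAt.fun_sum fun j _ => ?_
    exact HasFDerivAt.smul_const (hu.diff_xx j (x, t) hX).hasFDerivAt (EuclideanSpace.proj (𝕜 := ℝ) j)
  obtain ⟨hs, ho⟩ := peano2 h1 h2
  constructor
  · ext i j
    have := hs (EuclideanSpace.single i 1) (EuclideanSpace.single j 1)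
    rw [hf''a, hf''a] at this
    simp at this
    rw [Matrix.transpose_apply]
    exact this.symm
  · refine ho.congr_left fun h => ?_
    rw [hf'a, hf''a]
    have : ⟪gradu u (x, t), h⟫ = ∑ j, Dx u j (x, t) * h j := by
      rw [PiLp.inner_apply]
      simp [gradu, mul_comm]
    rw [this]
    rfl

lemma Ell_compact : IsCompact (Ell n ν) := by
  have hc : IsCompact (Set.univ.pi fun _ : Fin n => Set.univ.pi fun _ : Fin n => Icc (-|ν|) |ν|) :=
    isCompact_univ_pi fun _ => isCompact_univ_pi fun _ => isCompact_Icc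
  refine hc.of_isClosed_subset ?_ ?_
  · have h1 : IsClosed {a : Matrix (Fin n) (Fin n) ℝ | (∀ ξ : Fin n → ℝ, ν⁻¹ * (∑ i, ξ i ^ 2) ≤ ∑ i, ∑ j, a i j * ξ i * ξ j)} := by
      simp only [Set.ofPred_forall]
      exact isClosed_iInter fun ξ => isClosed_le (by fun_prop) (by fun_prop)
    have h2 : IsClosed {a : Matrix (Fin n) (Fin n) ℝ | (∑ i, ∑ j, (a i j) ^ 2) ≤ ν ^ 2} :=
      isClosed_le (by fun_prop) (by fun_prop)
    exact h1.inter h2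
  · intro a ha i _ j _
    have h1 : a i j ^ 2 ≤ ν ^ 2 := by
      refine le_trans ?_ ha.2
      refine le_trans ?_ (Finset.single_le_sum (f := fun i => ∑ j, a i j ^ 2) (fun i _ => by positivity) (Finset.mem_univ i))
      exact Finset.single_le_sum (f := fun j => a i j ^ 2) (fun i _ => by positivity) (Finset.mem_univ j)
    exact abs_le.1 (sq_le_sq.1 h1)

/-- minimal residual -/
def resT (ν : ℝ) (p : ℝ × Matrix (Fin n) (Fin n) ℝ) : ℝ := sInf ((fun a => |p.1 - dotM a p.2|) '' Ell n ν)

lemma resT_cont : Continuous (resT (n := n) ν) := by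
  refine IsCompact.continuous_sInf (f := fun (p : ℝ × Matrix (Fin n) (Fin n) ℝ) a => |p.1 - dotM a p.2|) Ell_compact ?_
  change Continuous (fun q : (ℝ × Matrix (Fin n) (Fin n) ℝ) × Matrix (Fin n) (Fin n) ℝ => |q.1.1 - dotM q.2 q.1.2|)
  unfold dotM
  fun_prop

lemma resT_le {p : ℝ × Matrix (Fin n) (Fin n) ℝ} {a} (ha : a ∈ Ell n ν) : resT ν p ≤ |p.1 - dotM a p.2| :=
  csInf_le ⟨0, by rintro _ ⟨a, _, rfl⟩; positivity⟩ ⟨a, ha, rfl⟩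

lemma resT_att (p : ℝ × Matrix (Fin n) (Fin n) ℝ) (hne : (Ell n ν).Nonempty) :
    ∃ a ∈ Ell n ν, |p.1 - dotM a p.2| = resT ν p := by
  have hc : ContinuousOn (fun a : Matrix (Fin n) (Fin n) ℝ => |p.1 - dotM a p.2|) (Ell n ν) := by
    unfold dotM; fun_prop
  obtain ⟨a, ha, h⟩ := Ell_compact.exists_sInf_image_eq hne hc
  exact ⟨a, ha, h.symm⟩

end

section
open Asymptotics Filter Topology

variable {ν : ℝ}

/-- the local minimal drift -/
def drF (ν : ℝ) (u : En n × ℝ → ℝ) (X : En n × ℝ) : ℝ := resT ν (Dt u X, hessu u X) / ‖gradu u X‖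

open Classical in
/-- the minimal drift -/
def drB (ν : ℝ) (u : En n × ℝ → ℝ) (Q : Set (En n × ℝ)) (x : En n) : ℝ≥0∞ :=
  ⨆ t : ℝ, if (x, t) ∈ Q then ENNReal.ofReal (drF ν u (x, t)) else 0

lemma drF_cont {u : En n × ℝ → ℝ} {Q : Set (En n × ℝ)} (hQ : IsOpen Q) (hu : IsC21 u Q) {X : En n × ℝ} (hX : X ∈ Q)
    (hG : gradu u X ≠ 0) : ContinuousAt (drF ν u) X := by
  have hN := hQ.mem_nhds hX
  have h1 : ContinuousAt (fun X => (Dt u X, hessu u X)) X := by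
    refine (hu.cont_t.continuousAt hN).prodMk ?_
    exact continuousAt_pi.2 fun i => continuousAt_pi.2 fun j => (hu.cont_xx i j).continuousAt hN
  have h2 : ContinuousAt (gradu u) X := by
    have : ContinuousAt (fun X => fun i => Dx u i X) X := continuousAt_pi.2 fun i => (hu.cont_x i).continuousAt hN
    exact (PiLp.continuous_toLp 2 _).continuousAt.comp this
  have h3 : ContinuousAt (fun X => resT ν (Dt u X, hessu u X)) X :=
    ContinuousAt.comp (f := fun X => (Dt u X, hessu u X)) resT_cont.continuousAt h1
  exact h3.div h2.norm (norm_ne_zero_iff.2 hG)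

lemma conv_bound {u : En n × ℝ → ℝ} {Q : Set (En n × ℝ)} {a : En n × ℝ → Matrix (Fin n) (Fin n) ℝ}
    {b : En n × ℝ → En n} (ha : UnifParabolic ν a Q) (he : ∀ X ∈ Q, -Dt u X + Lop a b u X = 0) {X : En n × ℝ} (hX : X ∈ Q) :
    resT ν (Dt u X, hessu u X) ≤ ‖b X‖ * ‖gradu u X‖ := by
  refine (resT_le (a := a X) (ha X hX)).trans ?_
  have h1 := he X hX
  have h2 : Dt u X - dotM (a X) (hessu u X) = ⟪gradu u X, b X⟫ := by
    rw [PiLp.inner_apply]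
    simp only [Lop] at h1
    simp only [dotM, hessu, gradu, RCLike.inner_apply, conj_trivial]
    linarith
  simp only
  rw [h2, mul_comm]
  exact abs_real_inner_le_norm _ _

lemma conv {u : En n × ℝ → ℝ} {Q : Set (En n × ℝ)} {a : En n × ℝ → Matrix (Fin n) (Fin n) ℝ}
    {b : En n × ℝ → En n} (hQ : IsOpen Q) (hu : IsC21 u Q) (ha : UnifParabolic ν a Q)
    (he : ∀ X ∈ Q, -Dt u X + Lop a b u X = 0) {S : ℝ≥0∞} (hb : LxnLtinfPow b Q ≤ S) :
    Drift S (drB ν u Q) ∧ Sol ν (drB ν u Q) Q u := by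
  have hz : ∀ X ∈ Q, gradu u X = 0 → drF ν u X = 0 := fun X hX h => by simp [drF, h]
  have hcont : ∀ X ∈ Q, ∀ l : ℝ≥0∞, l < ENNReal.ofReal (drF ν u X) → ∀ᶠ Z in 𝓝 X, Z ∈ Q ∧ l < ENNReal.ofReal (drF ν u Z) := by
    intro X hX l hl
    have hG : gradu u X ≠ 0 := by
      intro h; rw [hz X hX h] at hl; simp at hl
    have h1 : ContinuousAt (fun Z => ENNReal.ofReal (drF ν u Z)) X :=
      ENNReal.continuous_ofReal.continuousAt.comp (drF_cont hQ hu hX hG)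
    exact Filter.Eventually.and (hQ.mem_nhds hX) (h1.eventually_const_lt hl)
  refine ⟨⟨?_, ?_⟩, hu.cont, ?_⟩
  · refine lowerSemicontinuous_iSup fun t => ?_
    intro x l hl
    by_cases hx : (x, t) ∈ Q
    · simp only [if_pos hx] at hl
      have h1 := hcont _ hx l hl
      have h2 : ContinuousAt (fun z : En n => (z, t)) x := by fun_prop
      filter_upwards [h2.eventually h1] with z hz
      rw [if_pos hz.1]; exact hz.2
    · simp only [if_neg hx] at hl
      exact absurd hl (by simp)
  · refine le_trans (lintegral_mono fun x => ?_) hb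
    simp only
    gcongr
    refine iSup_le fun t => ?_
    split_ifs with hx
    · by_contra hcon
      push Not at hcon
      have h1 := hcont _ hx _ hcon
      have h2 : ContinuousAt (fun z : ℝ => (x, z)) t := by fun_prop
      have h3 := h2.eventually h1
      have hopen : IsOpen {t | (x, t) ∈ Q} := hQ.preimage (by fun_prop : Continuous (fun t : ℝ => (x, t)))
      have h4 := ENNReal.ae_le_essSup (μ := volume.restrict {t | (x, t) ∈ Q}) (fun t => (‖b (x, t)‖₊ : ℝ≥0∞))
      rw [ae_restrict_iff' hopen.measurableSet] at h4
      have h5 := Measure.measure_pos_of_mem_nhds volume h3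
      refine h5.ne' (measure_mono_null ?_ h4)
      rintro τ ⟨hτ, hlt⟩ hcon2
      have h6 : (‖b (x, τ)‖₊ : ℝ≥0∞) ≤ _ := hcon2 hτ
      have h7 : ENNReal.ofReal (drF ν u (x, τ)) ≤ (‖b (x, τ)‖₊ : ℝ≥0∞) := by
        have h8 : drF ν u (x, τ) ≤ ‖b (x, τ)‖ := div_le_of_le_mul₀ (norm_nonneg _) (norm_nonneg _) (conv_bound ha he hτ)
        calc _ ≤ ENNReal.ofReal ‖b (x, τ)‖ := ENNReal.ofReal_le_ofReal h8
          _ = _ := ofReal_norm _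
      exact absurd (h7.trans h6) (not_le.2 hlt)
    · exact zero_le
  · intro X hX
    obtain ⟨a', ha', hT⟩ := resT_att (ν := ν) (Dt u X, hessu u X) ⟨a X, ha X hX⟩
    obtain ⟨hs, ho⟩ := C21_expand hQ hu hX
    refine ⟨Dt u X, gradu u X, hessu u X, a', ha', hs, (hu.diff_t X hX).hasDerivAt, ho, ?_⟩
    have hT : |Dt u X - dotM a' (hessu u X)| = resT ν (Dt u X, hessu u X) := hT
    rw [hT]
    have h1 : ENNReal.ofReal (drF ν u X) ≤ drB ν u Q X.1 := by
      refine le_iSup_of_le X.2 ?_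
      rw [if_pos hX]
    refine le_trans ?_ (mul_le_mul_left h1 _)
    by_cases hG : gradu u X = 0
    · have := conv_bound ha he hX
      rw [hG, norm_zero, mul_zero] at this
      rw [ENNReal.ofReal_of_nonpos this]; exact zero_le
    · have hG' : 0 < ‖gradu u X‖ := norm_pos_iff.2 hG
      rw [← ENNReal.ofReal_mul' hG'.le]
      refine ENNReal.ofReal_le_ofReal (le_of_eq ?_)
      rw [drF, div_mul_cancel₀ _ hG'.ne']

end

/-- **Interior Harnack inequality with critical drift** (Theorem 1.1). -/
theorem interior_harnack_inequality
    (n : ℕ) (hn : 0 < n) (ν S : ℝ) (hν : 1 ≤ ν) :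
    ∃ N : ℝ, 0 < N ∧
      ∀ (y : En n) (s r : ℝ) (u : En n × ℝ → ℝ)
        (a : En n × ℝ → Matrix (Fin n) (Fin n) ℝ) (b : En n × ℝ → En n),
        0 < r →
        IsC21 u (pcyl (y, s) (2 * r)) →
        ContinuousOn u (closure (pcyl (y, s) (2 * r))) →
        UnifParabolic ν a (pcyl (y, s) (2 * r)) →
        LxnLtinfPow b (pcyl (y, s) (2 * r)) ≤ ENNReal.ofReal S →
        (∀ X ∈ pcyl (y, s) (2 * r), 0 ≤ u X) →
        (∀ X ∈ pcyl (y, s) (2 * r), -Dt u X + Lop a b u X = 0) →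
        ∀ X ∈ box y r (s - 3 * r ^ 2) (s - 2 * r ^ 2),
          ∀ X' ∈ pcyl (y, s) r, u X ≤ N * u X' := by
  obtain ⟨N, hN, H⟩ := Harnack1 (n := n) hn hν S.toNNReal
  refine ⟨N, hN, fun y s r u a b hr hu _ ha hb h0 he X hX X' hX' => ?_⟩
  have hQ : IsOpen (pcyl (y, s) (2 * r)) := isOpen_ball.prod isOpen_Ioo
  obtain ⟨hβ, hs⟩ := conv hQ hu ha he hb
  have hr2 : 0 < r ^ 2 := by positivity
  have hmap : MapsTo (psc y s r) (ball (0 : En n) 2 ×ˢ Ioo (-4 : ℝ) 0) (pcyl (y, s) (2 * r)) := by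
    rintro ⟨x, t⟩ ⟨hx, ht⟩
    simp only [mem_ball, dist_zero_right, mem_Ioo] at hx ht
    refine ⟨?_, ?_, ?_⟩
    · simp only [psc, mem_ball, dist_self_add_left, norm_smul, Real.norm_eq_abs, abs_of_pos hr]
      have : r * ‖x‖ < r * 2 := mul_lt_mul_of_pos_left hx hr
      linarith
    · simp only [psc]
      have : r ^ 2 * (-4) < r ^ 2 * t := mul_lt_mul_of_pos_left ht.1 hr2
      linarith
    · simp only [psc]
      have : r ^ 2 * t < r ^ 2 * 0 := mul_lt_mul_of_pos_left ht.2 hr2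
      linarith
  have key := H _ _ (hβ.scale y hr) (hs.scale hr hmap) (fun Z hZ => h0 _ (hmap hZ))
  have hinv : ∀ Z : En n × ℝ, psc y s r (r⁻¹ • (Z.1 - y), (Z.2 - s) / r ^ 2) = Z := by
    intro Z
    have h1 : r • r⁻¹ • (Z.1 - y) = Z.1 - y := by rw [smul_smul, mul_inv_cancel₀ hr.ne', one_smul]
    have h2 : r ^ 2 * ((Z.2 - s) / r ^ 2) = Z.2 - s := by field_simp
    simp only [psc, h1, h2, add_sub_cancel]
  have hball : ∀ x ∈ ball y r, r⁻¹ • (x - y) ∈ ball (0 : En n) 1 := by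
    intro x hx
    rw [mem_ball, dist_eq_norm] at hx
    rw [mem_ball, dist_zero_right, norm_smul, norm_inv, Real.norm_eq_abs, abs_of_pos hr, inv_mul_lt_iff₀ hr]
    linarith
  have k := key (r⁻¹ • (X.1 - y), (X.2 - s) / r ^ 2) ⟨hball _ hX.1, by
      rw [lt_div_iff₀ hr2]; linarith [hX.2.1], by
      rw [div_lt_iff₀ hr2]; linarith [hX.2.2]⟩
    (r⁻¹ • (X'.1 - y), (X'.2 - s) / r ^ 2) ⟨hball _ hX'.1, by
      have h1 := hX'.2.1
      simp only at h1
      rw [lt_div_iff₀ hr2]; linarith, by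
      have h1 := hX'.2.2
      simp only at h1
      rw [div_lt_iff₀ hr2]; linarith⟩
  simp only [hinv] at k
  exact k
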